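/- For γ > √(2d) (the supercritical regime), the renormalized family of nonnegative random variables { t^{3γ/(2√(2d))} · e^{t(γ/√2 − √d)²} · M_t^γ([0,1]^d) : t ≥ 1 }, where M_t^γ(A) = ∫_A e^{γ·X_t(x) − (γ²/2)·t} dx, is tight (its family of laws on ℝ is tight); moreover, for every sequence t_n → ∞ along which the laws converge weakly to a probability measure ν on ℝ, the limit is nontrivial: ν ≠ δ_0. -/

import Mathlib

open MeasureTheory ProbabilityTheory Filter

noncomputable section



namespace SC
open scoped ENNReal

/-- standard Gaussian -/
def g1 : Measure ℝ := gaussianReal 0 1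

instance : IsProbabilityMeasure g1 := by unfold g1; infer_instance

/-- Gaussian averaging operator -/
def G (f : ℝ → ℝ≥0∞) (s : ℝ) : ℝ≥0∞ := ∫⁻ ξ, f (s + ξ) ∂g1

/-- killing above b -/
def K (b : ℝ) (f : ℝ → ℝ≥0∞) : ℝ → ℝ≥0∞ := (Set.Iic b).indicator f

/-- E[∏_{i<n} 1{S_i ≤ b_i} f(S_n)] -/
def Wk (b : ℕ → ℝ) : ℕ → (ℝ → ℝ≥0∞) → ℝ → ℝ≥0∞
  | 0, f => f
  | (n+1), f => Wk b n (K (b n) (G f))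

lemma g1_map_neg : Measure.map (fun x => -x) g1 = g1 := by
  unfold g1; rw [gaussianReal_map_neg]; simp

lemma G_mono {f g : ℝ → ℝ≥0∞} (h : f ≤ g) : G f ≤ G g := fun _ => lintegral_mono fun _ => h _

@[fun_prop]
lemma G_meas {f : ℝ → ℝ≥0∞} (h : Measurable f) : Measurable (G f) := by
  unfold G
  exact Measurable.lintegral_prod_right' (f := fun p : ℝ × ℝ => f (p.1 + p.2)) (by fun_prop)

lemma G_const (c : ℝ≥0∞) : G (fun _ => c) = fun _ => c := by
  funext s; simp [G]

lemma G_add {f g : ℝ → ℝ≥0∞} (hf : Measurable f) : G (fun x => f x + g x) = fun x => G f x + G g x := by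
  funext s; unfold G; rw [lintegral_add_left (by fun_prop)]

lemma G_const_mul {f : ℝ → ℝ≥0∞} (hf : Measurable f) (c : ℝ≥0∞) :
    G (fun x => c * f x) = fun x => c * G f x := by
  funext s; unfold G; rw [lintegral_const_mul _ (by fun_prop)]

lemma G_neg (f : ℝ → ℝ≥0∞) (hf : Measurable f) (s : ℝ) : G f s = ∫⁻ ξ, f (s - ξ) ∂g1 := by
  unfold G
  conv_lhs => rw [← g1_map_neg]
  rw [lintegral_map (by fun_prop) (by fun_prop)]
  simp [sub_eq_add_neg]

@[fun_prop]
lemma K_meas {f : ℝ → ℝ≥0∞} (b : ℝ) (h : Measurable f) : Measurable (K b f) :=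
  h.indicator measurableSet_Iic

lemma K_le (b : ℝ) (f : ℝ → ℝ≥0∞) : K b f ≤ f := Set.indicator_le_self _ _

lemma K_mono {b b' : ℝ} (hb : b ≤ b') {f g : ℝ → ℝ≥0∞} (h : ∀ x, x ≤ b → f x ≤ g x) : K b f ≤ K b' g := by
  intro x
  unfold K
  by_cases hx : x ≤ b
  · rw [Set.indicator_of_mem (by exact hx), Set.indicator_of_mem (by exact hx.trans hb)]; exact h x hx
  · rw [Set.indicator_of_notMem (by exact hx)]; simp

lemma K_of_le {b x : ℝ} (f : ℝ → ℝ≥0∞) (hx : x ≤ b) : K b f x = f x := Set.indicator_of_mem (by exact hx) _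
lemma K_of_lt {b x : ℝ} (f : ℝ → ℝ≥0∞) (hx : b < x) : K b f x = 0 := Set.indicator_of_notMem (by simpa using hx) _

lemma K_add (b : ℝ) (f g : ℝ → ℝ≥0∞) : K b (fun x => f x + g x) = fun x => K b f x + K b g x := by
  funext x; simp only [K]; exact Set.indicator_add (Set.Iic b) f g |> fun h => congrFun h x

lemma K_const_mul (b : ℝ) (f : ℝ → ℝ≥0∞) (c : ℝ≥0∞) : K b (fun x => c * f x) = fun x => c * K b f x := by
  funext x; simp only [K, Set.indicator]; split_ifs <;> simp

lemma K_K (b : ℝ) (f : ℝ → ℝ≥0∞) : K b (K b f) = K b f := by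
  unfold K; rw [Set.indicator_indicator, Set.inter_self]

@[fun_prop]
lemma Wk_meas (b : ℕ → ℝ) (n : ℕ) {f : ℝ → ℝ≥0∞} (h : Measurable f) : Measurable (Wk b n f) := by
  induction n generalizing f with
  | zero => exact h
  | succ n ih => exact ih (by fun_prop)

lemma Wk_mono {b b' : ℕ → ℝ} {n : ℕ} (hb : ∀ i < n, b i ≤ b' i) {f g : ℝ → ℝ≥0∞} (h : f ≤ g) :
    Wk b n f ≤ Wk b' n g := by
  induction n generalizing f g with
  | zero => exact h
  | succ n ih =>
    exact ih (fun i hi => hb i (by omega)) (K_mono (hb n (by omega)) fun x _ => G_mono h x)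

lemma Wk_add (b : ℕ → ℝ) (n : ℕ) {f g : ℝ → ℝ≥0∞} (hf : Measurable f) :
    Wk b n (fun x => f x + g x) = fun x => Wk b n f x + Wk b n g x := by
  induction n generalizing f g with
  | zero => rfl
  | succ n ih =>
    simp only [Wk]
    rw [G_add hf, K_add, ih (by fun_prop)]

lemma Wk_const_mul (b : ℕ → ℝ) (n : ℕ) {f : ℝ → ℝ≥0∞} (hf : Measurable f) (c : ℝ≥0∞) :
    Wk b n (fun x => c * f x) = fun x => c * Wk b n f x := by
  induction n generalizing f with
  | zero => rfl
  | succ n ih =>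
    simp only [Wk]
    rw [G_const_mul hf, K_const_mul, ih (by fun_prop)]

lemma Wk_split (b : ℕ → ℝ) (m n : ℕ) (f : ℝ → ℝ≥0∞) :
    Wk b (m + n) f = Wk b m (Wk (fun i => b (m + i)) n f) := by
  induction n generalizing f with
  | zero => rfl
  | succ n ih => rw [← Nat.add_assoc]; simp only [Wk]; rw [ih]

lemma Wk_succ' (b : ℕ → ℝ) (n : ℕ) (f : ℝ → ℝ≥0∞) :
    Wk b (n + 1) f = K (b 0) (G (Wk (fun i => b (i + 1)) n f)) := by
  rw [Nat.add_comm, Wk_split]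
  simp only [Wk, Nat.add_comm]

lemma Wk_zero (b : ℕ → ℝ) (n : ℕ) : Wk b n (fun _ => 0) = fun _ => 0 := by
  have := Wk_const_mul b n (f := fun _ => 0) (by fun_prop) 0
  simpa using this

lemma Wk_le_one (b : ℕ → ℝ) (n : ℕ) {f : ℝ → ℝ≥0∞} (hf : f ≤ fun _ => 1) : Wk b n f ≤ fun _ => 1 := by
  induction n generalizing f with
  | zero => exact hf
  | succ n ih =>
    refine ih ((K_le _ _).trans ((G_mono hf).trans ?_))
    rw [G_const]

/-- one-step facts, real integrals -/
lemma memLp_g1 (p : NNReal) : MemLp (fun x : ℝ => x) p g1 := by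
  have := memLp_id_gaussianReal (μ := 0) (v := 1) p
  exact this

lemma integrable_pow (n : ℕ) : Integrable (fun x : ℝ => x ^ n) g1 := by
  rcases Nat.eq_zero_or_pos n with rfl | h
  · simp
  have := (memLp_g1 n).integrable_norm_pow (by omega)
  refine (integrable_norm_iff (by fun_prop)).1 ?_
  simpa using this

lemma integral_x : ∫ x, x ∂g1 = 0 := by
  unfold g1; simp [integral_id_gaussianReal]

lemma integral_x2 : ∫ x, x ^ 2 ∂g1 = 1 := by
  have h := variance_id_gaussianReal (μ := 0) (v := 1)
  rw [variance_eq_sub (memLp_id_gaussianReal 2)] at h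
  simp [integral_id_gaussianReal] at h
  exact h

end SC



namespace SC
open scoped ENNReal

lemma mean_excess {z : ℝ} (hz : 0 ≤ z) :
    ∫ x, (Set.Ioi z).indicator (fun x => x - z - 1) x ∂g1 ≤ 0 := by
  unfold g1
  rw [integral_gaussianReal_eq_integral_smul (by norm_num)]
  rw [← integral_add_left_eq_self _ z]
  set F : ℝ → ℝ := fun u => gaussianPDFReal 0 1 (z + u) • (Set.Ioi z).indicator (fun x => x - z - 1) (z + u) with hF
  by_cases hIntF : Integrable F
  swap
  · rw [integral_undef hIntF]
  set c : ℝ := (√(2 * Real.pi))⁻¹ * Real.exp (-z^2/2) * Real.exp (-z) with hc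
  have hc0 : 0 ≤ c := by positivity
  have i1 : Integrable (fun u : ℝ => u * Real.exp (-(1/2) * u^2)) := integrable_mul_exp_neg_mul_sq (by norm_num)
  have i2 : Integrable (fun u : ℝ => Real.exp (-(1/2) * u^2)) := integrable_exp_neg_mul_sq (by norm_num)
  have i3 : Integrable (fun u : ℝ => c * (u * Real.exp (-(1/2) * u^2) - Real.exp (-(1/2) * u^2))) :=
    (i1.sub i2).const_mul c
  have key : ∫ u, F u ≤ ∫ u, (Set.Ioi 0).indicator (fun u : ℝ => c * (u * Real.exp (-(1/2) * u^2) - Real.exp (-(1/2) * u^2))) u := by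
    refine integral_mono hIntF (i3.indicator measurableSet_Ioi) ?_
    intro u
    simp only [hF]
    by_cases hu : 0 < u
    · rw [Set.indicator_of_mem (by simpa using hu), Set.indicator_of_mem (by simpa using hu)]
      have e1 : gaussianPDFReal 0 1 (z + u) = (√(2 * Real.pi))⁻¹ * Real.exp (-z^2/2) * Real.exp (-(1/2) * u^2) * Real.exp (-(z*u)) := by
        rw [gaussianPDFReal]
        simp only [mul_assoc, ← Real.exp_add]
        norm_num
        left; ring
      rw [e1, hc]
      have e2 : Real.exp (-(z*u)) * (u - 1) ≤ Real.exp (-z) * (u-1) := by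
        rcases le_total 1 u with h | h
        · apply mul_le_mul_of_nonneg_right _ (by linarith)
          apply Real.exp_le_exp.2; nlinarith
        · apply mul_le_mul_of_nonpos_right _ (by linarith)
          apply Real.exp_le_exp.2; nlinarith
      have e3 : 0 ≤ (√(2 * Real.pi))⁻¹ * Real.exp (-z^2/2) * Real.exp (-(1/2) * u^2) := by positivity
      have := mul_le_mul_of_nonneg_left e2 e3
      simp only [smul_eq_mul]
      calc _ = (√(2 * Real.pi))⁻¹ * Real.exp (-z^2/2) * Real.exp (-(1/2) * u^2) * (Real.exp (-(z*u)) * (u - 1)) := by ring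
        _ ≤ _ := this
        _ = _ := by ring
    · rw [Set.indicator_of_notMem (by simpa using hu), Set.indicator_of_notMem (by simpa using hu)]
      simp
  refine key.trans ?_
  rw [integral_indicator measurableSet_Ioi, integral_const_mul, integral_sub i1.integrableOn i2.integrableOn,
    integral_gaussian_Ioi]
  have e4 : ∫ u in Set.Ioi (0:ℝ), u * Real.exp (-(1/2) * u^2) = 1 := by
    have := integral_mul_cexp_neg_mul_sq (b := (1/2 : ℂ)) (by norm_num)
    have h2 : ∫ r in Set.Ioi (0:ℝ), ((r * Real.exp (-(1/2) * r^2) : ℝ) : ℂ) = 1 := by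
      push_cast
      rw [this]; norm_num
    rw [integral_complex_ofReal] at h2
    exact_mod_cast h2
  rw [e4]
  have : (2:ℝ) ≤ √(Real.pi / (1/2)) := by
    apply Real.le_sqrt_of_sq_le
    have := Real.pi_gt_three
    norm_num; linarith
  nlinarith

lemma G_sym (f : ℝ → ℝ≥0∞) (hf : Measurable f) (x : ℝ) :
    2 * G f x = ∫⁻ ξ, (f (x + ξ) + f (x - ξ)) ∂g1 := by
  rw [two_mul]
  nth_rw 2 [G_neg f hf]
  rw [lintegral_add_left (by fun_prop)]; rfl

lemma lint_ofReal {f : ℝ → ℝ} (hf : Integrable f g1) (h0 : ∀ x, 0 ≤ f x) :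
    ∫⁻ x, ENNReal.ofReal (f x) ∂g1 = ENNReal.ofReal (∫ x, f x ∂g1) :=
  (ofReal_integral_eq_lintegral_ofReal hf (ae_of_all _ h0)).symm

lemma int_quad (a b c : ℝ) : ∫ x, (a + b * x + c * x^2) ∂g1 = a + c := by
  have h1 : Integrable (fun x : ℝ => x) g1 := by simpa using integrable_pow 1
  have h2 := integrable_pow 2
  rw [integral_add, integral_add, integral_const_mul, integral_const_mul, integral_x, integral_x2]
  · simp
  · exact integrable_const _
  · exact h1.const_mul _
  · exact (integrable_const _).add (h1.const_mul _)
  · exact h2.const_mul _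

lemma int_quad' (a b c : ℝ) : Integrable (fun x => (a + b * x + c * x^2)) g1 := by
  have h1 : Integrable (fun x : ℝ => x) g1 := by simpa using integrable_pow 1
  have h2 := integrable_pow 2
  exact ((integrable_const _).add (h1.const_mul _)).add (h2.const_mul _)

lemma two_mul_cancel {a b : ℝ≥0∞} (h : 2 * a ≤ 2 * b) : a ≤ b :=
  (ENNReal.mul_le_mul_iff_right (by norm_num) (by norm_num)).1 h

/-- potentials -/
def pot (B : ℝ) (n : ℕ) (s : ℝ) : ℝ≥0∞ := ENNReal.ofReal ((B - s) ^ n)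
def pot1 (B : ℝ) (s : ℝ) : ℝ≥0∞ := ENNReal.ofReal (B - s + 1)

@[fun_prop] lemma pot_meas (B n) : Measurable (pot B n) := by unfold pot; fun_prop
@[fun_prop] lemma pot1_meas (B) : Measurable (pot1 B) := by unfold pot1; fun_prop

lemma K_pot (B : ℝ) (n : ℕ) (hn : n ≠ 0) (s : ℝ) : K B (pot B n) s = ENNReal.ofReal ((max (B - s) 0) ^ n) := by
  unfold pot
  rcases le_or_gt s B with h | h
  · rw [K_of_le _ h, max_eq_left (by linarith)]
  · rw [K_of_lt _ h, max_eq_right (by linarith)]; simp [hn]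

lemma step_one {B x : ℝ} (hx : x ≤ B) : G (K B (pot1 B)) x ≤ pot1 B x := by
  have hi : Integrable (fun ξ : ℝ => (Set.Ioi (B - x)).indicator (fun ξ => ξ - (B-x) - 1) ξ) g1 := by
    have := int_quad' (-(B-x)-1) 1 0
    refine Integrable.indicator ?_ measurableSet_Ioi
    exact this.congr (ae_of_all _ fun ξ => by ring)
  have hq := int_quad' (B-x+1) (-1) 0
  have e : ∀ ξ, K B (pot1 B) (x + ξ) = ENNReal.ofReal ((B - x + 1 + (-1) * ξ + 0 * ξ^2) + (Set.Ioi (B - x)).indicator (fun ξ => ξ - (B-x) - 1) ξ) := by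
    intro ξ
    unfold pot1
    rcases le_or_gt (x + ξ) B with h | h
    · rw [K_of_le _ h, Set.indicator_of_notMem (by simp; linarith)]; congr 1; ring
    · rw [K_of_lt _ h, Set.indicator_of_mem (by simp; linarith)]; symm; apply ENNReal.ofReal_of_nonpos; linarith
  unfold G
  simp_rw [e]
  rw [lint_ofReal (by exact hq.add hi), integral_add hq hi, int_quad]
  · unfold pot1
    apply ENNReal.ofReal_le_ofReal
    have := mean_excess (z := B - x) (by linarith)
    linarith
  · intro ξ
    rcases le_or_gt (x + ξ) B with h | h
    · rw [Set.indicator_of_notMem (by simp; linarith)]; linarith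
    · rw [Set.indicator_of_mem (by simp; linarith)]; linarith

lemma step_two_lower {B x : ℝ} (hx : x ≤ B) : pot B 2 x + ENNReal.ofReal (1/2) ≤ G (K B (pot B 2)) x := by
  apply two_mul_cancel
  rw [G_sym _ (by fun_prop)]
  have : 2 * (pot B 2 x + ENNReal.ofReal (1/2)) = ∫⁻ ξ, ENNReal.ofReal (2*(B-x)^2 + 0 * ξ + 1 * ξ^2) ∂g1 := by
    rw [lint_ofReal (int_quad' _ _ _) (fun ξ => by nlinarith [sq_nonneg (B-x), sq_nonneg ξ]), int_quad, pot, ← ENNReal.ofReal_add (by positivity) (by positivity),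
      ← ENNReal.ofReal_ofNat, ← ENNReal.ofReal_mul (by positivity)]
    congr 1; ring
  rw [this]
  refine lintegral_mono fun ξ => ?_
  simp only
  rw [K_pot _ _ (by norm_num), K_pot _ _ (by norm_num), ← ENNReal.ofReal_add (by positivity) (by positivity)]
  apply ENNReal.ofReal_le_ofReal
  rcases le_total (B - (x + ξ)) 0 with h1 | h1 <;> rcases le_total (B - (x - ξ)) 0 with h2 | h2
  · rw [max_eq_right h1, max_eq_right h2]; nlinarith
  · rw [max_eq_right h1, max_eq_left h2]; nlinarith
  · rw [max_eq_left h1, max_eq_right h2]; nlinarith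
  · rw [max_eq_left h1, max_eq_left h2]; nlinarith

lemma step_two_upper {B x : ℝ} : G (K B (pot B 2)) x ≤ pot B 2 x + 1 := by
  have : pot B 2 x + 1 = ∫⁻ ξ, ENNReal.ofReal ((B-(x+ξ))^2) ∂g1 := by
    have := lint_ofReal (f := fun ξ => (B-(x+ξ))^2) (by convert int_quad' ((B-x)^2) (-2*(B-x)) 1 using 2; ring) (fun _ => by positivity)
    rw [this]
    have h2 : ∫ ξ, (B-(x+ξ))^2 ∂g1 = (B-x)^2 + 1 := by
      rw [← int_quad ((B-x)^2) (-2*(B-x)) 1]; congr 1; funext ξ; ring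
    rw [h2, ENNReal.ofReal_add (by positivity) (by norm_num), pot]; simp
  rw [this]
  refine lintegral_mono fun ξ => ?_
  exact K_le _ _ _

lemma step_one_lower {B x : ℝ} : pot B 1 x ≤ G (K B (pot B 1)) x := by
  rcases le_or_gt B x with h | h
  · unfold pot; rw [ENNReal.ofReal_of_nonpos (by simpa using h)]; exact zero_le
  apply two_mul_cancel
  rw [G_sym _ (by fun_prop)]
  have : 2 * pot B 1 x = ∫⁻ ξ, 2 * pot B 1 x ∂g1 := by simp
  rw [this]
  refine lintegral_mono fun ξ => ?_
  simp only
  rw [K_pot _ _ (by norm_num), K_pot _ _ (by norm_num), ← ENNReal.ofReal_add (by positivity) (by positivity), pot,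
      ← ENNReal.ofReal_ofNat, ← ENNReal.ofReal_mul (by positivity)]
  apply ENNReal.ofReal_le_ofReal
  have := le_max_left (B - (x + ξ)) 0
  have := le_max_left (B - (x - ξ)) 0
  linarith

lemma third_moment : ∫⁻ ξ, ENNReal.ofReal (|ξ|^3) ∂g1 ≤ ENNReal.ofReal 20 := by
  have h1 : ∀ t : ℝ, Integrable (fun x => Real.exp (t * x)) g1 := fun t => by
    unfold g1; exact integrable_exp_mul_gaussianReal t
  have h2 : ∀ t : ℝ, ∫ x, Real.exp (t * x) ∂g1 = Real.exp (t^2/2) := fun t => by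
    have := congrFun (mgf_id_gaussianReal (μ := 0) (v := 1)) t
    unfold g1; simpa [mgf] using this
  have : ∫⁻ ξ, ENNReal.ofReal (|ξ|^3) ∂g1 ≤ ∫⁻ ξ, ENNReal.ofReal (6 * (Real.exp (1*ξ) + Real.exp ((-1)*ξ))) ∂g1 := by
    refine lintegral_mono fun ξ => ENNReal.ofReal_le_ofReal ?_
    have h3 := Real.pow_div_factorial_le_exp |ξ| (abs_nonneg _) 3
    have h4 : Real.exp |ξ| ≤ Real.exp (1*ξ) + Real.exp ((-1)*ξ) := by
      rcases abs_cases ξ with ⟨h, _⟩ | ⟨h, _⟩ <;> rw [h] <;> simp <;> positivity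
    norm_num [Nat.factorial] at h3
    norm_num at h4 
    norm_num
    linarith
  refine this.trans ?_
  rw [lint_ofReal (by exact ((h1 1).add (h1 (-1))).const_mul 6) (fun _ => by positivity), integral_const_mul,
    integral_add (h1 1) (h1 (-1)), h2, h2]
  apply ENNReal.ofReal_le_ofReal
  have h5 : Real.exp (1/2) ≤ 5/3 := by
    have := Real.exp_one_lt_d9
    have h6 : Real.exp (1/2) ^ 2 = Real.exp 1 := by rw [← Real.exp_nat_mul]; norm_num
    have h7 := Real.exp_pos (1/2)
    nlinarith
  norm_num
  norm_num at h5
  linarith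

lemma step_three {B x : ℝ} (hx : x ≤ B) : G (K B (pot B 3)) x ≤ pot B 3 x + 10 * pot1 B x := by
  apply two_mul_cancel
  rw [G_sym _ (by fun_prop)]
  have hz : 0 ≤ B - x := by linarith
  have : ∫⁻ ξ, (ENNReal.ofReal (2*(B-x)^3 + 0 * ξ + 6*(B-x) * ξ^2) + ENNReal.ofReal (|ξ|^3)) ∂g1 ≤ 2 * (pot B 3 x + 10 * pot1 B x) := by
    rw [lintegral_add_left (by fun_prop)]
    rw [lint_ofReal (int_quad' _ _ _) (fun ξ => by rw [zero_mul, add_zero]; positivity), int_quad]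
    refine (add_le_add_right third_moment _).trans ?_
    unfold pot pot1
    rw [← ENNReal.ofReal_ofNat 10, ← ENNReal.ofReal_ofNat 2, ← ENNReal.ofReal_mul (by norm_num),
      ← ENNReal.ofReal_add (by positivity) (by positivity), ← ENNReal.ofReal_add (by positivity) (by positivity),
      ← ENNReal.ofReal_mul (by norm_num)]
    apply ENNReal.ofReal_le_ofReal
    nlinarith
  refine le_trans (lintegral_mono fun ξ => ?_) this
  simp only
  rw [K_pot _ _ (by norm_num), K_pot _ _ (by norm_num), ← ENNReal.ofReal_add (by positivity) (by positivity), ← ENNReal.ofReal_add (by rw [zero_mul, add_zero]; positivity) (by positivity)]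
  apply ENNReal.ofReal_le_ofReal
  set z := B - x with hzd
  have e1 : B - (x + ξ) = z - ξ := by ring
  have e2 : B - (x - ξ) = z + ξ := by ring
  rw [e1, e2]
  wlog hξ : 0 ≤ ξ generalizing ξ
  · have := this (-ξ) (by ring) (by ring) (by linarith)
    simp only [abs_neg, sub_neg_eq_add, ← sub_eq_add_neg] at this
    nlinarith
  rw [abs_of_nonneg hξ, max_eq_left (a := z + ξ) (by linarith)]
  rcases le_total ξ z with h | h
  · rw [max_eq_left (by linarith)]
    have : 0 ≤ ξ^3 := by positivity
    nlinarith
  · rw [max_eq_right (by linarith)]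
    have : 0 ≤ z^3 := by positivity
    nlinarith [mul_nonneg hz hξ, mul_nonneg (mul_nonneg hz hξ) (sub_nonneg.2 h)]

end SC



namespace SC
open scoped ENNReal

def Ik (b : ℕ → ℝ) (n : ℕ) (f : ℝ → ℝ≥0∞) : ℝ → ℝ≥0∞ := Wk b n (K (b n) f)

lemma Ik_succ (b : ℕ → ℝ) (n : ℕ) (f : ℝ → ℝ≥0∞) : Ik b (n+1) f = Ik b n (G (K (b (n+1)) f)) := rfl

lemma Ik_mono {b b' : ℕ → ℝ} {n : ℕ} (hb : ∀ i ≤ n, b i ≤ b' i) {f g : ℝ → ℝ≥0∞} (h : ∀ x ≤ b n, f x ≤ g x) :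
    Ik b n f ≤ Ik b' n g := by
  unfold Ik
  exact Wk_mono (fun i hi => hb i hi.le) (K_mono (hb n le_rfl) h)

lemma Ik_mono' {b : ℕ → ℝ} {n : ℕ} {f g : ℝ → ℝ≥0∞} (h : ∀ x ≤ b n, f x ≤ g x) (s : ℝ) :
    Ik b n f s ≤ Ik b n g s := Ik_mono (fun _ _ => le_rfl) h s

lemma Ik_add (b : ℕ → ℝ) (n : ℕ) {f g : ℝ → ℝ≥0∞} (hf : Measurable f) (s : ℝ) :
    Ik b n (fun x => f x + g x) s = Ik b n f s + Ik b n g s := by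
  unfold Ik; rw [K_add, Wk_add _ _ (by fun_prop)]

lemma Ik_const_mul (b : ℕ → ℝ) (n : ℕ) {f : ℝ → ℝ≥0∞} (hf : Measurable f) (c : ℝ≥0∞) (s : ℝ) :
    Ik b n (fun x => c * f x) s = c * Ik b n f s := by
  unfold Ik; rw [K_const_mul, Wk_const_mul _ _ (by fun_prop)]

lemma Ik_one_le (b : ℕ → ℝ) (n : ℕ) (s : ℝ) : Ik b n (fun _ => 1) s ≤ 1 :=
  Wk_le_one b n (K_le _ _) s

lemma flat_one (B : ℝ) (n : ℕ) (s : ℝ) : Ik (fun _ => B) n (pot1 B) s ≤ pot1 B s := by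
  induction n with
  | zero => exact K_le _ _ _
  | succ n ih =>
    rw [Ik_succ]
    exact (Ik_mono' (fun x hx => step_one hx) s).trans ih

lemma flat_three (B : ℝ) (n : ℕ) (s : ℝ) :
    Ik (fun _ => B) n (pot B 3) s ≤ pot B 3 s + n * (10 * pot1 B s) := by
  induction n with
  | zero => simp only [Nat.cast_zero, zero_mul, add_zero]; exact K_le _ _ _
  | succ n ih =>
    rw [Ik_succ]
    refine (Ik_mono' (fun x hx => step_three hx) s).trans ?_
    rw [Ik_add _ _ (by fun_prop), Ik_const_mul _ _ (by fun_prop)]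
    push_cast
    rw [add_mul, one_mul, ← add_assoc]
    gcongr
    exact flat_one B n s

lemma G_one : G (fun _ => 1) = fun _ => 1 := G_const 1

lemma Ik_anti (b : ℕ → ℝ) (n : ℕ) (s : ℝ) : Ik b (n+1) (fun _ => 1) s ≤ Ik b n (fun _ => 1) s := by
  rw [Ik_succ]
  refine Ik_mono' (fun x _ => ?_) s
  exact (G_mono (K_le _ _) x).trans (by rw [G_one])

lemma flat_two (B : ℝ) (n : ℕ) (s : ℝ) :
    n * Ik (fun _ => B) n (fun _ => 1) s ≤ 2 * Ik (fun _ => B) n (pot B 2) s := by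
  induction n with
  | zero => simp
  | succ n ih =>
    have h1 : Ik (fun _ => B) n (fun x => pot B 2 x + ENNReal.ofReal (1/2) * 1) s ≤ Ik (fun _ => B) (n+1) (pot B 2) s := by
      rw [Ik_succ]
      refine Ik_mono' (fun x hx => ?_) s
      rw [mul_one]; exact step_two_lower hx
    rw [Ik_add _ _ (by fun_prop), Ik_const_mul _ _ (by fun_prop)] at h1
    calc ((n+1 : ℕ) : ℝ≥0∞) * Ik (fun _ => B) (n+1) (fun _ => 1) s ≤ ((n+1 : ℕ) : ℝ≥0∞) * Ik (fun _ => B) n (fun _ => 1) s := by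
          gcongr; exact Ik_anti _ _ _
      _ = n * Ik (fun _ => B) n (fun _ => 1) s + 2 * (ENNReal.ofReal (1/2) * Ik (fun _ => B) n (fun _ => 1) s) := by
          rw [← mul_assoc, show (2:ℝ≥0∞) * ENNReal.ofReal (1/2) = 1 by
            rw [← ENNReal.ofReal_ofNat, ← ENNReal.ofReal_mul (by norm_num)]; norm_num]
          push_cast; ring
      _ ≤ 2 * Ik (fun _ => B) n (pot B 2) s + 2 * (ENNReal.ofReal (1/2) * Ik (fun _ => B) n (fun _ => 1) s) := by gcongr
      _ ≤ _ := by rw [← mul_add]; gcongr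

lemma flat_surv {B s : ℝ} (hs : s ≤ B) (n : ℕ) :
    Ik (fun _ => B) n (fun _ => 1) s ≤ ENNReal.ofReal (20 * (1 + (B - s)) / √(n + 1)) := by
  set y := B - s with hy
  have hy0 : 0 ≤ y := by linarith
  have hsq : 0 < √((n:ℝ) + 1) := by positivity
  rcases Nat.eq_zero_or_pos n with rfl | hn
  · refine (Ik_one_le _ _ _).trans ?_
    rw [← ENNReal.ofReal_one]
    apply ENNReal.ofReal_le_ofReal
    simp; linarith
  rcases le_or_gt (y^2) n with hyn | hyn
  swap
  · refine (Ik_one_le _ _ _).trans ?_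
    rw [← ENNReal.ofReal_one]
    apply ENNReal.ofReal_le_ofReal
    rw [le_div_iff₀ hsq, one_mul]
    apply Real.sqrt_le_iff.2
    constructor
    · positivity
    · nlinarith
  have hn' : (0:ℝ) < n := by exact_mod_cast hn
  set r := √(n:ℝ) with hr
  have hr0 : 0 < r := by positivity
  have hrr : r * r = n := Real.mul_self_sqrt hn'.le
  have h1 : 2 * Ik (fun _ => B) n (pot B 2) s ≤ ENNReal.ofReal r * Ik (fun _ => B) n (pot1 B) s + ENNReal.ofReal (1/r) * Ik (fun _ => B) n (pot B 3) s := by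
    rw [← Ik_const_mul _ _ (by fun_prop), ← Ik_const_mul _ _ (by fun_prop), ← Ik_const_mul _ _ (by fun_prop), ← Ik_add _ _ (by fun_prop)]
    refine Ik_mono' (fun x hx => ?_) s
    unfold pot pot1
    have hz : 0 ≤ B - x := by linarith
    rw [← ENNReal.ofReal_ofNat, ← ENNReal.ofReal_mul (by norm_num), ← ENNReal.ofReal_mul (by positivity), ← ENNReal.ofReal_mul (by positivity), ← ENNReal.ofReal_add (by positivity) (by positivity)]
    apply ENNReal.ofReal_le_ofReal
    set z := B - x
    have : r * (z + 1) + 1/r*z^3 - 2 * z^2 = r + z / r * (r - z)^2 := by field_simp; ring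
    have : 0 ≤ z / r * (r - z)^2 := by positivity
    linarith
  have h2 := (flat_two B n s).trans h1
  have h3 : n * Ik (fun _ => B) n (fun _ => 1) s ≤ ENNReal.ofReal r * pot1 B s + ENNReal.ofReal (1/r) * (pot B 3 s + n * (10 * pot1 B s)) := by
    refine h2.trans ?_
    gcongr
    · exact flat_one B n s
    · exact flat_three B n s
  have h4 : (n:ℝ≥0∞) * Ik (fun _ => B) n (fun _ => 1) s ≤ ENNReal.ofReal (12 * r * (y+1)) := by
    refine h3.trans ?_
    unfold pot pot1
    rw [← hy, ← ENNReal.ofReal_natCast, ← ENNReal.ofReal_ofNat, ← ENNReal.ofReal_mul (by positivity), ← ENNReal.ofReal_mul (by positivity), ← ENNReal.ofReal_mul (by positivity), ← ENNReal.ofReal_add (by positivity) (by positivity), ← ENNReal.ofReal_mul (by positivity), ← ENNReal.ofReal_add (by positivity) (by positivity)]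
    apply ENNReal.ofReal_le_ofReal
    rw [← hrr]
    have : 1/r * (y^3 + r*r*(10*(y+1))) = y^3 / r + 10 * r * (y+1) := by field_simp
    rw [this]
    have : y^3/r ≤ r * y := by
      rw [div_le_iff₀ hr0]; nlinarith
    nlinarith
  have h5 : Ik (fun _ => B) n (fun _ => 1) s ≤ ENNReal.ofReal (12 * r * (y+1)) / n := by
    rw [ENNReal.le_div_iff_mul_le (by left; simp; omega) (by left; simp), mul_comm]; exact h4
  refine h5.trans ?_
  rw [← ENNReal.ofReal_natCast, ← ENNReal.ofReal_div_of_pos hn']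
  apply ENNReal.ofReal_le_ofReal
  rw [div_le_div_iff₀ hn' hsq]
  have : 12 * √((n:ℝ)+1) ≤ 20 * r := by
    have e : √((n:ℝ)+1) ≤ 5/3 * r := by
      apply Real.sqrt_le_iff.2 ⟨by positivity, ?_⟩
      have : (1:ℝ) ≤ n := by exact_mod_cast hn
      nlinarith
    linarith
  calc 12 * r * (y+1) * √((n:ℝ)+1) = (12 * √((n:ℝ)+1)) * (r * (y+1)) := by ring
    _ ≤ 20 * r * (r * (y+1)) := by gcongr
    _ = 20 * (1+y) * n := by rw [← hrr]; ring

/-- logarithmic barrier -/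
def lb (c H : ℝ) (k : ℕ) : ℝ := c + H * Real.log (1 + k)

lemma lb_mono {c H : ℝ} (hH : 0 ≤ H) : Monotone (lb c H) := by
  intro i j hij
  unfold lb
  have : Real.log (1 + i) ≤ Real.log (1 + j) := Real.log_le_log (by positivity) (by gcongr)
  nlinarith

lemma lb_surv0 {c H s : ℝ} (hH : 0 ≤ H) (hs : s ≤ c) (n : ℕ) :
    Ik (lb c H) n (fun _ => 1) s ≤ ENNReal.ofReal (20 * (1 + (lb c H n - s)) / √(n + 1)) := by
  refine le_trans (Ik_mono (b' := fun _ => lb c H n) (fun i hi => lb_mono hH hi) (fun _ _ => le_rfl) s) ?_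
  refine flat_surv (hs.trans ?_) n
  unfold lb
  have : 0 ≤ Real.log (1 + n) := Real.log_nonneg (by simp)
  nlinarith

lemma lb_J_step {c H s : ℝ} (hH : 0 ≤ H) (n : ℕ) :
    Ik (lb c H) (n+1) (pot1 (lb c H (n+1))) s ≤ Ik (lb c H) n (pot1 (lb c H n)) s +
      ENNReal.ofReal (lb c H (n+1) - lb c H n) * Ik (lb c H) n (fun _ => 1) s := by
  rw [Ik_succ, ← Ik_const_mul _ _ (by fun_prop), ← Ik_add _ _ (by fun_prop)]
  refine Ik_mono' (fun x hx => ?_) s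
  have := lb_mono (c := c) hH (Nat.le_succ n)
  refine (step_one (hx.trans this)).trans ?_
  rw [mul_one]; unfold pot1
  rw [← ENNReal.ofReal_add (by linarith) (by simpa using this)]
  apply ENNReal.ofReal_le_ofReal; linarith

lemma log_diff (n : ℕ) : Real.log (1 + (n+1:ℕ)) - Real.log (1 + n) ≤ 1 / (n + 1) := by
  rw [← Real.log_div (by positivity) (by positivity)]
  refine (Real.log_le_sub_one_of_pos (by positivity)).trans ?_
  push_cast
  apply le_of_eq; field_simp; ring

lemma lb_J {H : ℝ} (hH : 0 ≤ H) : ∃ C : ℝ, 0 ≤ C ∧ ∀ (c s : ℝ) (n : ℕ), s ≤ c →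
    Ik (lb c H) n (pot1 (lb c H n)) s ≤ ENNReal.ofReal (C * (1 + (c - s))) := by
  set a : ℕ → ℝ := fun k => H / (k+1) * (20 * (1 + H * Real.log (1 + k)) / √(k + 1)) with ha
  have hL : ∀ k : ℕ, 0 ≤ Real.log (1 + (k:ℝ)) := fun k => Real.log_nonneg (by simp)
  have ha0 : ∀ k, 0 ≤ a k := fun k => by have := hL k; simp only [ha]; positivity
  have hsum : Summable a := by
    have hs : Summable (fun k : ℕ => (20 * H * (1 + 4 * H)) * (1 / ((k+1:ℕ):ℝ) ^ (5/4:ℝ))) := by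
      apply Summable.mul_left
      exact (summable_nat_add_iff 1).2 (Real.summable_one_div_nat_rpow.2 (by norm_num))
    refine Summable.of_nonneg_of_le ha0 (fun k => ?_) hs
    have hk : (0:ℝ) < (k:ℝ) + 1 := by positivity
    have hlog : Real.log (1 + (k:ℝ)) ≤ 4 * ((k:ℝ)+1)^(1/4:ℝ) := by
      have := Real.log_le_rpow_div (x := (k:ℝ)+1) hk.le (ε := 1/4) (by norm_num)
      rw [add_comm]; linarith
    have hone : (1:ℝ) ≤ ((k:ℝ)+1)^(1/4:ℝ) := Real.one_le_rpow (by simp) (by norm_num)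
    simp only [ha]
    rw [Real.sqrt_eq_rpow]
    push_cast
    have e1 : ((k:ℝ)+1)^(5/4:ℝ) * ((k:ℝ)+1)^(1/4:ℝ) = ((k:ℝ)+1) * ((k:ℝ)+1)^(1/2:ℝ) := by
      rw [← Real.rpow_add hk]
      nth_rw 2 [← Real.rpow_one ((k:ℝ)+1)]
      rw [← Real.rpow_add hk]; norm_num
    have e2 : 1 / ((k:ℝ)+1)^(5/4:ℝ) = ((k:ℝ)+1)^(1/4:ℝ) / (((k:ℝ)+1) * ((k:ℝ)+1)^(1/2:ℝ)) := by
      rw [← e1]; field_simp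
    rw [e2, div_mul_div_comm, ← mul_div_assoc]
    apply div_le_div_of_nonneg_right _ (by positivity)
    set q := ((k:ℝ)+1)^(1/4:ℝ)
    have : 1 + H * Real.log (1+k) ≤ (1 + 4*H) * q := by nlinarith
    nlinarith
  refine ⟨1 + ∑' k, a k, add_nonneg zero_le_one (tsum_nonneg ha0), ?_⟩
  intro c s n hs
  have key : Ik (lb c H) n (pot1 (lb c H n)) s ≤ ENNReal.ofReal ((1 + ∑ k ∈ Finset.range n, a k) * (1 + (c - s))) := by
    induction n with
    | zero => 
      refine (K_le _ _ _).trans ?_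
      simp [pot1, lb]
      apply ENNReal.ofReal_le_ofReal; linarith
    | succ n ih =>
      refine (lb_J_step hH n).trans ?_
      have h1 := lb_surv0 hH hs n
      have hd : lb c H (n+1) - lb c H n ≤ H / (n+1) := by
        have := mul_le_mul_of_nonneg_left (log_diff n) hH
        unfold lb; push_cast at *; rw [mul_one_div] at this; linarith
      have h2 : ENNReal.ofReal (lb c H (n+1) - lb c H n) * Ik (lb c H) n (fun _ => 1) s ≤ ENNReal.ofReal (a n * (1 + (c-s))) := by
        refine (mul_le_mul' (ENNReal.ofReal_le_ofReal hd) h1).trans ?_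
        rw [← ENNReal.ofReal_mul (by positivity)]
        apply ENNReal.ofReal_le_ofReal
        simp only [ha]
        rw [mul_assoc]
        apply mul_le_mul_of_nonneg_left _ (by positivity)
        rw [div_mul_eq_mul_div]
        apply div_le_div_of_nonneg_right _ (by positivity)
        unfold lb
        have := hL n
        have := mul_nonneg hH this
        have : 0 ≤ c - s := by linarith
        nlinarith
      refine (add_le_add ih h2).trans ?_
      have : 0 ≤ c - s := by linarith
      have h3 : 0 ≤ ∑ k ∈ Finset.range n, a k := Finset.sum_nonneg fun k _ => ha0 k
      rw [← ENNReal.ofReal_add (by positivity) (mul_nonneg (ha0 n) (by positivity)), Finset.sum_range_succ]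
      apply ENNReal.ofReal_le_ofReal; linarith
  refine key.trans (ENNReal.ofReal_le_ofReal ?_)
  have : 0 ≤ c - s := by linarith
  gcongr
  exact hsum.sum_le_tsum _ (fun k _ => ha0 k)

/-- Survival below a logarithmic barrier. -/
lemma lb_surv {H : ℝ} (hH : 0 ≤ H) : ∃ C : ℝ, 0 ≤ C ∧ ∀ (c s : ℝ) (n : ℕ), s ≤ c →
    Ik (lb c H) n (fun _ => 1) s ≤ ENNReal.ofReal (C * (1 + (c - s)) / √(n+1)) := by
  obtain ⟨C, hC0, hC⟩ := lb_J hH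
  refine ⟨40 * (1 + H) * C, by positivity, ?_⟩
  intro c s N hs
  set m := N / 2 with hm
  set n := N - m with hn
  have hN : N = m + n := by omega
  have hb := lb_mono (c := c) hH
  have h1 : Ik (lb c H) N (fun _ => 1) s ≤ Ik (lb c H) m (fun x => ENNReal.ofReal (20 * (1+H) / √(n+1)) * pot1 (lb c H m) x) s := by
    unfold Ik
    rw [hN, Wk_split]
    refine Wk_mono (fun _ _ => le_rfl) (fun x => ?_) s
    rcases lt_or_ge (lb c H m) x with hx | hx
    · rw [K_of_lt _ hx]
      apply le_of_eq
      rcases Nat.eq_zero_or_pos n with h0 | h0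
      · rw [h0]; simp only [Wk]; exact K_of_lt _ (by simpa using hx)
      · obtain ⟨n', hn'⟩ := Nat.exists_eq_succ_of_ne_zero h0.ne'
        rw [hn', Wk_succ']; exact K_of_lt _ (by simpa using hx)
    · rw [K_of_le _ hx]
      have h2 : Wk (fun i => lb c H (m+i)) n (K (lb c H (m+n)) fun _ => 1) x ≤ Ik (fun _ => lb c H (m+n)) n (fun _ => 1) x := by
        exact Wk_mono (fun i hi => hb (by omega)) le_rfl x
      have h3 := flat_surv (hx.trans (hb (Nat.le_add_right m n))) n
      refine h2.trans (h3.trans ?_)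
      unfold pot1
      rw [← ENNReal.ofReal_mul (by positivity)]
      apply ENNReal.ofReal_le_ofReal
      rw [div_mul_eq_mul_div]
      apply div_le_div_of_nonneg_right _ (by positivity)
      have h4 : lb c H (m+n) - lb c H m ≤ H := by
        have : Real.log (1 + (m+n:ℕ)) - Real.log (1+m) ≤ 1 := by
          rw [← Real.log_div (by positivity) (by positivity)]
          refine (Real.log_le_sub_one_of_pos (by positivity)).trans ?_
          have : (1 + ((m+n:ℕ):ℝ)) / (1+m) ≤ 2 := by
            rw [div_le_iff₀ (by positivity)]
            have : 1 + (m+n) ≤ 2 * (1+m) := by omega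
            exact_mod_cast this
          linarith
        unfold lb; nlinarith
      nlinarith
  rw [Ik_const_mul _ _ (by fun_prop)] at h1
  refine (h1.trans (mul_le_mul_right (hC c s m hs) _)).trans ?_
  rw [← ENNReal.ofReal_mul (by positivity)]
  apply ENNReal.ofReal_le_ofReal
  have : 0 ≤ c - s := by linarith
  have h5 : √((N:ℝ)+1) ≤ 2 * √((n:ℝ)+1) := by
    apply Real.sqrt_le_iff.2 ⟨by positivity, ?_⟩
    rw [mul_pow, Real.sq_sqrt (by positivity)]
    have : N + 1 ≤ 4 * (n+1) := by omega
    have : ((N:ℝ)+1) ≤ 4 * ((n:ℝ)+1) := by exact_mod_cast this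
    linarith
  rw [div_mul_eq_mul_div, div_le_div_iff₀ (by positivity) (by positivity)]
  calc 20 * (1+H) * (C * (1 + (c-s))) * √((N:ℝ)+1) ≤ 20 * (1+H) * (C * (1 + (c-s))) * (2 * √((n:ℝ)+1)) := by gcongr
    _ = _ := by ring

/-- version for general barriers dominated by a log barrier, without final constraint -/
lemma Wk_surv {H : ℝ} (hH : 0 ≤ H) : ∃ C : ℝ, 0 ≤ C ∧ ∀ (b : ℕ → ℝ) (c s : ℝ) (n : ℕ), s ≤ c →
    (∀ k < n, b k ≤ c + H * Real.log (1 + k)) →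
    Wk b n (fun _ => 1) s ≤ ENNReal.ofReal (C * (1 + (c - s)) / √(n+1)) := by
  obtain ⟨C, hC0, hC⟩ := lb_surv hH
  refine ⟨1 + 2 * C, by positivity, ?_⟩
  intro b c s n hs hb
  have : 0 ≤ c - s := by linarith
  rcases Nat.eq_zero_or_pos n with rfl | hn
  · simp only [Wk]
    rw [← ENNReal.ofReal_one]
    apply ENNReal.ofReal_le_ofReal
    simp; nlinarith
  obtain ⟨m, rfl⟩ := Nat.exists_eq_succ_of_ne_zero hn.ne'
  have h1 : Wk b (m+1) (fun _ => 1) s ≤ Ik (lb c H) m (fun _ => 1) s := by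
    simp only [Wk, Ik, G_one]
    exact Wk_mono (fun i hi => hb i (by omega)) (K_mono (hb m (by omega)) fun _ _ => le_rfl) s
  refine (h1.trans (hC c s m hs)).trans (ENNReal.ofReal_le_ofReal ?_)
  rw [div_le_div_iff₀ (by positivity) (by positivity)]
  have h5 : √(((m+1:ℕ):ℝ)+1) ≤ 2 * √((m:ℝ)+1) := by
    apply Real.sqrt_le_iff.2 ⟨by positivity, ?_⟩
    rw [mul_pow, Real.sq_sqrt (by positivity)]
    push_cast; nlinarith [(Nat.cast_nonneg m : (0:ℝ) ≤ m)]
  calc C * (1 + (c-s)) * √(((m+1:ℕ):ℝ)+1) ≤ C * (1 + (c-s)) * (2 * √((m:ℝ)+1)) := by gcongr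
    _ ≤ _ := by
      have : 0 ≤ (1 + (c - s)) * √((m:ℝ)+1) := by positivity
      nlinarith

end SC



namespace SC
open scoped ENNReal

/-- exponential with values in ENNReal -/
def E (x : ℝ) : ℝ≥0∞ := ENNReal.ofReal (Real.exp x)
@[fun_prop] lemma E_meas : Measurable E := by unfold E; fun_prop
lemma E_add (x y : ℝ) : E (x + y) = E x * E y := by
  unfold E; rw [Real.exp_add, ENNReal.ofReal_mul (Real.exp_pos _).le]
lemma E_zero : E 0 = 1 := by simp [E]
lemma E_mono {x y : ℝ} (h : x ≤ y) : E x ≤ E y := ENNReal.ofReal_le_ofReal (Real.exp_le_exp.2 h)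
lemma E_ne_top (x : ℝ) : E x ≠ ⊤ := ENNReal.ofReal_ne_top
lemma E_ne_zero (x : ℝ) : E x ≠ 0 := by simp [E, Real.exp_pos]

lemma adj {f h : ℝ → ℝ≥0∞} (hf : Measurable f) (hh : Measurable h) :
    ∫⁻ x, h x * G f x = ∫⁻ x, f x * G h x := by
  have e1 : ∀ x, h x * G f x = ∫⁻ ξ, h x * f (x + ξ) ∂g1 := fun x => by
    unfold G; rw [lintegral_const_mul _ (by fun_prop)]
  have e2 : ∀ x, f x * G h x = ∫⁻ ξ, f x * h (x - ξ) ∂g1 := fun x => by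
    rw [G_neg _ hh, lintegral_const_mul _ (by fun_prop)]
  simp_rw [e1, e2]
  have s1 := lintegral_lintegral_swap (μ := volume) (ν := g1) (f := fun x ξ => h x * f (x+ξ)) (by fun_prop)
  have s2 := lintegral_lintegral_swap (μ := volume) (ν := g1) (f := fun x ξ => f x * h (x-ξ)) (by fun_prop)
  rw [s1, s2]
  refine lintegral_congr fun ξ => ?_
  rw [← lintegral_add_right_eq_self (fun x => f x * h (x - ξ)) ξ]
  refine lintegral_congr fun x => ?_
  simp [mul_comm]

lemma G_iter (m : ℕ) {f : ℝ → ℝ≥0∞} (hf : Measurable f) (s : ℝ) :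
    (G^[m] f) s = ∫⁻ x, f (s + x) ∂(gaussianReal 0 m) := by
  induction m generalizing f with
  | zero => simp
  | succ m ih =>
    rw [Function.iterate_succ_apply, ih (by fun_prop)]
    have : gaussianReal 0 ((m+1:ℕ) : NNReal) = (gaussianReal 0 (m : NNReal)).conv (gaussianReal 0 1) := by
      rw [gaussianReal_conv_gaussianReal]; simp
    rw [this, Measure.lintegral_conv (by fun_prop)]
    unfold G g1
    simp_rw [add_assoc]

lemma Wk_le_iter (b : ℕ → ℝ) (m : ℕ) (f : ℝ → ℝ≥0∞) : Wk b m f ≤ G^[m] f := by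
  induction m generalizing f with
  | zero => exact le_rfl
  | succ m ih =>
    rw [Function.iterate_succ_apply]
    exact (Wk_mono (fun _ _ => le_rfl) (K_le _ _)).trans (ih _)

lemma G_iter_le {m : ℕ} (hm : 1 ≤ m) {f : ℝ → ℝ≥0∞} (hf : Measurable f) (s : ℝ) :
    (G^[m] f) s ≤ ENNReal.ofReal (1 / √m) * ∫⁻ x, f x := by
  rw [G_iter m hf, gaussianReal_of_var_ne_zero _ (by simp; omega), lintegral_withDensity_eq_lintegral_mul _ (by fun_prop) (by fun_prop)]
  rw [← lintegral_add_left_eq_self f s, ← lintegral_const_mul _ (by fun_prop)]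
  refine lintegral_mono fun x => ?_
  simp only [Pi.mul_apply]
  gcongr
  unfold gaussianPDF gaussianPDFReal
  apply ENNReal.ofReal_le_ofReal
  have hm' : (0:ℝ) < m := by exact_mod_cast hm
  have h1 : Real.exp (-(x - 0)^2 / (2 * ((m:NNReal):ℝ))) ≤ 1 := by
    apply Real.exp_le_one_iff.2
    apply div_nonpos_of_nonpos_of_nonneg _ (by positivity)
    nlinarith [sq_nonneg (x-0)]
  have h2 : (√(2 * Real.pi * ((m:NNReal):ℝ)))⁻¹ ≤ 1 / √m := by
    rw [one_div]
    apply inv_anti₀ (by positivity)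
    apply Real.sqrt_le_sqrt
    have := Real.pi_gt_three
    simp
    nlinarith
  calc _ ≤ (√(2 * Real.pi * ((m:NNReal):ℝ)))⁻¹ * 1 := by gcongr
    _ ≤ _ := by rw [mul_one]; exact h2

/-- reversed walk -/
def Rv (b : ℕ → ℝ) : ℕ → ℝ → ℝ≥0∞
  | 0 => fun _ => 1
  | (n+1) => G (K (b n) (Rv b n))

@[fun_prop] lemma Rv_meas (b : ℕ → ℝ) (n : ℕ) : Measurable (Rv b n) := by
  induction n with
  | zero => exact measurable_const
  | succ n ih => unfold Rv; fun_prop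

lemma K_swap (b : ℝ) (f g : ℝ → ℝ≥0∞) (x : ℝ) : K b f x * g x = f x * K b g x := by
  rcases le_or_gt x b with h | h
  · rw [K_of_le _ h, K_of_le _ h]
  · rw [K_of_lt _ h, K_of_lt _ h]; simp

lemma lint_Wk (b : ℕ → ℝ) (n : ℕ) {f : ℝ → ℝ≥0∞} (hf : Measurable f) :
    ∫⁻ x, Wk b n f x = ∫⁻ x, f x * Rv b n x := by
  induction n generalizing f with
  | zero => simp [Wk, Rv]
  | succ n ih =>
    simp only [Wk]
    rw [ih (by fun_prop)]
    simp_rw [K_swap, Rv]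
    rw [← adj hf (by fun_prop)]
    simp_rw [mul_comm]

lemma Rv_le (n : ℕ) (b b' : ℕ → ℝ) (h : ∀ k, 1 ≤ k → k ≤ n → b (n - k) ≤ b' k) (e : ℝ) (he : e ≤ b' 0) :
    Rv b n e ≤ Wk b' n (fun _ => 1) e := by
  induction n generalizing b' e with
  | zero => exact le_rfl
  | succ n ih =>
    rw [Wk_succ', K_of_le _ he]
    unfold Rv
    refine G_mono (fun x => ?_) e
    rcases lt_or_ge (b n) x with hx | hx
    · rw [K_of_lt _ hx]; exact zero_le
    · rw [K_of_le _ hx]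
      refine ih (fun i => b' (i+1)) (fun k hk hkn => ?_) x (hx.trans (by simpa using h 1 le_rfl (by omega)))
      simpa using h (k+1) (by omega) (by omega)

/-- Lemma T -/
lemma thirds {H : ℝ} (hH : 0 ≤ H) : ∃ C : ℝ, 0 ≤ C ∧ ∀ (b : ℕ → ℝ) (B E0 s : ℝ) (j : ℕ) (f : ℝ → ℝ≥0∞), Measurable f →
    1 ≤ j → s ≤ B → (∀ i < j, b i ≤ B) → (∀ k, 1 ≤ k → k ≤ j → b (j - k) ≤ E0 + H * Real.log (1 + k)) →
    Wk b j f s ≤ ENNReal.ofReal (C * (1 + (B - s)) / (j:ℝ)^(3/2:ℝ)) * ∫⁻ e, f e * ENNReal.ofReal (1 + max (E0 - e) 0) := by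
  obtain ⟨C1, hC1, h1⟩ := Wk_surv (H := 0) le_rfl
  obtain ⟨C2, hC2, h2⟩ := Wk_surv hH
  refine ⟨9 * C1 * C2, by positivity, ?_⟩
  intro b B E0 s j f hf hj hs hB hE
  set p := j / 3 with hp
  set m := j - 2 * p with hm
  have hjm : j = p + (m + p) := by omega
  have hm1 : 1 ≤ m := by omega
  have hBs : 0 ≤ B - s := by linarith
  set g := Wk (fun i => b (p + (m + i))) p f with hg
  have hgm : Measurable g := by simp only [hg]; fun_prop
  have e1 : Wk b j f s ≤ (ENNReal.ofReal (1/√m) * ∫⁻ x, g x) * Wk b p (fun _ => 1) s := by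
    have : Wk b j f = Wk b p (Wk (fun i => b (p + i)) m g) := by
      conv_lhs => rw [hjm, Wk_split, Wk_split]
    rw [this]
    have h3 := congrFun (Wk_const_mul b p (f := fun _ => 1) measurable_const (ENNReal.ofReal (1/√m) * ∫⁻ x, g x)) s
    rw [← h3]
    refine Wk_mono (fun _ _ => le_rfl) (fun x => ?_) s
    rw [mul_one]
    exact (Wk_le_iter _ _ _ x).trans (G_iter_le hm1 hgm x)
  have e2 : Wk b p (fun _ => 1) s ≤ ENNReal.ofReal (C1 * (1 + (B - s)) / √(p+1)) := by
    refine h1 b B s p hs (fun k hk => ?_)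
    have := hB k (by omega)
    simpa using this
  have e3 : ∫⁻ x, g x ≤ ENNReal.ofReal (C2 / √(p+1)) * ∫⁻ e, f e * ENNReal.ofReal (1 + max (E0 - e) 0) := by
    rw [hg, lint_Wk _ _ hf, ← lintegral_const_mul _ (by fun_prop)]
    refine lintegral_mono fun e => ?_
    simp only
    rw [mul_left_comm]
    gcongr
    have h4 := Rv_le p (fun i => b (p + (m + i))) (fun k => if k = 0 then max E0 e else b (j - k)) (fun k hk hkp => by
      rw [if_neg (by omega)]
      apply le_of_eq; congr 1; omega) e (by simp)
    refine h4.trans ?_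
    have h5 := h2 (fun k => if k = 0 then max E0 e else b (j - k)) (max E0 e) e p (le_max_right _ _) (fun k hk => by
      by_cases hk0 : k = 0
      · simp [hk0]
      · simp only [if_neg hk0]
        refine (hE k (by omega) (by omega)).trans ?_
        gcongr; exact le_max_left _ _)
    refine h5.trans ?_
    rw [← ENNReal.ofReal_mul (by positivity)]
    apply ENNReal.ofReal_le_ofReal
    rw [div_mul_eq_mul_div]
    apply le_of_eq
    congr 2
    rw [← max_sub_sub_right, sub_self]
  refine e1.trans ((mul_le_mul' (mul_le_mul_right e3 _) e2).trans ?_)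
  rw [← mul_assoc, mul_right_comm]
  gcongr
  rw [← ENNReal.ofReal_mul (by positivity), ← ENNReal.ofReal_mul (by positivity)]
  apply ENNReal.ofReal_le_ofReal
  have hj0 : (0:ℝ) < j := by exact_mod_cast hj
  have e5 : (j:ℝ)^(3/2:ℝ) ≤ 9 * (√m * √(p+1) * √(p+1)) := by
    have : (j:ℝ)^(3/2:ℝ) = j * √j := by
      rw [Real.sqrt_eq_rpow, show (3/2:ℝ) = 1 + 1/2 by norm_num, Real.rpow_add hj0, Real.rpow_one]
    rw [this, mul_assoc √(m:ℝ), Real.mul_self_sqrt (by positivity)]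
    have a1 : (j:ℝ) ≤ 3 * (p+1) := by
      have : j ≤ 3 * (p+1) := by omega
      exact_mod_cast this
    have a2 : √(j:ℝ) ≤ 3 * √m := by
      apply Real.sqrt_le_iff.2 ⟨by positivity, ?_⟩
      rw [mul_pow, Real.sq_sqrt (by positivity)]
      have : j ≤ 9 * m := by omega
      norm_num
      exact_mod_cast this
    calc (j:ℝ) * √j ≤ (3 * (p+1)) * (3 * √m) := by gcongr
      _ = _ := by ring
  have hm0 : (0:ℝ) < m := by exact_mod_cast hm1
  rw [div_mul_div_comm, div_mul_div_comm, div_le_div_iff₀ (by positivity) (by positivity)]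
  have : 0 ≤ C1 * C2 * (1 + (B-s)) := by positivity
  nlinarith [mul_le_mul_of_nonneg_left e5 this]

/-- one-dimensional Cameron-Martin -/
lemma cm1 (α : ℝ) (v : NNReal) {F : ℝ → ℝ≥0∞} (hF : Measurable F) :
    ∫⁻ x, E (α * x) * F x ∂(gaussianReal 0 v) = E (α^2 * v / 2) * ∫⁻ x, F (x + α * v) ∂(gaussianReal 0 v) := by
  rcases eq_or_ne v 0 with rfl | hv
  · simp [gaussianReal_zero_var, E_zero]
  rw [gaussianReal_of_var_ne_zero _ hv, lintegral_withDensity_eq_lintegral_mul _ (by fun_prop) (by fun_prop),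
    lintegral_withDensity_eq_lintegral_mul _ (by fun_prop) (by fun_prop), ← lintegral_const_mul _ (by fun_prop),
    ← lintegral_add_right_eq_self _ (α * v)]
  congr 1; funext x
  simp only [Pi.mul_apply]
  rw [← mul_assoc, ← mul_assoc]
  congr 1
  unfold gaussianPDF E gaussianPDFReal
  rw [← ENNReal.ofReal_mul (by positivity), ← ENNReal.ofReal_mul (by positivity)]
  congr 1
  have hv' : (v:ℝ) ≠ 0 := by exact_mod_cast hv
  rw [mul_assoc, ← Real.exp_add, mul_left_comm, ← Real.exp_add]
  congr 2
  field_simp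
  ring

lemma G_tilt (α : ℝ) {h : ℝ → ℝ≥0∞} (hh : Measurable h) (s : ℝ) :
    G (fun e => E (α * e) * h e) s = E (α * s + α^2/2) * G h (s + α) := by
  unfold G g1
  have := cm1 α 1 (F := fun x => h (s + x)) (by fun_prop)
  simp only [NNReal.coe_one, mul_one] at this
  rw [E_add, mul_assoc]
  simp_rw [show ∀ x, s + α + x = s + (x + α) by intro x; ring]
  rw [← this, ← lintegral_const_mul _ (by fun_prop)]
  congr 1; funext x
  rw [← mul_assoc, ← E_add]; congr 2; ring

lemma Wk_tilt (α : ℝ) (b : ℕ → ℝ) (m : ℕ) {h : ℝ → ℝ≥0∞} (hh : Measurable h) (s : ℝ) :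
    Wk b m (fun e => E (α * e) * h (e - α * m)) s = E (α * s + α^2 * m / 2) * Wk (fun i => b i - α * i) m h s := by
  induction m generalizing h with
  | zero => simp [Wk]
  | succ m ih =>
    simp only [Wk]
    have e1 : K (b m) (G (fun e => E (α * e) * h (e - α * (m+1:ℕ)))) = fun e => E (α * e) * (fun x => E (α^2/2) * (K (b m - α * m) (G h)) x) (e - α * m) := by
      funext x
      rcases le_or_gt x (b m) with hx | hx
      · rw [K_of_le _ hx, G_tilt α (h := fun e => h (e - α * (m+1:ℕ))) (by fun_prop)]
        simp only
        rw [K_of_le _ (by linarith), E_add, mul_assoc]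
        congr 2
        unfold G
        refine lintegral_congr fun ξ => ?_
        have : x + α + ξ - α*(m+1:ℕ) = x - α*m + ξ := by push_cast; ring
        simp only [this]
      · simp only
        rw [K_of_lt _ hx, K_of_lt _ (by linarith)]; simp
    rw [e1, ih (h := fun x => E (α^2/2) * (K (b m - α * m) (G h)) x) (by fun_prop), Wk_const_mul _ _ (by fun_prop), ← mul_assoc, ← E_add]
    congr 2; push_cast; ring

end SC



namespace SC
open scoped ENNReal

/-- indicator of an interval -/
def ind (l r : ℝ) : ℝ → ℝ≥0∞ := (Set.Icc l r).indicator (fun _ => 1)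
@[fun_prop] lemma ind_meas (l r : ℝ) : Measurable (ind l r) := by
  unfold ind; exact measurable_const.indicator measurableSet_Icc

lemma K_ind (l : ℝ) : K 0 (ind l 0) = ind l 0 := by
  unfold K ind; rw [Set.indicator_indicator]
  congr 1; ext x; simp

abbrev Z0 : ℕ → ℝ := fun _ => 0

lemma K_Wk (n : ℕ) (f : ℝ → ℝ≥0∞) (hf : K 0 f = f) : K 0 (Wk Z0 n f) = Wk Z0 n f := by
  cases n with
  | zero => exact hf
  | succ n => rw [Wk_succ', K_K]

lemma adjW (n : ℕ) {f h : ℝ → ℝ≥0∞} (hf : Measurable f) (hh : Measurable h) (kf : K 0 f = f) (kh : K 0 h = h) :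
    ∫⁻ x, Wk Z0 n f x * h x = ∫⁻ x, f x * Wk Z0 n h x := by
  induction n generalizing h with
  | zero => rfl
  | succ n ih =>
    have e1 : Wk Z0 (n+1) f = K 0 (G (Wk Z0 n f)) := Wk_succ' _ _ _
    rw [e1]
    simp_rw [K_swap]
    rw [kh]
    have := ih (h := K 0 (G h)) (by fun_prop) (K_K _ _)
    rw [show (fun x => f x * Wk Z0 (n+1) h x) = fun x => f x * Wk Z0 n (K 0 (G h)) x from rfl, ← this]
    simp_rw [← K_swap]
    rw [K_Wk _ _ kf, ← adj (by fun_prop) hh]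
    simp_rw [mul_comm]

lemma low1 (m : ℕ) (e : ℝ) (he : e ≤ 0) : pot 0 1 e ≤ Ik Z0 m (pot 0 1) e := by
  induction m with
  | zero => simp only [Ik, Wk]; rw [K_of_le _ he]
  | succ m ih =>
    rw [Ik_succ]
    exact ih.trans (Ik_mono' (fun x _ => step_one_lower) e)

lemma sum_sqrt (m : ℕ) : ∑ k ∈ Finset.range m, 1 / √((k:ℝ)+1) ≤ 2 * √m := by
  induction m with
  | zero => simp
  | succ m ih =>
    rw [Finset.sum_range_succ]
    push_cast
    have h1 : 0 < √((m:ℝ)+1) := by positivity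
    have h2 : √(m:ℝ) * √(m:ℝ) = m := Real.mul_self_sqrt (by positivity)
    have h3 : √((m:ℝ)+1) * √((m:ℝ)+1) = m + 1 := Real.mul_self_sqrt (by positivity)
    have : 1 / √((m:ℝ)+1) ≤ 2 * √((m:ℝ)+1) - 2 * √m := by
      rw [div_le_iff₀ h1]
      nlinarith [sq_nonneg (√((m:ℝ)+1) - √m)]
    linarith

lemma up2 {m : ℕ} (hm : 1 ≤ m) {e : ℝ} (he : e ≤ 0) (he' : -1 ≤ e) :
    Ik Z0 m (pot 0 2) e ≤ ENNReal.ofReal (81 * √m) := by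
  have h : Ik Z0 m (pot 0 2) e ≤ ENNReal.ofReal (1 + 40 * ∑ k ∈ Finset.range m, 1 / √((k:ℝ)+1)) := by
    clear hm
    induction m with
    | zero =>
      refine (K_le _ _ _).trans ?_
      unfold pot
      apply ENNReal.ofReal_le_ofReal
      simp only [Finset.range_zero, Finset.sum_empty]; nlinarith
    | succ m ih =>
      rw [Ik_succ]
      have h1 : Ik Z0 m (G (K (Z0 (m+1)) (pot 0 2))) e ≤ Ik Z0 m (fun x => pot 0 2 x + 1) e :=
        Ik_mono' (fun x _ => step_two_upper) e
      refine h1.trans ?_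
      rw [Ik_add _ _ (by fun_prop)]
      have h2 := flat_surv he m
      refine (add_le_add ih h2).trans ?_
      have : 0 ≤ ∑ k ∈ Finset.range m, 1 / √((k:ℝ)+1) := Finset.sum_nonneg fun _ _ => by positivity
      rw [← ENNReal.ofReal_add (by positivity) (by apply div_nonneg _ (by positivity); linarith)]
      apply ENNReal.ofReal_le_ofReal
      rw [Finset.sum_range_succ]
      have : 20 * (1 + (0 - e)) / √((m:ℝ)+1) ≤ 40 * (1 / √((m:ℝ)+1)) := by
        rw [mul_one_div]
        apply div_le_div_of_nonneg_right _ (by positivity)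
        linarith
      linarith
  refine h.trans (ENNReal.ofReal_le_ofReal ?_)
  have h1 := sum_sqrt m
  have h2 : 1 ≤ √(m:ℝ) := Real.one_le_sqrt.2 (by exact_mod_cast hm)
  linarith

lemma lowq {m : ℕ} (hm : 1 ≤ m) {e : ℝ} (he : e ≤ -1/2) (he' : -1 ≤ e) :
    ENNReal.ofReal (1 / (4 * (324 * √m))) ≤ Wk Z0 m (ind (-(324 * √m)) 0) e := by
  set L := 324 * √(m:ℝ) with hL
  have h2 : 1 ≤ √(m:ℝ) := Real.one_le_sqrt.2 (by exact_mod_cast hm)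
  have hL0 : 0 < L := by positivity
  set q := Wk Z0 m (ind (-L) 0) e with hq
  have e1 : Ik Z0 m (ind (-L) 0) e = q := by rw [hq, Ik, K_ind]
  have h3 := low1 m e (by linarith)
  have h4 : Ik Z0 m (pot 0 1) e ≤ ENNReal.ofReal L * q + ENNReal.ofReal (1/L) * Ik Z0 m (pot 0 2) e := by
    rw [← e1, ← Ik_const_mul _ _ (by fun_prop), ← Ik_const_mul _ _ (by fun_prop), ← Ik_add _ _ (by fun_prop)]
    refine Ik_mono' (fun x hx => ?_) e
    have hx : x ≤ 0 := hx
    unfold pot ind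
    by_cases hxL : -L ≤ x
    · rw [Set.indicator_of_mem (by exact ⟨hxL, hx⟩), mul_one]
      refine le_trans (ENNReal.ofReal_le_ofReal ?_) le_self_add
      simp; linarith
    · rw [Set.indicator_of_notMem (by simp; intro h; exact absurd h hxL), mul_zero, zero_add, ← ENNReal.ofReal_mul (by positivity)]
      apply ENNReal.ofReal_le_ofReal
      push Not at hxL
      rw [div_mul_eq_mul_div, le_div_iff₀ hL0]
      nlinarith
  have h5 := up2 hm (by linarith : e ≤ 0) he'
  have h6 : ENNReal.ofReal (1/4) + ENNReal.ofReal (1/4) ≤ ENNReal.ofReal L * q + ENNReal.ofReal (1/4) := by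
    calc ENNReal.ofReal (1/4) + ENNReal.ofReal (1/4) ≤ pot 0 1 e := by
          rw [← ENNReal.ofReal_add (by norm_num) (by norm_num), pot]
          apply ENNReal.ofReal_le_ofReal; norm_num; linarith
      _ ≤ _ := h3
      _ ≤ _ := h4
      _ ≤ ENNReal.ofReal L * q + ENNReal.ofReal (1/L) * ENNReal.ofReal (81 * √m) := by gcongr
      _ ≤ _ := by
        gcongr
        rw [← ENNReal.ofReal_mul (by positivity)]
        apply ENNReal.ofReal_le_ofReal
        rw [hL]; field_simp; norm_num
  have h7 : ENNReal.ofReal (1/4) ≤ ENNReal.ofReal L * q := (ENNReal.add_le_add_iff_right ENNReal.ofReal_ne_top).1 h6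
  have h8 : ENNReal.ofReal (1/4) / ENNReal.ofReal L ≤ q := by
    rw [ENNReal.div_le_iff (by simpa using hL0) ENNReal.ofReal_ne_top, mul_comm]; exact h7
  refine le_trans (le_of_eq ?_) h8
  rw [← ENNReal.ofReal_div_of_pos hL0]
  congr 1; field_simp

lemma low_sq {m : ℕ} (hm : 1 ≤ m) :
    ENNReal.ofReal (1 / (64 * (324 * √m)^3)) ≤ ∫⁻ x, ind (-1) 0 x * Wk Z0 (m + m) (ind (-1) 0) x := by
  set L := 324 * √(m:ℝ) with hL
  have h2 : 1 ≤ √(m:ℝ) := Real.one_le_sqrt.2 (by exact_mod_cast hm)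
  have hL0 : 0 < L := by positivity
  set u := Wk Z0 m (ind (-1) 0) with hu
  have hum : Measurable u := by rw [hu]; fun_prop
  have e1 : ∫⁻ x, ind (-1) 0 x * Wk Z0 (m + m) (ind (-1) 0) x = ∫⁻ x, u x * u x := by
    rw [hu, adjW m (by fun_prop) (by fun_prop) (K_ind _) (K_Wk _ _ (K_ind _)), Wk_split]
  have e2 : ENNReal.ofReal (1 / (8 * L)) ≤ ∫⁻ x, u x * ind (-L) 0 x := by
    rw [hu, adjW m (by fun_prop) (by fun_prop) (K_ind _) (K_ind _)]
    calc ENNReal.ofReal (1 / (8 * L)) = ∫⁻ x, (Set.Icc (-1:ℝ) (-1/2)).indicator (fun _ => ENNReal.ofReal (1/(4*L))) x := by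
          rw [lintegral_indicator measurableSet_Icc, setLIntegral_const, Real.volume_Icc, ← ENNReal.ofReal_mul (by positivity)]
          congr 1; field_simp; norm_num
      _ ≤ _ := by
        refine lintegral_mono fun x => ?_
        by_cases hx : x ∈ Set.Icc (-1:ℝ) (-1/2)
        · simp only [Set.indicator_of_mem hx]
          unfold ind
          rw [Set.indicator_of_mem (by exact ⟨hx.1, by linarith [hx.2]⟩ : x ∈ Set.Icc (-1:ℝ) 0), one_mul]
          exact lowq hm hx.2 hx.1
        · simp only [Set.indicator_of_notMem hx]; exact zero_le
  set c := 1 / (8 * L^2) with hc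
  have hc0 : 0 ≤ c := by positivity
  have e3 : ENNReal.ofReal (2 * c) * ∫⁻ x, u x * ind (-L) 0 x ≤ (∫⁻ x, u x * u x) + ENNReal.ofReal (c^2) * ∫⁻ x, ind (-L) 0 x := by
    rw [← lintegral_const_mul _ (by fun_prop), ← lintegral_const_mul _ (by fun_prop), ← lintegral_add_left (by fun_prop)]
    refine lintegral_mono fun x => ?_
    simp only
    by_cases hx : x ∈ Set.Icc (-L) 0
    · simp only [ind, Set.indicator_of_mem hx, mul_one]
      have hfin : u x ≠ ⊤ := ne_top_of_le_ne_top ENNReal.one_ne_top (Wk_le_one Z0 m (f := ind (-1) 0) (fun y => by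
        unfold ind; exact Set.indicator_le_self' (fun _ _ => zero_le) y) x)
      rw [← ENNReal.ofReal_toReal hfin, ← ENNReal.ofReal_mul (by positivity), ← ENNReal.ofReal_mul (by positivity), ← ENNReal.ofReal_add (by positivity) (by positivity)]
      apply ENNReal.ofReal_le_ofReal
      nlinarith [sq_nonneg ((u x).toReal - c)]
    · simp only [ind, Set.indicator_of_notMem hx, mul_zero]; exact zero_le
  have e4 : ∫⁻ x, ind (-L) 0 x = ENNReal.ofReal L := by
    unfold ind; rw [lintegral_indicator measurableSet_Icc]; simp
  rw [e1]
  rw [e4, ← ENNReal.ofReal_mul (by positivity)] at e3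
  have e5 : ENNReal.ofReal (1 / (64 * L^3)) + ENNReal.ofReal (c^2 * L) ≤ (∫⁻ x, u x * u x) + ENNReal.ofReal (c^2 * L) := by
    refine le_trans ?_ e3
    refine le_trans ?_ (mul_le_mul_right e2 _)
    rw [← ENNReal.ofReal_mul (by positivity), ← ENNReal.ofReal_add (by positivity) (by positivity)]
    apply ENNReal.ofReal_le_ofReal
    apply le_of_eq
    rw [hc]; field_simp; norm_num
  exact (ENNReal.add_le_add_iff_right ENNReal.ofReal_ne_top).1 e5

lemma G_low {f : ℝ → ℝ≥0∞} (hf : Measurable f) {x : ℝ} (hx : x ∈ Set.Icc (-1:ℝ) 0) :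
    ENNReal.ofReal (gaussianPDFReal 0 1 1) * ∫⁻ y, ind (-1) 0 y * f y ≤ G f x := by
  unfold G g1
  rw [gaussianReal_of_var_ne_zero _ (by norm_num), lintegral_withDensity_eq_lintegral_mul _ (by fun_prop) (by fun_prop)]
  rw [← lintegral_add_left_eq_self _ x, ← lintegral_const_mul _ (by fun_prop)]
  refine lintegral_mono fun y => ?_
  simp only [Pi.mul_apply]
  by_cases hy : x + y ∈ Set.Icc (-1:ℝ) 0
  · simp only [ind, Set.indicator_of_mem hy, one_mul]
    gcongr
    unfold gaussianPDF gaussianPDFReal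
    apply ENNReal.ofReal_le_ofReal
    apply mul_le_mul_of_nonneg_left _ (by positivity)
    apply Real.exp_le_exp.2
    apply div_le_div_of_nonneg_right _ (by positivity)
    simp only [Set.mem_Icc] at hx hy
    nlinarith
  · simp only [ind, Set.indicator_of_notMem hy]; simp

lemma ballot_low : ∃ c : ℝ, 0 < c ∧ ∀ n : ℕ, 3 ≤ n →
    ENNReal.ofReal (c / (n:ℝ)^(3/2:ℝ)) ≤ Wk Z0 n (ind (-1) 0) 0 := by
  set φ := gaussianPDFReal 0 1 1 with hφ
  have hφ0 : 0 < φ := gaussianPDFReal_pos _ _ _ (by norm_num)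
  refine ⟨min φ (φ^2) / (64 * 324^3), by positivity, ?_⟩
  intro n hn
  set m := (n - 1) / 2 with hm
  have hm1 : 1 ≤ m := by omega
  have hA := low_sq hm1
  set A := ∫⁻ x, ind (-1) 0 x * Wk Z0 (m + m) (ind (-1) 0) x with hAd
  have h0 : (0:ℝ) ∈ Set.Icc (-1:ℝ) 0 := by simp
  have st1 : ∀ x ∈ Set.Icc (-1:ℝ) 0, ENNReal.ofReal φ * A ≤ Wk Z0 (m+m+1) (ind (-1) 0) x := by
    intro x hx
    rw [Wk_succ', K_of_le _ hx.2]
    exact G_low (by fun_prop) hx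
  have st2 : ENNReal.ofReal (φ^2) * A ≤ Wk Z0 (m+m+2) (ind (-1) 0) 0 := by
    rw [Wk_succ', K_of_le _ le_rfl]
    refine le_trans ?_ (G_low (by fun_prop) h0)
    rw [pow_two, ENNReal.ofReal_mul hφ0.le, mul_assoc]
    gcongr
    calc ENNReal.ofReal φ * A = ∫⁻ y, (Set.Icc (-1:ℝ) 0).indicator (fun _ => ENNReal.ofReal φ * A) y := by
          rw [lintegral_indicator measurableSet_Icc]; simp
      _ ≤ _ := by
        refine lintegral_mono fun y => ?_
        by_cases hy : y ∈ Set.Icc (-1:ℝ) 0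
        · simp only [ind, Set.indicator_of_mem hy, one_mul]; exact st1 y hy
        · simp only [Set.indicator_of_notMem hy]; exact zero_le
  have fin : ENNReal.ofReal (min φ (φ^2)) * A ≤ Wk Z0 n (ind (-1) 0) 0 := by
    rcases (by omega : n = m + m + 1 ∨ n = m+m+2) with h | h
    · rw [h]; refine le_trans ?_ (st1 0 h0); gcongr; exact min_le_left _ _
    · rw [h]; refine le_trans ?_ st2; gcongr; exact min_le_right _ _
  refine le_trans ?_ fin
  refine le_trans ?_ (mul_le_mul_right hA _)
  rw [← ENNReal.ofReal_mul (by positivity)]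
  apply ENNReal.ofReal_le_ofReal
  rw [div_div, mul_one_div]
  have hn0 : (0:ℝ) < n := by exact_mod_cast (by omega : 0 < n)
  have hm0 : (0:ℝ) < m := by exact_mod_cast hm1
  apply div_le_div_of_nonneg_left (by positivity) (by positivity)
  rw [mul_pow]
  have : √(m:ℝ)^3 ≤ (n:ℝ)^(3/2:ℝ) := by
    rw [Real.sqrt_eq_rpow, ← Real.rpow_natCast, ← Real.rpow_mul hm0.le]
    norm_num
    apply Real.rpow_le_rpow hm0.le _ (by norm_num)
    exact_mod_cast (by omega : m ≤ n)
  nlinarith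

end SC



namespace SC
open scoped ENNReal

/-- integrate out an independent variable -/
lemma indep_lint {Ω α β : Type*} {m0 : MeasurableSpace Ω} [MeasurableSpace α] [MeasurableSpace β]
    {P : Measure Ω} [IsProbabilityMeasure P]
    {V : Ω → α} {D : Ω → β} (hV : AEMeasurable V P) (hD : AEMeasurable D P) (h : IndepFun V D P)
    {φ : α × β → ℝ≥0∞} (hφ : Measurable φ) :
    ∫⁻ ω, φ (V ω, D ω) ∂P = ∫⁻ ω, (∫⁻ δ, φ (V ω, δ) ∂(P.map D)) ∂P := by
  have h1 : P.map (fun ω => (V ω, D ω)) = (P.map V).prod (P.map D) :=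
    (indepFun_iff_map_prod_eq_prod_map_map hV hD).1 h
  have : IsProbabilityMeasure (P.map D) := Measure.isProbabilityMeasure_map hD
  have : IsProbabilityMeasure (P.map V) := Measure.isProbabilityMeasure_map hV
  rw [← lintegral_map' (f := φ) hφ.aemeasurable (hV.prodMk hD), h1, lintegral_prod _ hφ.aemeasurable]
  rw [lintegral_map' (by fun_prop) hV]

/-- Cameron-Martin for finite Gaussian families -/
lemma cm_fin {Ω ι : Type*} [Fintype ι] {m0 : MeasurableSpace Ω}
    {P : Measure Ω} [IsProbabilityMeasure P] {U : ι → Ω → ℝ}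
    (hG : HasGaussianLaw (fun ω i => U i ω) P) (hc : ∀ i, ∫ ω, U i ω ∂P = 0)
    (c : ι → ℝ) (κ : ι → ℝ) (v : ℝ)
    (hκ : ∀ i, κ i = ∑ j, c j * ∫ ω, U j ω * U i ω ∂P) (hv : v = ∑ i, c i * κ i)
    {F : (ι → ℝ) → ℝ≥0∞} (hF : Measurable F) :
    ∫⁻ ω, E (∑ j, c j * U j ω) * F (fun i => U i ω) ∂P = E (v/2) * ∫⁻ ω, F (fun i => U i ω + κ i) ∂P := by
  have hm2 : ∀ i, MemLp (U i) 2 P := fun i => (hG.eval i).memLp_two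
  have him : ∀ i j, Integrable (fun ω => U i ω * U j ω) P := fun i j => (hm2 i).integrable_mul (hm2 j)
  have hUm : ∀ i, AEMeasurable (U i) P := fun i => (hG.eval i).aemeasurable
  let L : (ι → ℝ) →L[ℝ] ℝ := ∑ j, (c j) • ContinuousLinearMap.proj (R := ℝ) (φ := fun _ : ι => ℝ) j
  have hL : ∀ x, L x = ∑ j, c j * x j := by intro x; simp [L]
  set ξ : Ω → ℝ := fun ω => ∑ j, c j * U j ω with hξ
  have hξG : HasGaussianLaw ξ P := by
    have := hG.map_fun L
    simpa only [hL] using this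
  have hξ0 : ∫ ω, ξ ω ∂P = 0 := by
    rw [hξ, integral_finsetSum]
    · simp [integral_const_mul, hc]
    · intro i _; exact ((hm2 i).integrable (by norm_num)).const_mul _
  have hξU : ∀ i, ∫ ω, ξ ω * U i ω ∂P = κ i := by
    intro i
    simp_rw [hξ, Finset.sum_mul]
    rw [integral_finsetSum]
    · rw [hκ]; refine Finset.sum_congr rfl fun j _ => ?_
      rw [← integral_const_mul]; congr 1; funext ω; ring
    · intro j _; simp_rw [mul_assoc]; exact (him j i).const_mul _
  have hξξ : ∫ ω, ξ ω * ξ ω ∂P = v := by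
    have : ∀ ω, ξ ω * ξ ω = ∑ i, c i * (ξ ω * U i ω) := by
      intro ω; conv_lhs => rw [hξ]
      simp only [Finset.mul_sum]
      refine Finset.sum_congr rfl fun j _ => by ring
    simp_rw [this]
    rw [integral_finsetSum]
    · rw [hv]; refine Finset.sum_congr rfl fun j _ => ?_
      rw [integral_const_mul, hξU]
    · intro j _; exact (hξG.memLp_two.integrable_mul (hm2 j)).const_mul _
  have hvar : Var[ξ; P] = v := by
    rw [variance_of_integral_eq_zero hξG.aemeasurable hξ0, ← hξξ]; congr 1; funext ω; simp [sq]
  have hv0 : 0 ≤ v := hvar ▸ variance_nonneg _ _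
  have hlaw : P.map ξ = gaussianReal 0 v.toNNReal := by
    rw [hξG.map_eq_gaussianReal, hξ0, hvar]
  rcases eq_or_ne v 0 with hv' | hv'
  · have hz : ξ =ᵐ[P] 0 := by
      have h0 : ∀ᵐ x ∂(P.map ξ), x = 0 := by
        rw [hlaw, hv']; simp
      exact ae_of_ae_map hξG.aemeasurable h0
    have hκ0 : ∀ i, κ i = 0 := by
      intro i; rw [← hξU i]
      rw [integral_congr_ae (g := fun _ => 0)]
      · simp
      · filter_upwards [hz] with ω h; simp [h]
    rw [hv']; simp only [hκ0, add_zero, zero_div, E_zero, one_mul]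
    refine lintegral_congr_ae ?_
    filter_upwards [hz] with ω h
    have : ∑ j, c j * U j ω = 0 := h
    rw [this, E_zero, one_mul]
  · set R : ι → Ω → ℝ := fun i ω => U i ω - (κ i / v) * ξ ω with hR
    let M : (ι → ℝ) →L[ℝ] ((ι → ℝ) × (Unit → ℝ)) :=
      (ContinuousLinearMap.pi fun i => ContinuousLinearMap.proj (R := ℝ) (φ := fun _ : ι => ℝ) i - (κ i / v) • L).prod
        (ContinuousLinearMap.pi fun _ => L)
    have hRG : HasGaussianLaw (fun ω ↦ (fun i ↦ R i ω, fun _ : Unit ↦ ξ ω)) P := by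
      have := hG.map_fun M
      have e : (fun ω => M (fun i => U i ω)) = (fun ω ↦ (fun i ↦ R i ω, fun _ : Unit ↦ ξ ω)) := by
        funext ω
        refine Prod.ext ?_ ?_
        · funext i
          change U i ω - (κ i / v) * L (fun i => U i ω) = _
          rw [hL]
        · funext i
          change L (fun i => U i ω) = _
          rw [hL]
      rwa [e] at this
    have hind : IndepFun (fun ω i => R i ω) (fun ω (_ : Unit) => ξ ω) P := by
      refine HasGaussianLaw.indepFun_of_covariance_eval (X := R) (Y := fun _ => ξ) hRG ?_
      intro i _
      have hRm : MemLp (R i) 2 P := (hm2 i).sub (hξG.memLp_two.const_mul _)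
      rw [covariance_eq_sub hRm hξG.memLp_two]
      have : P[R i * ξ] = 0 := by
        have : ∀ ω, (R i * ξ) ω = ξ ω * U i ω - (κ i / v) * (ξ ω * ξ ω) := by
          intro ω; simp only [Pi.mul_apply, hR]; ring
        simp_rw [this]
        rw [integral_sub, integral_const_mul, hξU, hξξ]
        · field_simp; simp
        · exact hξG.memLp_two.integrable_mul (hm2 i)
        · exact (hξG.memLp_two.integrable_mul hξG.memLp_two).const_mul _
      rw [this, hξ0]; simp
    have hind' : IndepFun (fun ω i => R i ω) ξ P :=
      hind.comp (φ := id) (ψ := fun f : Unit → ℝ => f ()) measurable_id (measurable_pi_apply _)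
    have hRm : AEMeasurable (fun ω i => R i ω) P := by
      refine aemeasurable_pi_lambda _ fun i => ?_
      exact (hUm i).sub (hξG.aemeasurable.const_mul _)
    have hvn : (v.toNNReal : ℝ) = v := Real.coe_toNNReal _ hv0
    have e1 : ∀ ω, E (∑ j, c j * U j ω) * F (fun i => U i ω)
        = (fun p : (ι → ℝ) × ℝ => E (1 * p.2) * F (fun i => p.1 i + κ i / v * p.2)) (fun i => R i ω, ξ ω) := by
      intro ω; simp [hR, hξ]
    have e2 : ∀ ω, F (fun i => U i ω + κ i)
        = (fun p : (ι → ℝ) × ℝ => F (fun i => p.1 i + κ i / v * (p.2 + 1 * v))) (fun i => R i ω, ξ ω) := by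
      intro ω; simp only [hR]; congr 1; funext i; field_simp; ring
    rw [lintegral_congr e1, lintegral_congr e2,
      indep_lint hRm hξG.aemeasurable hind' (φ := fun p : (ι → ℝ) × ℝ => E (1 * p.2) * F (fun i => p.1 i + κ i / v * p.2)) (by fun_prop),
      indep_lint hRm hξG.aemeasurable hind' (φ := fun p : (ι → ℝ) × ℝ => F (fun i => p.1 i + κ i / v * (p.2 + 1 * v))) (by fun_prop),
      ← lintegral_const_mul' _ _ (E_ne_top _), hlaw]
    refine lintegral_congr fun ω => ?_
    have := cm1 1 v.toNNReal (F := fun x => F (fun i => R i ω + κ i / v * x)) (by fun_prop)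
    simp only [hvn] at this
    rw [this]; simp

end SC



namespace SC
open scoped ENNReal
set_option linter.unusedSectionVars false

/-- euclidean space abbreviation -/
abbrev Eu (d : ℕ) := EuclideanSpace ℝ (Fin d)

/-- filtration generated by the field -/
@[reducible] def Fil {d : ℕ} {Ω : Type*} (X : ℝ → Eu d → Ω → ℝ) (s : ℝ) : MeasurableSpace Ω :=
  ⨆ u ∈ Set.Icc (0:ℝ) s, ⨆ x : Eu d, MeasurableSpace.comap (X u x) inferInstance

/-- covariance kernel at scale t -/
def Kf {d : ℕ} (k : Eu d → ℝ) (t : ℝ) (z : Eu d) : ℝ :=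
  ∫ u in Set.Icc (1:ℝ) (Real.exp t), k (u • z) / u

/-- bundle of the hypotheses on the field -/
structure FH {d : ℕ} {Ω : Type*} [MeasurableSpace Ω] (P : Measure Ω) (k : Eu d → ℝ) (X : ℝ → Eu d → Ω → ℝ) : Prop where
  k1 : ContDiff ℝ 1 k
  k0 : k 0 = 1
  kb : ∀ z, |k z| ≤ 1
  ksupp : HasCompactSupport k
  meas : ∀ t x, Measurable (X t x)
  gauss : ∀ (n : ℕ) (c : Fin n → ℝ) (t : Fin n → ℝ) (x : Fin n → Eu d),
      ∃ v : NNReal, Measure.map (fun ω => ∑ i, c i * X (t i) (x i) ω) P = gaussianReal 0 v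
  cent : ∀ t x, ∫ ω, X t x ω ∂P = 0
  cov : ∀ t, 0 ≤ t → ∀ x y : Eu d, ∫ ω, X t x ω * X t y ω ∂P = Kf k t (x - y)
  cont : ∀ᵐ ω ∂P, Continuous fun p : ℝ × Eu d => X p.1 p.2 ω
  indep : ∀ s t : ℝ, 0 ≤ s → s < t →
      Indep (⨆ x : Eu d, MeasurableSpace.comap (fun ω => X t x ω - X s x ω) inferInstance) (Fil X s) P

variable {d : ℕ} {Ω : Type*} [m0 : MeasurableSpace Ω] {P : Measure Ω} [IsProbabilityMeasure P]
  {k : Eu d → ℝ} {X : ℝ → Eu d → Ω → ℝ}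


lemma FH.gl (h : FH P k X) {ι : Type*} [Fintype ι] (t : ι → ℝ) (x : ι → Eu d) :
    HasGaussianLaw (fun ω i => X (t i) (x i) ω) P := by
  have hm : Measurable (fun ω i => X (t i) (x i) ω) := measurable_pi_lambda _ fun i => h.meas _ _
  have : IsGaussian (P.map (fun ω i => X (t i) (x i) ω)) := by
    refine isGaussian_of_map_eq_gaussianReal fun L => ?_
    classical
    let e := Fintype.equivFin ι
    obtain ⟨v, hv⟩ := h.gauss (Fintype.card ι) (fun i => L (Pi.single (e.symm i) 1)) (fun i => t (e.symm i)) (fun i => x (e.symm i))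
    refine ⟨0, v, ?_⟩
    rw [← hv, Measure.map_map L.continuous.measurable hm]
    congr 1; funext ω
    simp only [Function.comp]
    rw [e.symm.sum_comp (fun i => L (Pi.single i 1) * X (t i) (x i) ω)]
    refine (L.toLinearMap.pi_apply_eq_sum_univ (fun i => X (t i) (x i) ω)).trans ?_
    refine Finset.sum_congr rfl fun i _ => ?_
    rw [smul_eq_mul, mul_comm]; congr 1; change L _ = L _; congr 1; funext j; simp [Pi.single_apply, eq_comm]
  exact IsGaussian.hasGaussianLaw

lemma FH.memLp (h : FH P k X) (t : ℝ) (x : Eu d) : MemLp (X t x) 2 P := by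
  have := (h.gl (fun _ : Unit => t) (fun _ => x)).eval ()
  exact this.memLp_two

lemma Fil_meas (X : ℝ → Eu d → Ω → ℝ) {s u : ℝ} (hu : 0 ≤ u) (hus : u ≤ s) (x : Eu d) : Measurable[Fil X s] (X u x) := by
  apply Measurable.of_comap_le
  exact le_trans (le_iSup (fun x : Eu d => MeasurableSpace.comap (X u x) inferInstance) x)
    (le_iSup₂_of_le u ⟨hu, hus⟩ le_rfl)

lemma FH.Fil_le (h : FH P k X) (s : ℝ) : Fil X s ≤ m0 := by
  refine iSup₂_le fun u _ => iSup_le fun x => ?_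
  exact (h.meas u x).comap_le

lemma Fil_mono (X : ℝ → Eu d → Ω → ℝ) {s t : ℝ} (hst : s ≤ t) : Fil X s ≤ Fil X t := by
  refine iSup₂_le fun u hu => iSup_le fun x => ?_
  exact (Fil_meas X hu.1 (hu.2.trans hst) x).comap_le

/-- increments are independent of the past -/
lemma FH.indepFun (h : FH P k X) {s t : ℝ} (hs : 0 ≤ s) (hst : s < t) {α : Type*} [MeasurableSpace α] {V : Ω → α}
    (hV : Measurable[Fil X s] V) {ι : Type*} (x : ι → Eu d) :
    IndepFun V (fun ω i => X t (x i) ω - X s (x i) ω) P := by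
  have h1 := (h.indep s t hs hst).symm
  have h2 : Measurable[⨆ x : Eu d, MeasurableSpace.comap (fun ω => X t x ω - X s x ω) inferInstance]
      (fun ω i => X t (x i) ω - X s (x i) ω) := by
    refine @measurable_pi_lambda _ _ _ (_) _ _ fun i => ?_
    apply Measurable.of_comap_le
    exact le_iSup (fun x : Eu d => MeasurableSpace.comap (fun ω => X t x ω - X s x ω) inferInstance) (x i)
  exact indep_of_indep_of_le_left (indep_of_indep_of_le_right h1 h2.comap_le) hV.comap_le

lemma FH.indepFun1 (h : FH P k X) {s t : ℝ} (hs : 0 ≤ s) (hst : s < t) {α : Type*} [MeasurableSpace α] {V : Ω → α}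
    (hV : Measurable[Fil X s] V) (x : Eu d) :
    IndepFun V (fun ω => X t x ω - X s x ω) P :=
  (h.indepFun hs hst hV (fun _ : Unit => x)).comp measurable_id (measurable_pi_apply ())

lemma FH.cov2 (h : FH P k X) {s t : ℝ} (hs : 0 ≤ s) (hst : s ≤ t) (x y : Eu d) :
    ∫ ω, X s x ω * X t y ω ∂P = Kf k s (x - y) := by
  rcases eq_or_lt_of_le hst with rfl | hst
  · exact h.cov s hs x y
  have h1 : ∫ ω, X s x ω * (X t y ω - X s y ω) ∂P = 0 := by
    have := (h.indepFun1 hs hst (Fil_meas X hs le_rfl x) y).integral_fun_mul_eq_mul_integral (h.meas s x).aestronglyMeasurable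
      (by have := h.meas t y; have := h.meas s y; fun_prop)
    rw [this, h.cent]; simp
  have : ∀ ω, X s x ω * X t y ω = X s x ω * X s y ω + X s x ω * (X t y ω - X s y ω) := by intro ω; ring
  simp_rw [this]
  rw [integral_add, h1, h.cov s hs, add_zero]
  · exact (h.memLp s x).integrable_mul (h.memLp s y)
  · exact (h.memLp s x).integrable_mul ((h.memLp t y).sub (h.memLp s y))

lemma FH.kcont (h : FH P k X) : Continuous k := h.k1.continuous

lemma Kf_intOn (h : FH P k X) {a b : ℝ} (ha : 0 < a) (z : Eu d) :
    IntegrableOn (fun u : ℝ => k (u • z) / u) (Set.Icc a b) := by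
  apply ContinuousOn.integrableOn_Icc
  apply ContinuousOn.div
  · exact (h.kcont.comp (by fun_prop : Continuous fun u : ℝ => u • z)).continuousOn
  · fun_prop
  · intro x hx; exact (ha.trans_le hx.1).ne'

lemma int_inv (t : ℝ) (ht : 0 ≤ t) : ∫ u in Set.Icc (1:ℝ) (Real.exp t), 1 / u = t := by
  rw [integral_Icc_eq_integral_Ioc, ← intervalIntegral.integral_of_le (by simpa using ht), integral_one_div_of_pos one_pos (Real.exp_pos _)]
  simp

lemma Kf_zero (h : FH P k X) {t : ℝ} (ht : 0 ≤ t) : Kf k t 0 = t := by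
  unfold Kf; simp only [smul_zero, h.k0]; exact int_inv t ht

/-- kappa -/
lemma kap_nonneg (h : FH P k X) {t : ℝ} (ht : 0 ≤ t) (z : Eu d) : Kf k t z ≤ t := by
  conv_rhs => rw [← int_inv t ht]
  unfold Kf
  apply setIntegral_mono_on (Kf_intOn h one_pos z) _ measurableSet_Icc
  · intro u hu
    have : 0 < u := one_pos.trans_le hu.1
    gcongr; exact (abs_le.1 (h.kb _)).2
  · have := Kf_intOn h (b := Real.exp t) one_pos 0
    simp only [smul_zero, h.k0] at this
    exact this

lemma FH.lip (h : FH P k X) : ∃ L : ℝ, 0 ≤ L ∧ ∀ z, 1 - k z ≤ L * ‖z‖ := by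
  obtain ⟨C, hC⟩ := h.k1.lipschitzWith_of_hasCompactSupport h.ksupp one_ne_zero
  refine ⟨C, C.2, fun z => ?_⟩
  have := hC.dist_le_mul 0 z
  rw [h.k0, Real.dist_eq, dist_zero_left] at this
  exact (le_abs_self _).trans this

lemma kap_le (h : FH P k X) {L : ℝ} (hL : 0 ≤ L) (hLk : ∀ z, 1 - k z ≤ L * ‖z‖) {t : ℝ} (ht : 0 ≤ t) (z : Eu d) :
    t - Kf k t z ≤ L * ‖z‖ * Real.exp t := by
  have hi : IntegrableOn (fun u : ℝ => 1 / u) (Set.Icc 1 (Real.exp t)) := by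
    have := Kf_intOn h (b := Real.exp t) one_pos 0
    simpa [h.k0] using this
  conv_lhs => enter [1]; rw [← int_inv t ht]
  unfold Kf
  rw [← integral_sub hi (Kf_intOn h one_pos z)]
  calc _ ≤ ∫ u in Set.Icc (1:ℝ) (Real.exp t), L * ‖z‖ := by
        apply setIntegral_mono_on (hi.sub (Kf_intOn h one_pos z)) _ measurableSet_Icc
        · intro u hu
          have hu0 : 0 < u := one_pos.trans_le hu.1
          change 1 / u - k (u • z) / u ≤ _
          rw [← sub_div, div_le_iff₀ hu0]
          have := hLk (u • z)
          rw [norm_smul, Real.norm_eq_abs, abs_of_pos hu0] at this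
          linarith
        · exact integrableOn_const (by simp)
    _ ≤ _ := by
        simp only [integral_const, MeasurableSet.univ, measureReal_restrict_apply, Set.univ_inter, Real.volume_real_Icc, smul_eq_mul]
        rw [max_eq_left (by simpa using ht)]
        have : 0 ≤ L * ‖z‖ := by positivity
        nlinarith

lemma FH.supp (h : FH P k X) : ∃ R : ℝ, 0 < R ∧ ∀ z, R ≤ ‖z‖ → k z = 0 := by
  obtain ⟨R, hR⟩ := h.ksupp.isCompact.isBounded.exists_norm_le
  refine ⟨max R 0 + 1, by positivity, fun z hz => ?_⟩
  by_contra hne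
  have := hR z (subset_tsupport _ hne)
  have := le_max_left R 0
  linarith

lemma Kf_diff (h : FH P k X) {R : ℝ} (hR : ∀ z, R ≤ ‖z‖ → k z = 0) {s t : ℝ} (hs : 0 ≤ s) (hst : s ≤ t) {z : Eu d}
    (hz : R ≤ Real.exp s * ‖z‖) : Kf k t z = Kf k s z := by
  unfold Kf
  have e1 : (1:ℝ) ≤ Real.exp s := by simpa using hs
  have e2 : Real.exp s ≤ Real.exp t := by simpa using hst
  rw [integral_Icc_eq_integral_Ioc, integral_Icc_eq_integral_Ioc, ← Set.Ioc_union_Ioc_eq_Ioc e1 e2,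
    setIntegral_union (Set.Ioc_disjoint_Ioc_of_le le_rfl) measurableSet_Ioc]
  · rw [setIntegral_eq_zero_of_forall_eq_zero (t := Set.Ioc (Real.exp s) (Real.exp t)), add_zero]
    intro u hu
    have hu0 : 0 < u := (Real.exp_pos s).trans hu.1
    rw [hR, zero_div]
    rw [norm_smul, Real.norm_eq_abs, abs_of_pos hu0]
    exact hz.trans (by gcongr; exact hu.1.le)
  · exact (Kf_intOn h one_pos z).mono_set Set.Ioc_subset_Icc_self
  · exact (Kf_intOn h (Real.exp_pos s) z).mono_set Set.Ioc_subset_Icc_self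

lemma FH.zero (h : FH P k X) (x : Eu d) : ∀ᵐ ω ∂P, X 0 x ω = 0 := by
  have h1 := h.cov 0 le_rfl x x
  rw [sub_self, Kf_zero h le_rfl] at h1
  rw [integral_eq_zero_iff_of_nonneg (fun ω => mul_self_nonneg _) ((h.memLp 0 x).integrable_mul (h.memLp 0 x))] at h1
  filter_upwards [h1] with ω hω
  simpa using hω

lemma FH.incr_cov (h : FH P k X) {s t : ℝ} (hs : 0 ≤ s) (hst : s ≤ t) (x y : Eu d) :
    ∫ ω, (X t x ω - X s x ω) * (X t y ω - X s y ω) ∂P = Kf k t (x - y) - Kf k s (x - y) := by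
  have e : ∀ ω, (X t x ω - X s x ω) * (X t y ω - X s y ω) = X t x ω * X t y ω - X s y ω * X t x ω
    - (X s x ω * X t y ω - X s x ω * X s y ω) := by intro ω; ring
  simp_rw [e]
  have hi : ∀ s t x y, Integrable (fun ω => X s x ω * X t y ω) P := fun s t x y => (h.memLp s x).integrable_mul (h.memLp t y)
  have hsym : Kf k s (y - x) = Kf k s (x - y) := by
    rw [← h.cov s hs, ← h.cov s hs]; congr 1; funext ω; ring
  have hi2 : ∀ s t x y s' t' x' y', Integrable (fun ω => X s x ω * X t y ω - X s' x' ω * X t' y' ω) P :=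
    fun s t x y s' t' x' y' => (hi s t x y).sub (hi s' t' x' y')
  rw [integral_sub (hi2 _ _ _ _ _ _ _ _) (hi2 _ _ _ _ _ _ _ _), integral_sub (hi _ _ _ _) (hi _ _ _ _),
    integral_sub (hi _ _ _ _) (hi _ _ _ _), h.cov t (hs.trans hst), h.cov s hs, h.cov2 hs hst, h.cov2 hs hst, hsym]
  ring

lemma FH.incr_gl (h : FH P k X) {ι : Type*} [Fintype ι] (s t : ℝ) (x : ι → Eu d) :
    HasGaussianLaw (fun ω i => X t (x i) ω - X s (x i) ω) P := by
  have := h.gl (ι := ι ⊕ ι) (Sum.elim (fun _ => t) (fun _ => s)) (Sum.elim x x)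
  let M : (ι ⊕ ι → ℝ) →L[ℝ] (ι → ℝ) := ContinuousLinearMap.pi fun i =>
    ContinuousLinearMap.proj (R := ℝ) (φ := fun _ : ι ⊕ ι => ℝ) (Sum.inl i) - ContinuousLinearMap.proj (R := ℝ) (φ := fun _ : ι ⊕ ι => ℝ) (Sum.inr i)
  exact this.map_fun M

lemma FH.incr_law (h : FH P k X) {s t : ℝ} (hs : 0 ≤ s) (hst : s ≤ t) (x : Eu d) :
    P.map (fun ω => X t x ω - X s x ω) = gaussianReal 0 (t - s).toNNReal := by
  have h1 : HasGaussianLaw (fun ω => X t x ω - X s x ω) P := (h.incr_gl s t (fun _ : Unit => x)).eval ()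
  have h0 : ∫ ω, (X t x ω - X s x ω) ∂P = 0 := by
    rw [integral_sub ((h.memLp t x).integrable (by norm_num)) ((h.memLp s x).integrable (by norm_num)), h.cent, h.cent, sub_zero]
  rw [h1.map_eq_gaussianReal, h0, variance_of_integral_eq_zero h1.aemeasurable h0]
  congr 2
  have := h.incr_cov hs hst x x
  rw [sub_self, Kf_zero h hs, Kf_zero h (hs.trans hst)] at this
  rw [← this]; congr 1; funext ω; simp [sq]

lemma FH.incr_law2 (h : FH P k X) {R : ℝ} (hR : ∀ z, R ≤ ‖z‖ → k z = 0) {s t : ℝ} (hs : 0 ≤ s) (hst : s ≤ t) {x y : Eu d}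
    (hz : R ≤ Real.exp s * ‖x - y‖) :
    P.map (fun ω => (X t x ω - X s x ω, X t y ω - X s y ω)) =
      (gaussianReal 0 (t - s).toNNReal).prod (gaussianReal 0 (t - s).toNNReal) := by
  have h1 : HasGaussianLaw (fun ω => (X t x ω - X s x ω, X t y ω - X s y ω)) P :=
    (h.incr_gl s t ![x, y]).prodMk (X := fun i ω => X t (![x,y] i) ω - X s (![x,y] i) ω) 0 1
  have h0 : ∀ x, ∫ ω, (X t x ω - X s x ω) ∂P = 0 := by
    intro x
    rw [integral_sub ((h.memLp t x).integrable (by norm_num)) ((h.memLp s x).integrable (by norm_num)), h.cent, h.cent, sub_zero]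
  have h2 := h1.indepFun_of_covariance_eq_zero (by
    rw [covariance_eq_sub h1.fst.memLp_two h1.snd.memLp_two, h0, h0]
    have := h.incr_cov hs hst x y
    rw [Kf_diff h hR hs hst hz, sub_self] at this
    simpa using this)
  rw [(indepFun_iff_map_prod_eq_prod_map_map h1.fst.aemeasurable h1.snd.aemeasurable).1 h2, h.incr_law hs hst, h.incr_law hs hst]

/-- one-step peel -/
lemma FH.peel (h : FH P k X) (i : ℕ) {H : Ω → ℝ≥0∞} (hH : Measurable[Fil X i] H) {f : ℝ → ℝ≥0∞} (hf : Measurable f) (x : Eu d) :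
    ∫⁻ ω, H ω * f (X (i+1:ℕ) x ω) ∂P = ∫⁻ ω, H ω * G f (X i x ω) ∂P := by
  have hi : (0:ℝ) ≤ i := by positivity
  have hi1 : (i:ℝ) < (i+1:ℕ) := by push_cast; linarith
  have hV : Measurable[Fil X i] (fun ω => (H ω, X i x ω)) := hH.prodMk (Fil_meas X hi le_rfl x)
  have hV' := hV.mono (h.Fil_le i) le_rfl
  have hD : Measurable (fun ω => X (i+1:ℕ) x ω - X i x ω) := (h.meas _ _).sub (h.meas _ _)
  have := indep_lint hV'.aemeasurable hD.aemeasurable (h.indepFun1 hi hi1 hV x)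
    (φ := fun p : (ℝ≥0∞ × ℝ) × ℝ => p.1.1 * f (p.1.2 + p.2)) (by fun_prop)
  rw [h.incr_law hi hi1.le] at this
  simp only [add_sub_cancel] at this
  rw [this]
  refine lintegral_congr fun ω => ?_
  unfold G g1
  rw [lintegral_const_mul _ (by fun_prop)]
  simp

lemma FH.peel2 (h : FH P k X) {R : ℝ} (hR : ∀ z, R ≤ ‖z‖ → k z = 0) (i : ℕ) {x y : Eu d}
    (hz : R ≤ Real.exp i * ‖x - y‖)
    {H : Ω → ℝ≥0∞} (hH : Measurable[Fil X i] H) {f g : ℝ → ℝ≥0∞} (hf : Measurable f) (hg : Measurable g) :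
    ∫⁻ ω, H ω * (f (X (i+1:ℕ) x ω) * g (X (i+1:ℕ) y ω)) ∂P = ∫⁻ ω, H ω * (G f (X i x ω) * G g (X i y ω)) ∂P := by
  have hi : (0:ℝ) ≤ i := by positivity
  have hi1 : (i:ℝ) < (i+1:ℕ) := by push_cast; linarith
  have hV : Measurable[Fil X i] (fun ω => (H ω, X i x ω, X i y ω)) :=
    hH.prodMk ((Fil_meas X hi le_rfl x).prodMk (Fil_meas X hi le_rfl y))
  have hV' := hV.mono (h.Fil_le i) le_rfl
  have hD : Measurable (fun ω => (X (i+1:ℕ) x ω - X i x ω, X (i+1:ℕ) y ω - X i y ω)) :=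
    ((h.meas _ _).sub (h.meas _ _)).prodMk ((h.meas _ _).sub (h.meas _ _))
  have hI := (h.indepFun hi hi1 hV ![x,y]).comp (φ := id) (ψ := fun f : Fin 2 → ℝ => (f 0, f 1)) measurable_id (by fun_prop)
  have := indep_lint hV'.aemeasurable hD.aemeasurable hI
    (φ := fun p : (ℝ≥0∞ × ℝ × ℝ) × ℝ × ℝ => p.1.1 * (f (p.1.2.1 + p.2.1) * g (p.1.2.2 + p.2.2))) (by fun_prop)
  rw [h.incr_law2 hR hi hi1.le hz] at this
  simp only [add_sub_cancel] at this
  rw [this]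
  refine lintegral_congr fun ω => ?_
  unfold G g1
  rw [lintegral_const_mul _ (by fun_prop)]
  congr 1
  have e : ((i+1:ℕ) - (i:ℝ)).toNNReal = 1 := by push_cast; simp
  rw [e]
  exact lintegral_prod_mul (f := fun δ => f (X i x ω + δ)) (g := fun δ => g (X i y ω + δ)) (by fun_prop) (by fun_prop)

/-- exponential moment of fractional increments -/
lemma FH.frac (h : FH P k X) {s t : ℝ} (hs : 0 ≤ s) (hst : s ≤ t) (γ : ℝ) {H : Ω → ℝ≥0∞} (hH : Measurable[Fil X s] H) (x : Eu d) :
    ∫⁻ ω, H ω * E (γ * (X t x ω - X s x ω)) ∂P = E (γ^2 * (t-s)/2) * ∫⁻ ω, H ω ∂P := by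
  rcases eq_or_lt_of_le hst with rfl | hst
  · simp [E_zero]
  have hH' := hH.mono (h.Fil_le s) le_rfl
  have hD : Measurable (fun ω => X t x ω - X s x ω) := (h.meas _ _).sub (h.meas _ _)
  have := indep_lint hH'.aemeasurable hD.aemeasurable (h.indepFun1 hs hst hH x)
    (φ := fun p : ℝ≥0∞ × ℝ => p.1 * E (γ * p.2)) (by fun_prop)
  simp only at this
  rw [this, h.incr_law hs hst.le, mul_comm, ← lintegral_mul_const _ hH']
  refine lintegral_congr fun ω => ?_
  rw [lintegral_const_mul _ (by fun_prop)]
  have := cm1 γ (t-s).toNNReal (F := fun _ => 1) (by fun_prop)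
  simp only [mul_one, lintegral_const, measure_univ] at this
  rw [this, Real.coe_toNNReal _ (by linarith)]

lemma FH.frac2 (h : FH P k X) {s t : ℝ} (hs : 0 ≤ s) (hst : s ≤ t) (γ : ℝ) {H : Ω → ℝ≥0∞} (hH : Measurable[Fil X s] H) (x y : Eu d) :
    ∫⁻ ω, H ω * (E (γ * (X t x ω - X s x ω)) * E (γ * (X t y ω - X s y ω))) ∂P ≤ 2 * E (2 * γ^2 * (t-s)) * ∫⁻ ω, H ω ∂P := by
  have hH' := hH.mono (h.Fil_le s) le_rfl
  have hD : ∀ x, Measurable (fun ω => X t x ω - X s x ω) := fun x => (h.meas _ _).sub (h.meas _ _)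
  calc _ ≤ ∫⁻ ω, (H ω * E ((2*γ) * (X t x ω - X s x ω)) + H ω * E ((2*γ) * (X t y ω - X s y ω))) ∂P := by
        refine lintegral_mono fun ω => ?_
        simp only
        rw [← mul_add, ← E_add]
        refine mul_le_mul_right ?_ _
        rcases le_total (γ * (X t x ω - X s x ω)) (γ * (X t y ω - X s y ω)) with hh | hh
        · exact le_add_left (E_mono (by linarith))
        · exact le_add_right (E_mono (by linarith))
    _ = _ := by
        have := hD x
        rw [lintegral_add_left (by fun_prop), h.frac hs hst _ hH, h.frac hs hst _ hH]
        rw [show (2*γ)^2*(t-s)/2 = 2 * γ^2 * (t-s) by ring]; ring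

end SC



namespace SC
open scoped ENNReal
set_option linter.unusedSectionVars false

/-- barrier indicator -/
def ib (b s : ℝ) : ℝ≥0∞ := (Set.Iic b).indicator (fun _ => 1) s

@[fun_prop]
lemma ib_meas (b : ℝ) : Measurable (ib b) := by
  unfold ib; exact measurable_const.indicator measurableSet_Iic

lemma ib_le_one (b s : ℝ) : ib b s ≤ 1 := by
  unfold ib; exact Set.indicator_le_self' (by simp) s

lemma ib_of_le {b s : ℝ} (h : s ≤ b) : ib b s = 1 := by simp [ib, h]
lemma ib_of_lt {b s : ℝ} (h : b < s) : ib b s = 0 := by simp [ib, h]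
lemma ib_mono {b b' s s' : ℝ} (h : s ≤ b → s' ≤ b') : ib b s ≤ ib b' s' := by
  rcases le_or_gt s b with h1 | h1
  · rw [ib_of_le h1, ib_of_le (h h1)]
  · rw [ib_of_lt h1]; exact zero_le

lemma K_eq (b : ℝ) (f : ℝ → ℝ≥0∞) (s : ℝ) : K b f s = ib b s * f s := by
  rcases le_or_gt s b with h1 | h1
  · rw [ib_of_le h1, K_of_le _ h1, one_mul]
  · rw [ib_of_lt h1, K_of_lt _ h1, zero_mul]

variable {d : ℕ} {Ω : Type*} [m0 : MeasurableSpace Ω] {P : Measure Ω} [IsProbabilityMeasure P]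
  {k : Eu d → ℝ} {X : ℝ → Eu d → Ω → ℝ}

/-- path stays below barrier -/
def pp (X : ℝ → Eu d → Ω → ℝ) (b : ℕ → ℝ) (l n : ℕ) (x : Eu d) (ω : Ω) : ℝ≥0∞ :=
  ∏ i ∈ Finset.range n, ib (b i) (X (l+i:ℕ) x ω)

lemma pp_succ (b : ℕ → ℝ) (l n : ℕ) (x : Eu d) (ω : Ω) :
    pp X b l (n+1) x ω = pp X b l n x ω * ib (b n) (X (l+n:ℕ) x ω) := by
  unfold pp; rw [Finset.prod_range_succ]

lemma pp_add (b : ℕ → ℝ) (l m n : ℕ) (x : Eu d) (ω : Ω) :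
    pp X b l (m+n) x ω = pp X b l m x ω * pp X (fun i => b (m+i)) (l+m) n x ω := by
  unfold pp; rw [Finset.prod_range_add]; simp only [add_assoc]

lemma pp_le_one (b : ℕ → ℝ) (l n : ℕ) (x : Eu d) (ω : Ω) : pp X b l n x ω ≤ 1 :=
  Finset.prod_le_one' fun _ _ => ib_le_one _ _

lemma pp_one {b : ℕ → ℝ} {l n : ℕ} {x : Eu d} {ω : Ω} (h : ∀ i < n, X (l+i:ℕ) x ω ≤ b i) : pp X b l n x ω = 1 := by
  unfold pp; exact Finset.prod_eq_one fun i hi => ib_of_le (h i (Finset.mem_range.1 hi))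

lemma pp_zero {b : ℕ → ℝ} {l n : ℕ} {x : Eu d} {ω : Ω} (i : ℕ) (hi : i < n) (h : b i < X (l+i:ℕ) x ω) : pp X b l n x ω = 0 := by
  unfold pp; exact Finset.prod_eq_zero (Finset.mem_range.2 hi) (ib_of_lt h)

lemma FH.Fil_nat (X : ℝ → Eu d → Ω → ℝ) {i m : ℕ} (hi : i ≤ m) (x : Eu d) : Measurable[Fil X m] (X i x) :=
  Fil_meas X (by positivity) (by exact_mod_cast hi) x

lemma pp_meas (X : ℝ → Eu d → Ω → ℝ) (b : ℕ → ℝ) (l n m : ℕ) (h : l + n ≤ m + 1) (x : Eu d) : Measurable[Fil X m] (pp X b l n x) := by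
  unfold pp
  refine Finset.measurable_fun_prod _ fun i hi => ?_
  have := Finset.mem_range.1 hi
  exact (ib_meas _).comp (FH.Fil_nat X (by omega) x)

lemma FH.path (h : FH P k X) (b : ℕ → ℝ) (l n : ℕ) {H : Ω → ℝ≥0∞} (hH : Measurable[Fil X l] H) (x : Eu d) :
    ∀ {f : ℝ → ℝ≥0∞}, Measurable f →
    ∫⁻ ω, H ω * (pp X b l n x ω * f (X (l+n:ℕ) x ω)) ∂P = ∫⁻ ω, H ω * Wk b n f (X l x ω) ∂P := by
  induction n with
  | zero => intro f hf; simp [pp, Wk]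
  | succ n ih =>
    intro f hf
    have hH' : Measurable[Fil X (l+n:ℕ)] (fun ω => H ω * (pp X b l n x ω * ib (b n) (X (l+n:ℕ) x ω))) := by
      refine Measurable.mul (hH.mono (Fil_mono X (by push_cast; linarith [(Nat.cast_nonneg n : (0:ℝ) ≤ n)])) le_rfl) ?_
      exact (pp_meas X b l n _ (by omega) x).mul ((ib_meas _).comp (FH.Fil_nat X le_rfl x))
    have := h.peel (l+n) hH' hf x
    have e : ∫⁻ ω, H ω * (pp X b l (n+1) x ω * f (X (l+(n+1):ℕ) x ω)) ∂P =
        ∫⁻ ω, H ω * (pp X b l n x ω * ib (b n) (X (l+n:ℕ) x ω)) * f (X (l+n+1:ℕ) x ω) ∂P := by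
      refine lintegral_congr fun ω => ?_
      rw [pp_succ, ← add_assoc]; ring
    rw [e, this]
    simp only [Wk]
    rw [← ih (K_meas _ (G_meas hf))]
    refine lintegral_congr fun ω => ?_
    rw [K_eq]; ring

lemma FH.path2 (h : FH P k X) {R : ℝ} (hR : ∀ z, R ≤ ‖z‖ → k z = 0) (b b' : ℕ → ℝ) (l n : ℕ) {x y : Eu d}
    (hz : R ≤ Real.exp l * ‖x - y‖) {H : Ω → ℝ≥0∞} (hH : Measurable[Fil X l] H) :
    ∀ {f g : ℝ → ℝ≥0∞}, Measurable f → Measurable g →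
    ∫⁻ ω, H ω * ((pp X b l n x ω * f (X (l+n:ℕ) x ω)) * (pp X b' l n y ω * g (X (l+n:ℕ) y ω))) ∂P =
      ∫⁻ ω, H ω * (Wk b n f (X l x ω) * Wk b' n g (X l y ω)) ∂P := by
  induction n with
  | zero => intro f g hf hg; simp [pp, Wk]
  | succ n ih =>
    intro f g hf hg
    have hH' : Measurable[Fil X (l+n:ℕ)] (fun ω => H ω * ((pp X b l n x ω * ib (b n) (X (l+n:ℕ) x ω)) *
        (pp X b' l n y ω * ib (b' n) (X (l+n:ℕ) y ω)))) := by
      refine Measurable.mul (hH.mono (Fil_mono X (by push_cast; linarith [(Nat.cast_nonneg n : (0:ℝ) ≤ n)])) le_rfl) ?_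
      refine Measurable.mul ?_ ?_
      · exact (pp_meas X b l n _ (by omega) x).mul ((ib_meas _).comp (FH.Fil_nat X le_rfl x))
      · exact (pp_meas X b' l n _ (by omega) y).mul ((ib_meas _).comp (FH.Fil_nat X le_rfl y))
    have hz' : R ≤ Real.exp (l+n:ℕ) * ‖x - y‖ := by
      refine hz.trans ?_
      gcongr; omega
    have := h.peel2 hR (l+n) hz' hH' hf hg
    have e : ∫⁻ ω, H ω * ((pp X b l (n+1) x ω * f (X (l+(n+1):ℕ) x ω)) * (pp X b' l (n+1) y ω * g (X (l+(n+1):ℕ) y ω))) ∂P =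
        ∫⁻ ω, H ω * ((pp X b l n x ω * ib (b n) (X (l+n:ℕ) x ω)) *
        (pp X b' l n y ω * ib (b' n) (X (l+n:ℕ) y ω))) * (f (X (l+n+1:ℕ) x ω) * g (X (l+n+1:ℕ) y ω)) ∂P := by
      refine lintegral_congr fun ω => ?_
      rw [pp_succ, pp_succ, ← add_assoc]; ring
    rw [e, this]
    simp only [Wk]
    rw [← ih (K_meas _ (G_meas hf)) (K_meas _ (G_meas hg))]
    refine lintegral_congr fun ω => ?_
    rw [K_eq, K_eq]; ring

lemma FH.path0 (h : FH P k X) (b : ℕ → ℝ) (n : ℕ) (x : Eu d) {f : ℝ → ℝ≥0∞} (hf : Measurable f) :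
    ∫⁻ ω, pp X b 0 n x ω * f (X n x ω) ∂P = Wk b n f 0 := by
  have := h.path b 0 n (H := fun _ => 1) measurable_const x hf
  simp only [one_mul, zero_add] at this
  rw [this]
  rw [lintegral_congr_ae (g := fun _ => Wk b n f 0)]
  · simp
  · filter_upwards [h.zero x] with ω hω
    simp [hω]

/-- tilted path estimate -/
lemma FH.cmpath (h : FH P k X) (α lam : ℝ) (b : ℕ → ℝ) (j : ℕ) (x y : Eu d) {f : ℝ → ℝ≥0∞} (hf : Measurable f) :
    ∫⁻ ω, E (α * X j x ω + lam * (X j x ω - X j y ω)) * (pp X b 0 j x ω * f (X j x ω)) ∂P =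
      E (α^2 * j / 2 + (α * lam + lam^2) * (j - Kf k j (x - y))) *
        Wk (fun i => b i - (α * i + lam * (i - Kf k i (x - y)))) j
          (fun e => f (e + (α * j + lam * (j - Kf k j (x - y))))) 0 := by
  let U : Fin (j+1) ⊕ Unit → Ω → ℝ := fun i => X (Sum.elim (fun i : Fin (j+1) => (((i:ℕ)):ℝ)) (fun _ => (j:ℝ)) i) (Sum.elim (fun _ => x) (fun _ => y) i)
  have hG : HasGaussianLaw (fun ω i => U i ω) P := h.gl _ _
  let κ : Fin (j+1) ⊕ Unit → ℝ := Sum.elim (fun i : Fin (j+1) => α * (i:ℕ) + lam * ((i:ℕ) - Kf k (i:ℕ) (x - y))) (fun _ => α * Kf k j (x-y) + lam * (Kf k j (x-y) - j))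
  let c : Fin (j+1) ⊕ Unit → ℝ := Sum.elim (fun i => if i = Fin.last j then α + lam else 0) (fun _ => -lam)
  have hsum : ∀ φ : Fin (j+1) ⊕ Unit → ℝ, ∑ i, c i * φ i = (α + lam) * φ (Sum.inl (Fin.last j)) - lam * φ (Sum.inr ()) := by
    intro φ
    rw [Fintype.sum_sum_type]
    simp [c]; ring
  have hsym : ∀ i : ℕ, Kf k i (y - x) = Kf k i (x - y) := by
    intro i
    rw [← h.cov i (by positivity), ← h.cov i (by positivity)]; congr 1; funext ω; ring
  have hκ : ∀ i, κ i = ∑ m, c m * ∫ ω, U m ω * U i ω ∂P := by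
    intro i
    rw [hsum]
    rcases i with i | i
    · have hi : ((i:ℕ):ℝ) ≤ j := by exact_mod_cast Nat.lt_succ_iff.1 i.2
      simp only [U, κ, Sum.elim_inl, Sum.elim_inr, Fin.val_last]
      simp_rw [mul_comm (X j _ _)]
      rw [h.cov2 (by positivity) hi, h.cov2 (by positivity) hi, sub_self, Kf_zero h (by positivity)]
      ring
    · simp only [U, κ, Sum.elim_inl, Sum.elim_inr, Fin.val_last]
      rw [h.cov _ (by positivity), h.cov _ (by positivity), sub_self, Kf_zero h (by positivity)]
      ring
  have := cm_fin hG (fun i => h.cent _ _) c κ _ hκ rfl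
    (F := fun u => (∏ i : Fin j, ib (b i) (u (Sum.inl i.castSucc))) * f (u (Sum.inl (Fin.last j)))) (by fun_prop)
  simp only [hsum] at this
  have e1 : ∀ ω, pp X b 0 j x ω = ∏ i : Fin j, ib (b i) (X ((i:ℕ):ℝ) x ω) := by
    intro ω; unfold pp; rw [Finset.prod_range]; simp
  have e2 : ∀ ω, α * X j x ω + lam * (X j x ω - X j y ω) = (α + lam) * U (Sum.inl (Fin.last j)) ω - lam * U (Sum.inr ()) ω := by
    intro ω; simp [U]; ring
  simp_rw [e2, e1]
  have e3 : ∀ ω, f (X j x ω) = f (U (Sum.inl (Fin.last j)) ω) := by intro ω; simp [U]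
  have e4 : ∀ ω, (∏ i : Fin j, ib (b i) (X ((i:ℕ):ℝ) x ω)) = ∏ i : Fin j, ib (b i) (U (Sum.inl i.castSucc) ω) := by
    intro ω; simp [U]
  simp_rw [e3, e4]
  rw [this]
  congr 1
  · congr 1; simp only [κ, Sum.elim_inl, Sum.elim_inr, Fin.val_last]; ring
  · rw [← h.path0 _ _ x (by fun_prop)]
    refine lintegral_congr fun ω => ?_
    congr 1
    · unfold pp; rw [Finset.prod_range]
      refine Finset.prod_congr rfl fun i _ => ?_
      refine le_antisymm (ib_mono fun hh => ?_) (ib_mono fun hh => ?_)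
      · simp only [U, κ, Sum.elim_inl, Fin.val_castSucc] at hh
        simp only [zero_add]; linarith
      · simp only [U, κ, Sum.elim_inl, Fin.val_castSucc]
        simp only [zero_add] at hh; linarith

end SC



namespace SC
open scoped ENNReal
set_option linter.unusedSectionVars false

/-- unit cube -/
def Q (d : ℕ) : Set (Eu d) := {x | ∀ i, x i ∈ Set.Icc (0:ℝ) 1}

lemma Q_eq (d : ℕ) : Q d = WithLp.ofLp ⁻¹' (Set.Icc (0 : Fin d → ℝ) 1) := by
  ext x; simp only [Q, Set.mem_setOf_eq, Set.mem_preimage, Set.mem_Icc, Pi.le_def]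
  exact ⟨fun h => ⟨fun i => (h i).1, fun i => (h i).2⟩, fun h i => ⟨h.1 i, h.2 i⟩⟩

lemma Q_closed (d : ℕ) : IsClosed (Q d) := by
  rw [Q_eq]; exact isClosed_Icc.preimage (PiLp.continuous_ofLp 2 _)

lemma Q_meas (d : ℕ) : MeasurableSet (Q d) := (Q_closed d).measurableSet

lemma Q_compact (d : ℕ) : IsCompact (Q d) := by
  rw [Q_eq]
  exact (PiLp.homeomorph 2 (fun _ : Fin d => ℝ)).isCompact_preimage.2 isCompact_Icc

lemma Q_vol (d : ℕ) : volume (Q d) = 1 := by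
  rw [Q_eq, (PiLp.volume_preserving_ofLp (Fin d)).measure_preimage measurableSet_Icc.nullMeasurableSet, Real.volume_Icc_pi]
  simp

/-- Lebesgue measure on the cube -/
def vQ (d : ℕ) : Measure (Eu d) := volume.restrict (Q d)

instance (d : ℕ) : IsProbabilityMeasure (vQ d) := ⟨by simp [vQ, Q_vol]⟩

variable {d : ℕ} {Ω : Type*} [m0 : MeasurableSpace Ω] {P : Measure Ω} [IsProbabilityMeasure P]
  {k : Eu d → ℝ} {X : ℝ → Eu d → Ω → ℝ}

lemma FH.jm (h : FH P k X) {α : Type*} [MeasurableSpace α] (μ : Measure α) [SFinite μ] {g : α → Eu d} (hg : Measurable g) (t : ℝ) :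
    AEMeasurable (fun p : Ω × α => X t (g p.2) p.1) (P.prod μ) := by
  classical
  have h0 : P {ω | ¬ Continuous fun p : ℝ × Eu d => X p.1 p.2 ω} = 0 := h.cont
  obtain ⟨S, hS, hSm, hS0⟩ := exists_measurable_superset_of_null h0
  let X' : Eu d → Ω → ℝ := fun x => Sᶜ.indicator (X t x)
  have h1 : Measurable (Function.uncurry X') := by
    refine measurable_uncurry_of_continuous_of_measurable (fun ω => ?_) (fun x => (h.meas t x).indicator hSm.compl)
    by_cases hω : ω ∈ S
    · simp only [X', Set.indicator, Set.mem_compl_iff, hω, not_true_eq_false, if_false]; exact continuous_const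
    · simp only [X', Set.indicator, Set.mem_compl_iff, hω, not_false_eq_true, if_true]
      have hc : Continuous fun p : ℝ × Eu d => X p.1 p.2 ω := by
        by_contra hh; exact hω (hS hh)
      exact hc.comp (by fun_prop : Continuous fun x : Eu d => (t, x))
  refine ⟨fun p => Function.uncurry X' (g p.2, p.1), h1.comp (by fun_prop), ?_⟩
  have h2 : ∀ᵐ ω ∂P, ω ∉ S := by rw [ae_iff]; simpa using hS0
  have h3 : ∀ᵐ p ∂(P.prod μ), p.1 ∉ S := Measure.quasiMeasurePreserving_fst.ae h2
  filter_upwards [h3] with p hp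
  simp [Function.uncurry, X', Set.indicator, hp]

lemma FH.pp_jm (h : FH P k X) {α : Type*} [MeasurableSpace α] (μ : Measure α) [SFinite μ] {g : α → Eu d} (hg : Measurable g)
    (b : ℕ → ℝ) (l n : ℕ) :
    AEMeasurable (fun p : Ω × α => pp X b l n (g p.2) p.1) (P.prod μ) := by
  unfold pp
  refine Finset.aemeasurable_fun_prod _ fun i _ => ?_
  exact (ib_meas _).comp_aemeasurable (h.jm μ hg _)

/-- representation of Y -/
lemma FH.Yrep (h : FH P k X) {γ : ℝ} {Y : ℝ → Ω → ℝ}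
    (hY : ∀ (t : ℝ) (ω : Ω), Y t ω =
      t ^ (3 * γ / (2 * Real.sqrt (2 * (d:ℝ)))) *
        Real.exp (t * (γ / Real.sqrt 2 - Real.sqrt (d:ℝ)) ^ 2) *
        ∫ x in {x : EuclideanSpace ℝ (Fin d) | ∀ i, x i ∈ Set.Icc (0:ℝ) 1},
          Real.exp (γ * X t x ω - γ ^ 2 / 2 * t)) {t : ℝ} (ht : 0 ≤ t) :
    (∀ ω, 0 ≤ Y t ω) ∧ ∀ᵐ ω ∂P, ENNReal.ofReal (Y t ω) =
      ENNReal.ofReal (t ^ (3 * γ / (2 * Real.sqrt (2 * (d:ℝ))))) *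
        ∫⁻ x, E (γ * (X t x ω - Real.sqrt (2*(d:ℝ)) * t) + d * t) ∂(vQ d) := by
  refine ⟨fun ω => ?_, ?_⟩
  · rw [hY]
    have : 0 ≤ ∫ x in {x : EuclideanSpace ℝ (Fin d) | ∀ i, x i ∈ Set.Icc (0:ℝ) 1},
          Real.exp (γ * X t x ω - γ ^ 2 / 2 * t) := integral_nonneg fun x => (Real.exp_pos _).le
    positivity
  · filter_upwards [h.cont] with ω hω
    have hc : Continuous fun x : Eu d => Real.exp (γ * X t x ω - γ ^ 2 / 2 * t) := by
      have := hω.comp (by fun_prop : Continuous fun x : Eu d => (t, x))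
      simp only [Function.comp_def] at this
      fun_prop
    have hi : Integrable (fun x : Eu d => Real.exp (γ * X t x ω - γ ^ 2 / 2 * t)) (volume.restrict (Q d)) :=
      hc.continuousOn.integrableOn_compact (Q_compact d)
    rw [hY, mul_assoc, ENNReal.ofReal_mul (by positivity), ENNReal.ofReal_mul (by positivity)]
    change _ * (_ * ENNReal.ofReal (∫ x in Q d, _)) = _
    rw [ofReal_integral_eq_lintegral_ofReal hi (Eventually.of_forall fun x => (Real.exp_pos _).le)]
    congr 1
    rw [← lintegral_const_mul' _ _ ENNReal.ofReal_ne_top]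
    refine lintegral_congr fun x => ?_
    unfold E
    rw [← ENNReal.ofReal_mul (Real.exp_pos _).le, ← Real.exp_add]
    congr 2
    have e2 : Real.sqrt (2*(d:ℝ)) = Real.sqrt 2 * Real.sqrt d := Real.sqrt_mul (by norm_num) _
    have e3 : Real.sqrt d ^2 = d := Real.sq_sqrt (by positivity)
    have e4 : Real.sqrt 2 ^2 = 2 := Real.sq_sqrt (by positivity)
    have e5 : γ / Real.sqrt 2 = γ * Real.sqrt 2 / 2 := by
      rw [div_eq_div_iff (by positivity) (by norm_num), mul_assoc, ← sq, e4]
    rw [e2, e5]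
    linear_combination (t * γ^2/4) * e4 + t * e3

lemma FH.lint_aem (h : FH P k X) (γ c c' t : ℝ) : AEMeasurable (fun ω => ∫⁻ x, E (γ * (X t x ω - c) + c') ∂(vQ d)) P := by
  refine AEMeasurable.lintegral_prod_right' (f := fun p : Ω × Eu d => E (γ * (X t p.2 p.1 - c) + c')) ?_
  have := h.jm (vQ d) measurable_id t
  simp only [id] at this
  have hm : Measurable fun z => E (γ * (z - c) + c') := by fun_prop
  exact hm.comp_aemeasurable this

lemma FH.Y_aem (h : FH P k X) {γ : ℝ} {Y : ℝ → Ω → ℝ}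
    (hY : ∀ (t : ℝ) (ω : Ω), Y t ω =
      t ^ (3 * γ / (2 * Real.sqrt (2 * (d:ℝ)))) *
        Real.exp (t * (γ / Real.sqrt 2 - Real.sqrt (d:ℝ)) ^ 2) *
        ∫ x in {x : EuclideanSpace ℝ (Fin d) | ∀ i, x i ∈ Set.Icc (0:ℝ) 1},
          Real.exp (γ * X t x ω - γ ^ 2 / 2 * t)) {t : ℝ} (ht : 0 ≤ t) : AEMeasurable (Y t) P := by
  obtain ⟨h1, h2⟩ := h.Yrep hY ht
  refine AEMeasurable.congr (f := fun ω => (ENNReal.ofReal (t ^ (3 * γ / (2 * Real.sqrt (2 * (d:ℝ))))) *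
        ∫⁻ x, E (γ * (X t x ω - Real.sqrt (2*(d:ℝ)) * t) + d * t) ∂(vQ d)).toReal) ?_ ?_
  · exact ((h.lint_aem _ _ _ _).const_mul _).ennreal_toReal
  · filter_upwards [h2] with ω hω
    rw [← hω, ENNReal.toReal_ofReal (h1 ω)]

end SC



namespace SC
open scoped ENNReal
set_option linter.unusedSectionVars false

lemma lint_tail {a : ℝ} (ha : 0 < a) (c : ℝ) : ∫⁻ e, (Set.Ioi c).indicator (fun e => E (-a * e)) e = ENNReal.ofReal (Real.exp (-a * c) / a) := by
  rw [lintegral_indicator measurableSet_Ioi]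
  unfold E
  rw [← ofReal_integral_eq_lintegral_ofReal (integrableOn_exp_mul_Ioi (by linarith) c) (Eventually.of_forall fun x => (Real.exp_pos _).le),
    integral_exp_mul_Ioi (by linarith)]
  congr 1; field_simp

lemma lint_head {α : ℝ} (ha : 0 < α) (c : ℝ) :
    ∫⁻ e, (ib c e * E (α * e)) * ENNReal.ofReal (1 + max (c - e) 0) ≤ ENNReal.ofReal ((1 + 2/α) * (2/α) * Real.exp (α * c)) := by
  calc _ ≤ ∫⁻ e, ENNReal.ofReal (1 + 2/α) * E (α/2 * c) * (Set.Iic c).indicator (fun e => E (α/2 * e)) e := by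
        refine lintegral_mono fun e => ?_
        simp only
        rcases le_or_gt e c with h1 | h1
        · rw [ib_of_le h1, Set.indicator_of_mem (by exact h1), one_mul]
          unfold E
          rw [← ENNReal.ofReal_mul (Real.exp_pos _).le, ← ENNReal.ofReal_mul (by positivity), ← ENNReal.ofReal_mul (by positivity)]
          apply ENNReal.ofReal_le_ofReal
          rw [max_eq_left (by linarith)]
          have h2 : 1 + (c - e) ≤ (1 + 2/α) * Real.exp (α/2 * (c - e)) := by
            have h3 : α/2 * (c-e) + 1 ≤ Real.exp (α/2 * (c - e)) := Real.add_one_le_exp _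
            have h4 : 0 ≤ c - e := by linarith
            have h5 : (1 + 2/α) * (α/2 * (c-e) + 1) = 1 + (c - e) + α/2 * (c-e) + 2/α := by field_simp; ring
            have : (1 + 2/α) * (α/2 * (c-e) + 1) ≤ (1 + 2/α) * Real.exp (α/2 * (c - e)) :=
              mul_le_mul_of_nonneg_left h3 (by positivity)
            have : 0 ≤ α/2 * (c-e) := by positivity
            have : 0 ≤ 2/α := by positivity
            linarith
          calc Real.exp (α * e) * (1 + (c - e)) ≤ Real.exp (α * e) * ((1 + 2/α) * Real.exp (α/2 * (c - e))) :=
                mul_le_mul_of_nonneg_left h2 (Real.exp_pos _).le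
            _ = (1 + 2/α) * (Real.exp (α * e) * Real.exp (α/2 * (c-e))) := by ring
            _ = (1 + 2/α) * (Real.exp (α/2 * c) * Real.exp (α/2 * e)) := by
                rw [← Real.exp_add, ← Real.exp_add]; congr 2; ring
            _ = _ := by ring
        · rw [ib_of_lt h1]; simp
    _ = ENNReal.ofReal (1 + 2/α) * E (α/2 * c) * ENNReal.ofReal (Real.exp (α/2 * c) / (α/2)) := by
        rw [lintegral_const_mul _ (by exact Measurable.indicator (by fun_prop) measurableSet_Iic), lintegral_indicator measurableSet_Iic]
        congr 1
        unfold E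
        rw [← ofReal_integral_eq_lintegral_ofReal (integrableOn_exp_mul_Iic (by linarith) c) (Eventually.of_forall fun x => (Real.exp_pos _).le),
          integral_exp_mul_Iic (by linarith)]
    _ ≤ _ := by
        unfold E
        rw [← ENNReal.ofReal_mul (by positivity), ← ENNReal.ofReal_mul (by positivity)]
        apply ENNReal.ofReal_le_ofReal
        apply le_of_eq
        rw [show α * c = α/2*c + α/2*c by ring, Real.exp_add]
        field_simp

/-- curved barrier -/
def gb (a β : ℝ) (n i : ℕ) : ℝ := min β (β - 3/(2*a) * Real.log n + 2/a * Real.log (1 + (n - i : ℝ)))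

lemma gb_le (a β : ℝ) (n i : ℕ) : gb a β n i ≤ β := min_le_left _ _

lemma gb_slope {a : ℝ} (ha : 0 < a) (β : ℝ) {n j m : ℕ} (hj : j ≤ n) (hm : m ≤ j) :
    gb a β n (j - m) ≤ gb a β n j + 2/a * Real.log (1 + m) := by
  have hjn : (j:ℝ) ≤ n := by exact_mod_cast hj
  have hlog : 0 ≤ Real.log (1 + m) := Real.log_nonneg (by linarith [(Nat.cast_nonneg m : (0:ℝ) ≤ m)])
  have h0 : 0 ≤ 2/a * Real.log (1 + m) := by positivity
  unfold gb
  rw [min_add]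
  refine min_le_min (by linarith) ?_
  rw [Nat.cast_sub hm, add_assoc, ← mul_add]
  have : Real.log (1 + (n - (j - m) : ℝ)) ≤ Real.log (1 + (n - j : ℝ)) + Real.log (1 + m) := by
    rw [← Real.log_mul (by linarith) (by positivity)]
    apply Real.log_le_log
    · have : (0:ℝ) ≤ m := Nat.cast_nonneg m
      linarith
    · have : (0:ℝ) ≤ m := Nat.cast_nonneg m
      nlinarith
  have h2 : 0 ≤ 2/a := by positivity
  nlinarith

lemma gb_last {a : ℝ} (β : ℝ) (ha : 0 < a) {n : ℕ} (hn : 1 ≤ n) : gb a β n n = β - 3/(2*a) * Real.log n := by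
  unfold gb
  have : 0 ≤ Real.log n := Real.log_nonneg (by exact_mod_cast hn)
  simp only [sub_self, add_zero, Real.log_one, mul_zero]
  rw [min_eq_right]
  have : 0 ≤ 3/(2*a) * Real.log n := by positivity
  linarith

/-- weight bound -/
lemma gb_weight {a : ℝ} (β : ℝ) (ha : 0 < a) {n j : ℕ} (hj1 : 1 ≤ j) (hj : j ≤ n) :
    Real.exp (-a * gb a β n j) / (j:ℝ)^(3/2:ℝ) ≤ Real.exp (-a * β) * (1/(j:ℝ)^(3/2:ℝ) + 3 / (1 + (n - j : ℝ))^2) := by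
  have hjn : (j:ℝ) ≤ n := by exact_mod_cast hj
  have hj0 : (1:ℝ) ≤ j := by exact_mod_cast hj1
  have hjp : 0 < (j:ℝ)^(3/2:ℝ) := by positivity
  set r : ℝ := 1 + (n - j : ℝ) with hr
  have hr1 : 1 ≤ r := by rw [hr]; linarith
  have hn0 : (0:ℝ) < n := by linarith
  have hcase : gb a β n j = β ∨ Real.exp (-a * gb a β n j) = Real.exp (-a*β) * ((n:ℝ)^(3/2:ℝ) / r^2) := by
    unfold gb
    rcases min_choice β (β - 3/(2*a) * Real.log n + 2/a * Real.log (1 + (n - j : ℝ))) with h | h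
    · left; exact h
    · right; rw [h, ← hr]
      have e1 : (n:ℝ)^(3/2:ℝ) = Real.exp (3/2 * Real.log n) := by
        rw [Real.rpow_def_of_pos hn0, mul_comm]
      have e2 : r^2 = Real.exp (2 * Real.log r) := by
        rw [show (2:ℝ) * Real.log r = Real.log r + Real.log r by ring, Real.exp_add, Real.exp_log (by linarith)]; ring
      rw [e1, e2, ← Real.exp_sub, ← Real.exp_add]; congr 1; field_simp; ring
  have hnn : 0 ≤ 3 / r^2 := by positivity
  rcases hcase with h | h
  · rw [h, div_eq_mul_one_div]
    apply mul_le_mul_of_nonneg_left _ (Real.exp_pos _).le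
    linarith
  · rw [h, mul_div_assoc]
    apply mul_le_mul_of_nonneg_left _ (Real.exp_pos _).le
    rcases le_or_gt (n:ℝ) (2*j) with h2 | h2
    · have : (n:ℝ)^(3/2:ℝ) ≤ 3 * (j:ℝ)^(3/2:ℝ) := by
        calc (n:ℝ)^(3/2:ℝ) ≤ (2*j:ℝ)^(3/2:ℝ) := by gcongr
          _ = (2:ℝ)^(3/2:ℝ) * (j:ℝ)^(3/2:ℝ) := Real.mul_rpow (by norm_num) (by positivity)
          _ ≤ _ := by
            gcongr
            rw [show (3/2:ℝ) = 1 + 1/2 by norm_num, Real.rpow_add (by norm_num), Real.rpow_one, ← Real.sqrt_eq_rpow]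
            have : Real.sqrt 2 ≤ 3/2 := by rw [Real.sqrt_le_left (by norm_num)]; norm_num
            linarith
      have h3 : (n:ℝ)^(3/2:ℝ) / r^2 / (j:ℝ)^(3/2:ℝ) ≤ 3 / r^2 := by
        rw [div_div, mul_comm, ← div_div]
        apply div_le_div_of_nonneg_right _ (by positivity)
        rw [div_le_iff₀ hjp]; exact this
      have : 0 ≤ 1/(j:ℝ)^(3/2:ℝ) := by positivity
      linarith
    · have h3 : (n:ℝ)^(3/2:ℝ) ≤ r^2 := by
        have e : (n:ℝ)^(3/2:ℝ) = n * Real.sqrt n := by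
          rw [show (3/2:ℝ) = 1 + 1/2 by norm_num, Real.rpow_add hn0, Real.rpow_one, ← Real.sqrt_eq_rpow]
        have hs := Real.sq_sqrt hn0.le
        have hs0 := Real.sqrt_nonneg (n:ℝ)
        have hrn : 1 + n/2 ≤ r := by rw [hr]; linarith
        have : (1 + n/2:ℝ)^2 ≤ r^2 := by gcongr
        rw [e]
        have h4 : 0 ≤ (n:ℝ) * (Real.sqrt n / 2 - 1)^2 := by positivity
        nlinarith
      have : (n:ℝ)^(3/2:ℝ) / r^2 ≤ 1 := by rw [div_le_one (by positivity)]; exact h3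
      have : (n:ℝ)^(3/2:ℝ) / r^2 / (j:ℝ)^(3/2:ℝ) ≤ 1 / (j:ℝ)^(3/2:ℝ) :=
        div_le_div_of_nonneg_right this hjp.le
      linarith

variable {d : ℕ} {Ω : Type*} [m0 : MeasurableSpace Ω] {P : Measure Ω} [IsProbabilityMeasure P]
  {k : Eu d → ℝ} {X : ℝ → Eu d → Ω → ℝ}

/-- bad event -/
def bad (X : ℝ → Eu d → Ω → ℝ) (a β η : ℝ) (n j l : ℕ) (u v : Eu d) : Set Ω :=
  {ω | (∀ i < j, X i u ω ≤ a * i + gb a β n i + η) ∧ a * j + gb a β n j < X j u ω ∧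
    (d+1) * l * Real.exp (-(l/2:ℝ)) ≤ X j u ω - X j v ω}

lemma FH.bad1 (h : FH P k X) {a : ℝ} (ha : 0 < a) (ha2 : a^2 = 2*d) {η : ℝ} (hη : 0 ≤ η) :
    ∃ C : ℝ, 0 ≤ C ∧ ∀ (β : ℝ) (n j l : ℕ) (u v : Eu d), 0 ≤ β → 1 ≤ j → j ≤ n →
      ‖u - v‖ ≤ Real.sqrt d * Real.exp (1 - (j + l : ℝ)) →
      P (bad X a β η n j l u v) ≤ ENNReal.ofReal (C * (1 + β) *
        (Real.exp (-a * gb a β n j) / (j:ℝ)^(3/2:ℝ)) * Real.exp (-(d+1)*l - d*j)) := by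
  obtain ⟨L, hL, hLk⟩ := h.lip
  obtain ⟨C0, hC0, ht⟩ := thirds (H := 2/a) (by positivity)
  set C1 : ℝ := L * Real.sqrt d * Real.exp 1 with hC1
  have hC1n : 0 ≤ C1 := by positivity
  refine ⟨Real.exp C1 * (C0 * (1 + η)) * ((1 + (η + C1)) * (Real.exp (a * C1) / a)), by positivity, ?_⟩
  intro β n j l u v hβ hj1 hj huv
  set lam : ℝ := Real.exp (l/2) with hlam
  have hlam1 : 1 ≤ lam := by rw [hlam]; apply Real.one_le_exp; positivity
  set κ : ℕ → ℝ := fun i => i - Kf k i (u - v) with hκ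
  have hκ0 : ∀ i, 0 ≤ κ i := fun i => by rw [hκ]; simp only [sub_nonneg]; exact kap_nonneg h (by positivity) _
  have hκj : lam^2 * κ j ≤ C1 := by
    have h1 : κ j ≤ L * ‖u - v‖ * Real.exp j := kap_le h hL hLk (by positivity) _
    have h2 : L * ‖u - v‖ * Real.exp j ≤ L * (Real.sqrt d * Real.exp (1 - (j + l : ℝ))) * Real.exp j := by gcongr
    calc lam^2 * κ j ≤ lam^2 * (L * (Real.sqrt d * Real.exp (1 - (j + l : ℝ))) * Real.exp j) := by
          apply mul_le_mul_of_nonneg_left (h1.trans h2) (by positivity)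
      _ = L * Real.sqrt d * (Real.exp (l/2) * Real.exp (l/2) * Real.exp (1 - (j + l : ℝ)) * Real.exp j) := by rw [hlam]; ring
      _ = C1 := by
          rw [← Real.exp_add, ← Real.exp_add, ← Real.exp_add, hC1]; congr 2; ring
  have hlκ : lam * κ j ≤ C1 := by
    refine le_trans ?_ hκj
    have := hκ0 j
    have : lam ≤ lam^2 := by nlinarith
    exact mul_le_mul_of_nonneg_right this (hκ0 j)
  set f : ℝ → ℝ≥0∞ := (Set.Ioi (a * j + gb a β n j)).indicator (fun z => E (-a * z - (d+1) * l)) with hf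
  have hfm : Measurable f := Measurable.indicator (by fun_prop) measurableSet_Ioi
  have hs1 : P (bad X a β η n j l u v) ≤ ∫⁻ ω, E (a * X j u ω + lam * (X j u ω - X j v ω)) *
      (pp X (fun i => a * i + gb a β n i + η) 0 j u ω * f (X j u ω)) ∂P := by
    have hbm : MeasurableSet (bad X a β η n j l u v) := by
      have hm1 := fun i : ℕ => h.meas i u
      have hm2 := h.meas j v
      have e : bad X a β η n j l u v = (⋂ i : ℕ, ⋂ _ : i < j, {ω | X i u ω ≤ a * i + gb a β n i + η}) ∩
          ({ω | a * j + gb a β n j < X j u ω} ∩ {ω | (d+1) * l * Real.exp (-(l/2:ℝ)) ≤ X j u ω - X j v ω}) := by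
        ext ω; simp [bad]
      rw [e]
      refine MeasurableSet.inter (MeasurableSet.iInter fun i => MeasurableSet.iInter fun _ => measurableSet_le (hm1 i) measurable_const) ?_
      exact (measurableSet_lt measurable_const (hm1 j)).inter (measurableSet_le measurable_const ((hm1 j).sub hm2))
    rw [← lintegral_indicator_one hbm]
    refine lintegral_mono fun ω => ?_
    by_cases hω : ω ∈ bad X a β η n j l u v
    · rw [Set.indicator_of_mem hω, pp_one (by simpa using hω.1), one_mul, hf, Set.indicator_of_mem (by exact hω.2.1), ← E_add, Pi.one_apply, ← E_zero]
      apply E_mono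
      have h3 : (d+1:ℝ) * l ≤ lam * (X j u ω - X j v ω) := by
        have := mul_le_mul_of_nonneg_left hω.2.2 (by positivity : 0 ≤ lam)
        refine le_trans (le_of_eq ?_) this
        rw [hlam, show Real.exp (l/2:ℝ) * ((d+1:ℝ) * l * Real.exp (-(l/2:ℝ))) = (d+1:ℝ)*l*(Real.exp (l/2:ℝ) * Real.exp (-(l/2:ℝ))) by ring,
          ← Real.exp_add]; simp
      linarith
    · rw [Set.indicator_of_notMem hω]; exact zero_le
  rw [h.cmpath a lam _ j u v hfm] at hs1
  refine hs1.trans ?_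
  set hh : ℝ → ℝ≥0∞ := (Set.Ioi (gb a β n j - C1)).indicator (fun e => E (-a * e)) with hhh
  have hhm : Measurable hh := Measurable.indicator (by fun_prop) measurableSet_Ioi
  set cc : ℝ := -(a^2*j) - a * (lam * κ j) - (d+1) * l with hcc
  have hs2 : Wk (fun i => a * i + gb a β n i + η - (a * i + lam * (i - Kf k i (u - v)))) j
          (fun e => f (e + (a * j + lam * (j - Kf k j (u - v))))) 0 ≤ E cc * Wk (fun i => gb a β n i + η) j hh 0 := by
    have e := congrFun (Wk_const_mul (fun i => gb a β n i + η) j hhm (E cc)) 0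
    rw [← e]
    refine Wk_mono (fun i _ => ?_) (fun z => ?_) 0
    · have : 0 ≤ lam * κ i := mul_nonneg (by positivity) (hκ0 i)
      simp only [hκ] at this; linarith
    · simp only [hf, hhh]
      by_cases hz : a * j + gb a β n j < z + (a * j + lam * κ j)
      · rw [Set.indicator_of_mem (by exact hz), Set.indicator_of_mem (by simp only [Set.mem_Ioi]; linarith), ← E_add]
        apply E_mono; rw [hcc]; simp only [hκ]; linarith
      · rw [Set.indicator_of_notMem (by exact hz)]; exact zero_le
  have hs3 : Wk (fun i => gb a β n i + η) j hh 0 ≤ ENNReal.ofReal (C0 * (1 + (β + η)) / (j:ℝ)^(3/2:ℝ)) *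
      ∫⁻ e, hh e * ENNReal.ofReal (1 + max (gb a β n j + η - e) 0) := by
    have ht' := ht (fun i => gb a β n i + η) (β + η) (gb a β n j + η) 0 j hh hhm hj1 (by linarith)
    rw [sub_zero] at ht'
    apply ht'
    · intro i _; have := gb_le a β n i; linarith
    · intro m _ hm; have := gb_slope ha β hj hm; linarith
  have hs4 : ∫⁻ e, hh e * ENNReal.ofReal (1 + max (gb a β n j + η - e) 0) ≤
      ENNReal.ofReal (1 + (η + C1)) * ENNReal.ofReal (Real.exp (-a * (gb a β n j - C1)) / a) := by
    rw [← lint_tail ha, ← lintegral_const_mul _ hhm]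
    refine lintegral_mono fun e => ?_
    by_cases he : gb a β n j - C1 < e
    · rw [mul_comm]; refine mul_le_mul_left ?_ _
      apply ENNReal.ofReal_le_ofReal
      have : max (gb a β n j + η - e) 0 ≤ η + C1 := max_le (by linarith) (by linarith)
      linarith
    · simp [hhh, Set.indicator_of_notMem (s := Set.Ioi (gb a β n j - C1)) (by exact he)]
  calc _ ≤ E (a ^ 2 * ↑j / 2 + (a * lam + lam ^ 2) * (↑j - Kf k (↑j) (u - v))) * (E cc *
        (ENNReal.ofReal (C0 * (1 + (β + η)) / (j:ℝ)^(3/2:ℝ)) *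
          (ENNReal.ofReal (1 + (η + C1)) * ENNReal.ofReal (Real.exp (-a * (gb a β n j - C1)) / a)))) := by
        refine mul_le_mul_right (hs2.trans (mul_le_mul_right (hs3.trans (mul_le_mul_right hs4 _)) _)) _
    _ ≤ _ := by
        rw [← mul_assoc, ← E_add]
        unfold E
        rw [← ENNReal.ofReal_mul (by positivity), ← ENNReal.ofReal_mul (by positivity), ← ENNReal.ofReal_mul (by positivity)]
        apply ENNReal.ofReal_le_ofReal
        have e1 : Real.exp (a ^ 2 * ↑j / 2 + (a * lam + lam ^ 2) * (↑j - Kf k (↑j) (u - v)) + cc) ≤ Real.exp C1 * Real.exp (-(d+1)*l - d*j) := by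
          rw [← Real.exp_add]; apply Real.exp_le_exp.2
          have : (a * lam + lam ^ 2) * (↑j - Kf k (↑j) (u - v)) = a * (lam * κ j) + lam^2 * κ j := by simp only [hκ]; ring
          rw [this, hcc, ha2]; linarith
        have e2 : C0 * (1 + (β + η)) ≤ C0 * (1 + η) * (1 + β) := by
          have : C0 * (1 + η) * (1 + β) = C0 * (1 + (β + η)) + C0 * (η * β) := by ring
          have : 0 ≤ C0 * (η * β) := by positivity
          linarith
        have e3 : Real.exp (-a * (gb a β n j - C1)) = Real.exp (a * C1) * Real.exp (-a * gb a β n j) := by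
          rw [← Real.exp_add]; congr 1; ring
        rw [e3]
        calc _ ≤ (Real.exp C1 * Real.exp (-(d+1)*l - d*j)) * ((C0 * (1 + η) * (1 + β)) / (j:ℝ)^(3/2:ℝ) *
              ((1 + (η + C1)) * (Real.exp (a * C1) * Real.exp (-a * gb a β n j) / a))) := by gcongr
          _ = _ := by field_simp

end SC



namespace SC
open scoped ENNReal
set_option linter.unusedSectionVars false

variable {d : ℕ} {Ω : Type*} [m0 : MeasurableSpace Ω] {P : Measure Ω} [IsProbabilityMeasure P]
  {k : Eu d → ℝ} {X : ℝ → Eu d → Ω → ℝ}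

/-- side of the lattice -/
def sz (m : ℕ) : ℕ := ⌊Real.exp m⌋₊ + 1

/-- lattice point -/
def pt (m : ℕ) (v : Fin d → Fin (sz m)) : Eu d := WithLp.toLp 2 (fun i => Real.exp (-m) * (v i : ℕ))

/-- index of rounding -/
def rd (m : ℕ) (x : Eu d) : Fin d → Fin (sz m) := fun i =>
  ⟨min ⌊Real.exp m * x i⌋₊ ⌊Real.exp m⌋₊, by unfold sz; omega⟩

lemma pt_mem (m : ℕ) (v : Fin d → Fin (sz m)) : pt m v ∈ Q d := by
  intro i
  simp only [pt]
  refine ⟨by positivity, ?_⟩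
  have h1 : ((v i : ℕ) : ℝ) ≤ Real.exp m := by
    have h2 : (v i : ℕ) ≤ ⌊Real.exp m⌋₊ := by have := (v i).2; unfold sz at this; omega
    exact (Nat.cast_le.2 h2).trans (Nat.floor_le (Real.exp_pos _).le)
  calc Real.exp (-m) * (v i : ℕ) ≤ Real.exp (-m) * Real.exp m := by gcongr
    _ = 1 := by rw [← Real.exp_add]; simp

lemma rd_dist (m : ℕ) {x : Eu d} (hx : x ∈ Q d) : ‖x - pt m (rd m x)‖ ≤ Real.sqrt d * Real.exp (-m) := by
  have hc : ∀ i, |x i - (pt m (rd m x)) i| ≤ Real.exp (-m) := by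
    intro i
    have hi := hx i
    have h1 : ⌊Real.exp m * x i⌋₊ ≤ ⌊Real.exp m⌋₊ := by
      apply Nat.floor_le_floor
      have := Real.exp_pos m
      nlinarith [hi.2]
    have h2 : (pt m (rd m x)) i = Real.exp (-m) * (⌊Real.exp m * x i⌋₊ : ℝ) := by
      simp only [pt, rd]; rw [min_eq_left h1]
    have h0 : 0 ≤ Real.exp m * x i := mul_nonneg (Real.exp_pos _).le hi.1
    have h3 := Nat.floor_le h0
    have h4 := (Nat.lt_floor_add_one (Real.exp m * x i)).le
    have h5 : x i = Real.exp (-m) * (Real.exp m * x i) := by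
      rw [← mul_assoc, ← Real.exp_add]; simp
    rw [h2]; nth_rewrite 1 [h5]
    rw [← mul_sub, abs_of_nonneg (mul_nonneg (Real.exp_pos _).le (by linarith))]
    have : Real.exp (-m:ℝ) * (Real.exp m * x i - (⌊Real.exp m * x i⌋₊ : ℝ)) ≤ Real.exp (-m:ℝ) * 1 :=
      mul_le_mul_of_nonneg_left (by linarith) (Real.exp_pos _).le
    linarith
  rw [EuclideanSpace.norm_eq]
  calc Real.sqrt (∑ i, ‖(x - pt m (rd m x)) i‖^2) ≤ Real.sqrt (∑ i : Fin d, (Real.exp (-m))^2) := by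
        apply Real.sqrt_le_sqrt
        refine Finset.sum_le_sum fun i _ => ?_
        rw [Real.norm_eq_abs]
        have := hc i
        gcongr
        simpa using this
    _ = _ := by
        simp only [Finset.sum_const, Finset.card_univ, Fintype.card_fin, nsmul_eq_mul]
        rw [Real.sqrt_mul (by positivity), Real.sqrt_sq (Real.exp_pos _).le]

lemma rd_tendsto {x : Eu d} (hx : x ∈ Q d) : Tendsto (fun m => pt m (rd m x)) atTop (nhds x) := by
  rw [tendsto_iff_norm_sub_tendsto_zero]
  have h1 : Tendsto (fun m : ℕ => Real.sqrt d * Real.exp (-(m:ℝ))) atTop (nhds (Real.sqrt d * 0)) := by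
    apply Tendsto.const_mul
    exact Real.tendsto_exp_neg_atTop_nhds_zero.comp tendsto_natCast_atTop_atTop
  rw [mul_zero] at h1
  refine squeeze_zero (fun m => norm_nonneg _) (fun m => ?_) h1
  rw [norm_sub_rev]; exact rd_dist m hx

/-- parent in the chaining -/
def par (j l : ℕ) (u : Eu d) : Eu d := if l = 0 then u else pt (j+l-1) (rd (j+l-1) u)

lemma par_dist (j l : ℕ) {u : Eu d} (hu : u ∈ Q d) : ‖u - par j l u‖ ≤ Real.sqrt d * Real.exp (1 - (j + l : ℝ)) := by
  unfold par
  split_ifs with h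
  · simp; positivity
  · have := rd_dist (j+l-1) hu
    rw [Nat.cast_sub (by omega)] at this
    push_cast at this
    rwa [show -((j:ℝ)+l-1) = 1 - (j+l) by ring] at this

/-- union of all bad events -/
def bigbad (X : ℝ → Eu d → Ω → ℝ) (a β η : ℝ) (n : ℕ) : Set Ω :=
  ⋃ i : Fin n, ⋃ l : ℕ, ⋃ v : Fin d → Fin (sz (i+1+l)), bad X a β η n (i+1) l (pt (i+1+l) v) (par (i+1) l (pt (i+1+l) v))

lemma eta_sum (d : ℕ) : Summable (fun l : ℕ => (d+1:ℝ) * l * Real.exp (-(l/2:ℝ))) := by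
  have := Real.summable_pow_mul_exp_neg_nat_mul 1 (r := 1/2) (by norm_num)
  have := this.mul_left (d+1:ℝ)
  refine this.congr fun l => ?_
  rw [pow_one, mul_assoc]; congr 3; ring

/-- total slack -/
def etaT (d : ℕ) : ℝ := ∑' l : ℕ, (d+1:ℝ) * l * Real.exp (-(l/2:ℝ))

lemma etaT_nonneg (d : ℕ) : 0 ≤ etaT d := tsum_nonneg fun l => by positivity

lemma gb_zero {a β : ℝ} (ha : 0 < a) (hβ : 0 ≤ β) {n : ℕ} (hn : 1 ≤ n) : 0 ≤ gb a β n 0 := by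
  unfold gb
  refine le_min hβ ?_
  have hn' : (1:ℝ) ≤ n := by exact_mod_cast hn
  have h0 : 0 ≤ Real.log n := Real.log_nonneg hn'
  have h1 : Real.log n ≤ Real.log (1 + (n - (0:ℕ) : ℝ)) := Real.log_le_log (by linarith) (by simp)
  have h2 : 3/(2*a) * Real.log n ≤ 2/a * Real.log (1 + (n - (0:ℕ) : ℝ)) := by
    calc 3/(2*a) * Real.log n ≤ 2/a * Real.log n := by
          apply mul_le_mul_of_nonneg_right _ h0
          rw [div_le_div_iff₀ (by positivity) ha]; nlinarith
      _ ≤ _ := mul_le_mul_of_nonneg_left h1 (by positivity)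
  linarith

lemma det_claim {a β : ℝ} (ha : 0 < a) (hβ : 0 ≤ β) {n : ℕ} (hn : 1 ≤ n) {ω : Ω}
    (hz : ∀ m (v : Fin d → Fin (sz m)), X 0 (pt m v) ω = 0)
    (hb : ω ∉ bigbad X a β (etaT d) n) :
    ∀ j ≤ n, ∀ l, ∀ v : Fin d → Fin (sz (j+l)), X j (pt (j+l) v) ω ≤ a * j + gb a β n j +
      ∑ i ∈ Finset.range (l+1), (d+1:ℝ) * i * Real.exp (-(i/2:ℝ)) := by
  have hpart : ∀ l, ∑ i ∈ Finset.range (l+1), (d+1:ℝ) * i * Real.exp (-(i/2:ℝ)) ≤ etaT d := fun l =>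
    (eta_sum d).sum_le_tsum _ fun i _ => by positivity
  intro j
  induction j using Nat.strong_induction_on with
  | _ j ihj =>
  intro hj l
  rcases Nat.eq_zero_or_pos j with rfl | hjp
  · intro v
    have h1 := gb_zero ha hβ hn
    have h2 : 0 ≤ ∑ i ∈ Finset.range (l+1), (d+1:ℝ) * i * Real.exp (-(i/2:ℝ)) := Finset.sum_nonneg fun i _ => by positivity
    have h3 := hz (0+l) v
    simp only [Nat.cast_zero, mul_zero, zero_add] at h3 ⊢
    rw [h3]; linarith
  obtain ⟨i0, rfl⟩ : ∃ i0, j = i0 + 1 := ⟨j-1, by omega⟩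
  have hnot : ∀ l (v : Fin d → Fin (sz (i0+1+l))), ω ∉ bad X a β (etaT d) n (i0+1) l (pt (i0+1+l) v) (par (i0+1) l (pt (i0+1+l) v)) := by
    intro l v hbad
    exact hb (Set.mem_iUnion.2 ⟨⟨i0, by omega⟩, Set.mem_iUnion.2 ⟨l, Set.mem_iUnion.2 ⟨v, hbad⟩⟩⟩)
  have hprev : ∀ l (v : Fin d → Fin (sz (i0+1+l))), ∀ i < i0+1, X i (pt (i0+1+l) v) ω ≤ a * i + gb a β n i + etaT d := by
    intro l v i hi
    obtain ⟨m, hm⟩ : ∃ m, i0+1+l = i + m := ⟨i0+1+l-i, by omega⟩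
    have key : ∀ M (hM : M = i + m) (v : Fin d → Fin (sz M)), X i (pt M v) ω ≤ a * i + gb a β n i + etaT d := by
      intro M hM v; subst hM
      exact (ihj i hi (by omega) m v).trans (by linarith [hpart m])
    exact key _ hm v
  induction l with
  | zero =>
    intro v
    by_contra hcon
    push Not at hcon
    simp only [zero_add, Finset.sum_range_one, Nat.cast_zero, mul_zero, zero_mul, add_zero] at hcon
    refine hnot 0 v ⟨hprev 0 v, hcon, ?_⟩
    simp [par]
  | succ l ihl =>
    intro v
    by_contra hcon
    push Not at hcon
    rw [Finset.sum_range_succ] at hcon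
    have h2 : 0 ≤ ∑ i ∈ Finset.range (l+1), (d+1:ℝ) * i * Real.exp (-(i/2:ℝ)) := Finset.sum_nonneg fun i _ => by positivity
    have h3 : 0 ≤ (d+1:ℝ) * (l+1:ℕ) * Real.exp (-((l+1:ℕ)/2:ℝ)) := by positivity
    refine hnot (l+1) v ⟨hprev (l+1) v, by linarith, ?_⟩
    have h4 := ihl (rd (i0+1+l) (pt (i0+1+(l+1)) v))
    have h5 : par (i0+1) (l+1) (pt (i0+1+(l+1)) v) = pt (i0+1+l) (rd (i0+1+l) (pt (i0+1+(l+1)) v)) := by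
      unfold par; rw [if_neg (by omega)]; rfl
    rw [h5]; linarith

lemma FH.good (h : FH P k X) {a : ℝ} (ha : 0 < a) :
    ∀ᵐ ω ∂P, ∀ β, 0 ≤ β → ∀ n, 1 ≤ n → ω ∉ bigbad X a β (etaT d) n → ∀ x ∈ Q d, ∀ j ≤ n,
      X j x ω ≤ a * j + gb a β n j + etaT d := by
  have hz : ∀ᵐ ω ∂P, ∀ m (v : Fin d → Fin (sz m)), X 0 (pt m v) ω = 0 := by
    rw [ae_all_iff]; intro m; rw [ae_all_iff]; intro v; exact h.zero _
  filter_upwards [hz, h.cont] with ω h1 h2 β hβ n hn hb x hx j hj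
  have hc : Continuous fun x : Eu d => X j x ω := h2.comp (by fun_prop : Continuous fun x : Eu d => ((j:ℝ), x))
  have ht : Tendsto (fun m => X j (pt m (rd m x)) ω) atTop (nhds (X j x ω)) := (hc.tendsto x).comp (rd_tendsto hx)
  refine le_of_tendsto ht ?_
  filter_upwards [eventually_ge_atTop j] with m hm
  obtain ⟨l, rfl⟩ : ∃ l, m = j + l := ⟨m - j, by omega⟩
  refine (det_claim ha hβ hn h1 hb j hj l _).trans ?_
  have := (eta_sum d).sum_le_tsum (Finset.range (l+1)) fun i _ => by positivity
  unfold etaT; linarith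

lemma sum_w : ∃ C : ℝ, 0 ≤ C ∧ ∀ n : ℕ, ∑ i ∈ Finset.range n, (1/((i+1:ℕ):ℝ)^(3/2:ℝ) + 3 / (1 + (n - (i+1:ℕ) : ℝ))^2) ≤ C := by
  have s1 : Summable (fun i : ℕ => 1/((i+1:ℕ):ℝ)^(3/2:ℝ)) := by
    have := (Real.summable_one_div_nat_rpow (p := 3/2)).2 (by norm_num)
    exact (summable_nat_add_iff 1).2 this
  have s2 : Summable (fun i : ℕ => 3/((i+1:ℕ):ℝ)^2) := by
    have := (Real.summable_one_div_nat_pow (p := 2)).2 (by norm_num)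
    have := ((summable_nat_add_iff 1).2 this).mul_left 3
    exact this.congr fun i => by ring
  refine ⟨(∑' i : ℕ, 1/((i+1:ℕ):ℝ)^(3/2:ℝ)) + ∑' i : ℕ, 3/((i+1:ℕ):ℝ)^2, ?_, fun n => ?_⟩
  · exact add_nonneg (tsum_nonneg fun _ => by positivity) (tsum_nonneg fun _ => by positivity)
  · rw [Finset.sum_add_distrib]
    refine add_le_add (s1.sum_le_tsum _ fun i _ => by positivity) ?_
    rw [← Finset.sum_range_reflect]
    refine le_trans (le_of_eq ?_) (s2.sum_le_tsum (Finset.range n) fun i _ => by positivity)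
    refine Finset.sum_congr rfl fun i hi => ?_
    have := Finset.mem_range.1 hi
    congr 2
    rw [show n - 1 - i + 1 = n - i by omega, Nat.cast_sub (by omega)]; push_cast; ring

lemma FH.bigbad_le (h : FH P k X) {a : ℝ} (ha : 0 < a) (ha2 : a^2 = 2*d) :
    ∃ C : ℝ, 0 ≤ C ∧ ∀ (β : ℝ) (n : ℕ), 0 ≤ β → P (bigbad X a β (etaT d) n) ≤ ENNReal.ofReal (C * ((1 + β) * Real.exp (-a * β))) := by
  obtain ⟨C0, hC0, h0⟩ := h.bad1 ha ha2 (etaT_nonneg d)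
  obtain ⟨C1, hC1, h1⟩ := sum_w
  have hse : Summable (fun l : ℕ => Real.exp (-(l:ℝ))) := Real.summable_exp_neg_nat
  set S := ∑' l : ℕ, Real.exp (-(l:ℝ)) with hS
  have hS0 : 0 ≤ S := tsum_nonneg fun _ => (Real.exp_pos _).le
  refine ⟨2^d * C0 * S * C1, by positivity, fun β n hβ => ?_⟩
  -- one (i,l)
  have hil : ∀ (i : Fin n) (l : ℕ), P (⋃ v : Fin d → Fin (sz (i+1+l)), bad X a β (etaT d) n (i+1) l (pt (i+1+l) v) (par (i+1) l (pt (i+1+l) v)))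
      ≤ ENNReal.ofReal (2^d * C0 * (1+β) * (Real.exp (-a * gb a β n (i+1)) / ((i+1:ℕ):ℝ)^(3/2:ℝ)) * Real.exp (-(l:ℝ))) := by
    intro i l
    refine (measure_iUnion_fintype_le _ _).trans ?_
    have hsz : ((sz (i+1+l) : ℕ) : ℝ) ≤ 2 * Real.exp (i+1+l:ℕ) := by
      unfold sz; push_cast
      have := Nat.floor_le (Real.exp_pos ((i:ℝ)+1+l)).le
      have h2 : 1 ≤ Real.exp ((i:ℝ)+1+l) := Real.one_le_exp (by positivity)
      linarith
    calc _ ≤ ∑ v : Fin d → Fin (sz (i+1+l)), ENNReal.ofReal (C0 * (1 + β) *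
        (Real.exp (-a * gb a β n (i+1)) / ((i+1:ℕ):ℝ)^(3/2:ℝ)) * Real.exp (-(d+1)*l - d*(i+1:ℕ))) := by
          refine Finset.sum_le_sum fun v _ => ?_
          apply h0 β n (i+1) l _ _ hβ (by omega) (by have := i.2; omega)
          exact par_dist _ _ (pt_mem _ _)
      _ = ENNReal.ofReal (((sz (i+1+l) : ℕ) : ℝ)^d) * ENNReal.ofReal (C0 * (1 + β) *
        (Real.exp (-a * gb a β n (i+1)) / ((i+1:ℕ):ℝ)^(3/2:ℝ)) * Real.exp (-(d+1)*l - d*(i+1:ℕ))) := by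
          simp only [Finset.sum_const, Finset.card_univ, Fintype.card_fun, Fintype.card_fin, nsmul_eq_mul]
          congr 1
          rw [← Nat.cast_pow, ENNReal.ofReal_natCast]
      _ ≤ _ := by
          rw [← ENNReal.ofReal_mul (by positivity)]
          apply ENNReal.ofReal_le_ofReal
          have e1 : ((sz (i+1+l) : ℕ) : ℝ)^d ≤ 2^d * Real.exp (d * ((i+1:ℕ) + l)) := by
            calc _ ≤ (2 * Real.exp (i+1+l:ℕ))^d := by gcongr
              _ = _ := by rw [mul_pow, ← Real.exp_nat_mul]; push_cast; rfl
          have e2 : Real.exp (d * ((i+1:ℕ) + l)) * Real.exp (-(d+1)*l - d*(i+1:ℕ)) = Real.exp (-(l:ℝ)) := by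
            rw [← Real.exp_add]; congr 1; push_cast; ring
          calc _ ≤ 2^d * Real.exp (d * ((i+1:ℕ) + l)) * (C0 * (1 + β) *
                (Real.exp (-a * gb a β n (i+1)) / ((i+1:ℕ):ℝ)^(3/2:ℝ)) * Real.exp (-(d+1)*l - d*(i+1:ℕ))) := by
                apply mul_le_mul_of_nonneg_right e1 (by positivity)
            _ = 2^d * C0 * (1+β) * (Real.exp (-a * gb a β n (i+1)) / ((i+1:ℕ):ℝ)^(3/2:ℝ)) *
                (Real.exp (d * ((i+1:ℕ) + l)) * Real.exp (-(d+1)*l - d*(i+1:ℕ))) := by ring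
            _ = _ := by rw [e2]
  have hi : ∀ i : Fin n, P (⋃ l : ℕ, ⋃ v : Fin d → Fin (sz (i+1+l)), bad X a β (etaT d) n (i+1) l (pt (i+1+l) v) (par (i+1) l (pt (i+1+l) v)))
      ≤ ENNReal.ofReal (2^d * C0 * (1+β) * (Real.exp (-a * gb a β n (i+1)) / ((i+1:ℕ):ℝ)^(3/2:ℝ)) * S) := by
    intro i
    refine (measure_iUnion_le _).trans ?_
    refine (ENNReal.tsum_le_tsum (hil i)).trans ?_
    rw [← ENNReal.ofReal_tsum_of_nonneg (fun l => by positivity) (hse.mul_left _), tsum_mul_left]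
  unfold bigbad
  refine (measure_iUnion_fintype_le _ _).trans ?_
  refine (Finset.sum_le_sum fun i _ => hi i).trans ?_
  rw [← ENNReal.ofReal_sum_of_nonneg (fun i _ => by positivity)]
  apply ENNReal.ofReal_le_ofReal
  calc _ ≤ ∑ i : Fin n, 2^d * C0 * (1+β) * S * Real.exp (-a*β) * (1/((i+1:ℕ):ℝ)^(3/2:ℝ) + 3 / (1 + (n - (i+1:ℕ) : ℝ))^2) := by
        refine Finset.sum_le_sum fun i _ => ?_
        have := gb_weight β ha (n := n) (j := i+1) (by omega) (by have := i.2; omega)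
        calc _ = 2^d * C0 * (1+β) * S * (Real.exp (-a * gb a β n (i+1)) / ((i+1:ℕ):ℝ)^(3/2:ℝ)) := by ring
          _ ≤ 2^d * C0 * (1+β) * S * (Real.exp (-a * β) * (1/((i+1:ℕ):ℝ)^(3/2:ℝ) + 3 / (1 + (n - (i+1:ℕ) : ℝ))^2)) :=
              mul_le_mul_of_nonneg_left this (by positivity)
          _ = _ := by ring
    _ = 2^d * C0 * (1+β) * S * Real.exp (-a*β) * ∑ i ∈ Finset.range n, (1/((i+1:ℕ):ℝ)^(3/2:ℝ) + 3 / (1 + (n - (i+1:ℕ) : ℝ))^2) := by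
        rw [← Finset.mul_sum, Finset.sum_range]
    _ ≤ 2^d * C0 * (1+β) * S * Real.exp (-a*β) * C1 := mul_le_mul_of_nonneg_left (h1 n) (by positivity)
    _ = _ := by ring

end SC



namespace SC
open scoped ENNReal
set_option linter.unusedSectionVars false

variable {d : ℕ} {Ω : Type*} [m0 : MeasurableSpace Ω] {P : Measure Ω} [IsProbabilityMeasure P]
  {k : Eu d → ℝ} {X : ℝ → Eu d → Ω → ℝ}

lemma FH.mean_x (h : FH P k X) {a γ : ℝ} (ha : 0 < a) (ha2 : a^2 = 2*d) (hg : a < γ) {η : ℝ} (hη : 0 ≤ η) {β : ℝ} (hβ : 0 ≤ β) :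
    ∃ C : ℝ, 0 ≤ C ∧ ∀ (n : ℕ) (t : ℝ) (x : Eu d), 1 ≤ n → (n:ℝ) ≤ t → t ≤ n + 1 →
      ∫⁻ ω, pp X (fun i => a * i + gb a β n i + η) 0 (n+1) x ω * E (γ * (X t x ω - a * t) + d * t) ∂P
        ≤ ENNReal.ofReal (C * (n:ℝ)^(-(3*γ/(2*a)))) := by
  obtain ⟨C0, hC0, ht⟩ := thirds (H := 2/a) (by positivity)
  have hδ : 0 < γ - a := by linarith
  set δ := γ - a with hδd
  refine ⟨Real.exp (δ^2/2) * ((C0 * (1 + (β + η))) * ((1 + 2/δ) * (2/δ) * Real.exp (δ * (β + η)))), by positivity, ?_⟩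
  intro n t x hn hnt htn
  have hn0 : (0:ℝ) < n := by exact_mod_cast hn
  set b : ℕ → ℝ := fun i => a * i + gb a β n i + η with hb
  set H : Ω → ℝ≥0∞ := fun ω => pp X b 0 (n+1) x ω * E (γ * (X n x ω - a * n) + d * n) with hH
  have hHm : Measurable[Fil X n] H := by
    refine Measurable.mul (pp_meas X b 0 (n+1) n (by omega) x) ?_
    have h1 : Measurable fun z => E (γ * (z - a * n) + d * n) := by fun_prop
    exact h1.comp (FH.Fil_nat X le_rfl x)
  have e1 : ∀ ω, pp X b 0 (n+1) x ω * E (γ * (X t x ω - a * t) + d * t)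
      = E ((d - γ * a) * (t - n)) * (H ω * E (γ * (X t x ω - X n x ω))) := by
    intro ω
    have : γ * (X t x ω - a * t) + d * t = (d - γ * a) * (t - n) + ((γ * (X n x ω - a * n) + d * n) + (γ * (X t x ω - X n x ω))) := by ring
    rw [this, E_add, E_add, hH]; ring
  have hXm : ∀ t, Measurable (X t x) := fun t => h.meas t x
  have hHm' := hHm.mono (h.Fil_le n) le_rfl
  rw [lintegral_congr e1, lintegral_const_mul' _ _ (E_ne_top _), h.frac hn0.le hnt γ hHm x, ← mul_assoc, ← E_add]
  set hh : ℝ → ℝ≥0∞ := fun e => ib (gb a β n n + η) e * E (δ * e) with hhd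
  have hhm : Measurable hh := (ib_meas _).mul (by fun_prop)
  have e2 : ∫⁻ ω, H ω ∂P = Wk (fun i => gb a β n i + η) n hh 0 := by
    set f : ℝ → ℝ≥0∞ := fun e => ib (b n) e * E (γ * (e - a * n) + d * n) with hf
    have hfm : Measurable f := (ib_meas _).mul (by fun_prop)
    have e3 : ∀ ω, H ω = pp X b 0 n x ω * f (X n x ω) := by
      intro ω
      simp only [hH, hf, pp_succ]
      simp only [zero_add]; ring
    rw [lintegral_congr e3, h.path0 b n x hfm]
    have e4 : f = fun e => E (a * e) * (fun e' => E (d * n - a^2 * n) * hh e') (e - a * n) := by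
      funext e
      simp only [hf, hhd]
      have : γ * (e - a * n) + d * n = a * e + ((d * n - a^2 * n) + δ * (e - a * n)) := by rw [hδd]; ring
      rw [this, E_add, E_add]
      have h5 : ib (b n) e = ib (gb a β n n + η) (e - a * n) := by
        apply le_antisymm
        · apply ib_mono; intro h6; simp only [hb] at h6; linarith
        · apply ib_mono; intro h6; simp only [hb]; linarith
      rw [h5]; ring
    rw [e4, Wk_tilt a b n (hhm.const_mul _) 0]
    have e5 : (fun i => b i - a * i) = fun i => gb a β n i + η := by funext i; simp only [hb]; ring
    rw [e5, Wk_const_mul _ _ hhm]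
    rw [← mul_assoc, ← E_add, ha2]
    have : a * 0 + 2 * (d:ℝ) * n/2 + (d * n - 2 * d * n) = 0 := by ring
    rw [this, E_zero, one_mul]
  rw [e2]
  have h3 := ht (fun i => gb a β n i + η) (β + η) (gb a β n n + η) 0 n hh hhm hn (by positivity)
    (fun i _ => by have := gb_le a β n i; linarith) (fun m _ hm => by have := gb_slope ha β (le_refl n) hm; linarith)
  have h4 := lint_head hδ (gb a β n n + η)
  have h5 : E ((d - γ * a) * (t - n) + γ^2 * (t - n)/2) ≤ ENNReal.ofReal (Real.exp (δ^2/2)) := by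
    apply E_mono
    have : (d - γ * a) * (t - n) + γ^2 * (t - n)/2 = δ^2/2 * (t-n) := by
      rw [hδd]; linear_combination (-(t-n)/2) * ha2
    rw [this]
    have : 0 ≤ δ^2/2 := by positivity
    nlinarith
  calc _ ≤ ENNReal.ofReal (Real.exp (δ^2/2)) * (ENNReal.ofReal (C0 * (1 + (β + η - 0)) / (n:ℝ)^(3/2:ℝ)) * ENNReal.ofReal ((1 + 2/δ) * (2/δ) * Real.exp (δ * (gb a β n n + η)))) :=
        mul_le_mul' h5 (h3.trans (mul_le_mul_right h4 _))
    _ = _ := by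
        rw [sub_zero, ← ENNReal.ofReal_mul (by positivity), ← ENNReal.ofReal_mul (by positivity)]
        congr 1
        rw [gb_last β ha hn]
        have e6 : Real.exp (δ * (β - 3/(2*a) * Real.log n + η)) = Real.exp (δ * (β + η)) * (n:ℝ)^(-(3*γ/(2*a))) * (n:ℝ)^(3/2:ℝ) := by
          rw [mul_assoc, ← Real.rpow_add hn0, Real.rpow_def_of_pos hn0, ← Real.exp_add]
          congr 1
          rw [hδd]; field_simp; ring
        rw [e6]; field_simp

lemma FH.tight (h : FH P k X) (hd : 1 ≤ d) {γ : ℝ} (hγ : Real.sqrt (2*(d:ℝ)) < γ) {Y : ℝ → Ω → ℝ}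
    (hY : ∀ (t : ℝ) (ω : Ω), Y t ω =
      t ^ (3 * γ / (2 * Real.sqrt (2 * (d:ℝ)))) *
        Real.exp (t * (γ / Real.sqrt 2 - Real.sqrt (d:ℝ)) ^ 2) *
        ∫ x in {x : EuclideanSpace ℝ (Fin d) | ∀ i, x i ∈ Set.Icc (0:ℝ) 1},
          Real.exp (γ * X t x ω - γ ^ 2 / 2 * t)) :
    ∀ ε : ℝ, 0 < ε → ∃ M : ℝ, ∀ t : ℝ, 1 ≤ t →
        P {ω | M < |Y t ω|} ≤ ENNReal.ofReal ε := by
  intro ε hε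
  have hd0 : (0:ℝ) < d := by exact_mod_cast hd
  set a := Real.sqrt (2*(d:ℝ)) with haD
  have ha : 0 < a := Real.sqrt_pos.2 (by positivity)
  have ha2 : a^2 = 2*d := Real.sq_sqrt (by positivity)
  obtain ⟨C, hC, hbb⟩ := h.bigbad_le ha ha2
  -- choose the level
  have hlim : Tendsto (fun β : ℝ => C * ((1+β) * Real.exp (-a*β))) atTop (nhds 0) := by
    have h1 : Tendsto (fun β : ℝ => β * Real.exp (-a*β)) atTop (nhds 0) := by
      have := Real.tendsto_pow_mul_exp_neg_atTop_nhds_zero 1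
      have h2 := this.comp (tendsto_id.const_mul_atTop ha)
      have h3 := h2.const_mul a⁻¹
      simp only [mul_zero, Function.comp_def, pow_one, id] at h3
      refine h3.congr fun β => ?_
      rw [neg_mul]; field_simp
    have h2 : Tendsto (fun β : ℝ => Real.exp (-a*β)) atTop (nhds 0) := by
      refine Real.tendsto_exp_atBot.comp ?_
      exact tendsto_id.const_mul_atTop_of_neg (by linarith)
    have h3 := (h2.add h1).const_mul C
    simp only [add_zero, mul_zero] at h3
    refine h3.congr fun β => by ring
  obtain ⟨β, hβ0, hβ⟩ := ((eventually_ge_atTop (0:ℝ)).and (hlim.eventually (eventually_le_nhds (show (0:ℝ) < ε/2 by positivity)))).exists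
  obtain ⟨C1, hC1, hmean⟩ := h.mean_x (γ := γ) ha ha2 hγ (etaT_nonneg d) hβ0
  set p : ℝ := 3 * γ / (2 * a) with hp
  have hγ0 : 0 < γ := ha.trans hγ
  have hp0 : 0 ≤ p := by positivity
  set C2 : ℝ := C1 * 2^p with hC2
  refine ⟨(C2 + 1) / (ε/2), fun t ht => ?_⟩
  have hM : 0 < (C2 + 1) / (ε/2) := by positivity
  set M := (C2 + 1) / (ε/2) with hMd
  set n := ⌊t⌋₊ with hn
  have hn1 : 1 ≤ n := (Nat.one_le_floor_iff t).2 ht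
  have hnt : (n:ℝ) ≤ t := Nat.floor_le (by linarith)
  have htn : t ≤ n + 1 := (Nat.lt_floor_add_one t).le
  have hn0 : (0:ℝ) < n := by exact_mod_cast hn1
  obtain ⟨hYn, hYr⟩ := h.Yrep hY (t := t) (by linarith)
  set b : ℕ → ℝ := fun i => a * i + gb a β n i + etaT d with hb
  set F : Ω × Eu d → ℝ≥0∞ := fun q => pp X b 0 (n+1) q.2 q.1 * E (γ * (X t q.2 q.1 - a * t) + d * t) with hF
  have hFm : AEMeasurable F (P.prod (vQ d)) := by
    refine (h.pp_jm (vQ d) measurable_id b 0 (n+1)).mul ?_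
    have hm : Measurable fun z => E (γ * (z - a * t) + d * t) := by fun_prop
    exact hm.comp_aemeasurable (h.jm (vQ d) measurable_id t)
  set Z : Ω → ℝ≥0∞ := fun ω => ENNReal.ofReal (t^p) * ∫⁻ x, F (ω, x) ∂(vQ d) with hZ
  have hZm : AEMeasurable Z P := (hFm.lintegral_prod_right').const_mul _
  have hZint : ∫⁻ ω, Z ω ∂P ≤ ENNReal.ofReal C2 := by
    rw [hZ, lintegral_const_mul' _ _ ENNReal.ofReal_ne_top]
    rw [lintegral_lintegral_swap (f := fun ω x => F (ω, x)) hFm]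
    calc _ ≤ ENNReal.ofReal (t^p) * ∫⁻ x, ENNReal.ofReal (C1 * (n:ℝ)^(-p)) ∂(vQ d) :=
          mul_le_mul_right (lintegral_mono fun x => hmean n t x hn1 hnt htn) _
      _ = ENNReal.ofReal (t^p * (C1 * (n:ℝ)^(-p))) := by
          rw [lintegral_const, measure_univ, mul_one, ← ENNReal.ofReal_mul (by positivity)]
      _ ≤ _ := by
          apply ENNReal.ofReal_le_ofReal
          have h1 : t^p ≤ (2*n)^p := Real.rpow_le_rpow (by linarith) (by have : (1:ℝ) ≤ n := by exact_mod_cast hn1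
                                                                         linarith) hp0
          rw [Real.mul_rpow (by norm_num) hn0.le] at h1
          calc _ ≤ (2^p * (n:ℝ)^p) * (C1 * (n:ℝ)^(-p)) := mul_le_mul_of_nonneg_right h1 (by positivity)
            _ = C1 * 2^p * ((n:ℝ)^p * (n:ℝ)^(-p)) := by ring
            _ = _ := by rw [← Real.rpow_add hn0]; simp [hC2]
  have hsub : P {ω | M < |Y t ω|} ≤ P (bigbad X a β (etaT d) n ∪ {ω | ENNReal.ofReal M ≤ Z ω}) := by
    refine measure_mono_ae ?_
    filter_upwards [hYr, h.good ha] with ω h1 h2 h3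
    by_cases hω : ω ∈ bigbad X a β (etaT d) n
    · exact Or.inl hω
    right
    have h4 := h2 β hβ0 n hn1 hω
    have h3' : M < |Y t ω| := h3
    rw [abs_of_nonneg (hYn ω)] at h3'
    have h5 : ENNReal.ofReal (Y t ω) = Z ω := by
      rw [h1, hZ]
      simp only
      congr 1
      refine lintegral_congr_ae ?_
      have : ∀ᵐ x ∂(vQ d), x ∈ Q d := ae_restrict_mem (Q_meas d)
      filter_upwards [this] with x hx
      simp only [hF]
      have h6 : pp X b 0 (n+1) x ω = 1 := by
        unfold pp
        refine Finset.prod_eq_one fun i hi => ?_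
        apply ib_of_le
        have := h4 x hx i (by have := Finset.mem_range.1 hi; omega)
        simpa [hb] using this
      rw [h6, one_mul]
    show ENNReal.ofReal M ≤ Z ω
    rw [← h5]; exact ENNReal.ofReal_le_ofReal h3'.le
  calc _ ≤ _ := hsub
    _ ≤ P (bigbad X a β (etaT d) n) + P {ω | ENNReal.ofReal M ≤ Z ω} := measure_union_le _ _
    _ ≤ ENNReal.ofReal (ε/2) + ENNReal.ofReal (ε/2) := by
        refine add_le_add ((hbb β n hβ0).trans (ENNReal.ofReal_le_ofReal hβ)) ?_
        refine (meas_ge_le_lintegral_div hZm (by simpa using hM) ENNReal.ofReal_ne_top).trans ?_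
        refine (ENNReal.div_le_div_right hZint _).trans ?_
        rw [← ENNReal.ofReal_div_of_pos hM]
        apply ENNReal.ofReal_le_ofReal
        rw [hMd, div_div_eq_mul_div, div_le_iff₀ (by positivity)]
        nlinarith
    _ = _ := by rw [← ENNReal.ofReal_add (by positivity) (by positivity)]; congr 1; ring

end SC



namespace SC
open scoped ENNReal
set_option linter.unusedSectionVars false

lemma ind_int (c : ℝ) : ∫⁻ e, ind (c-1) c e * ENNReal.ofReal (1 + max (c - e) 0) ≤ 2 := by
  calc _ ≤ ∫⁻ e, (Set.Icc (c-1) c).indicator (fun _ => (2:ℝ≥0∞)) e := by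
        refine lintegral_mono fun e => ?_
        simp only [ind]
        by_cases he : e ∈ Set.Icc (c-1) c
        · rw [Set.indicator_of_mem he, Set.indicator_of_mem he, one_mul]
          rw [show (2:ℝ≥0∞) = ENNReal.ofReal 2 by simp]
          apply ENNReal.ofReal_le_ofReal
          have : max (c - e) 0 ≤ 1 := max_le (by linarith [he.1]) (by norm_num)
          linarith
        · rw [Set.indicator_of_notMem he]; simp
    _ ≤ 2 := by
        rw [lintegral_indicator measurableSet_Icc, lintegral_const]
        simp

lemma tilt_ind (a' : ℝ) (l m : ℕ) (s : ℝ) :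
    Wk (fun i => a' * ((l + i : ℕ):ℝ)) m (ind (a' * ((l + m : ℕ):ℝ) - 1) (a' * ((l + m : ℕ):ℝ))) s =
      E (a' * s + a'^2 * m / 2) * Wk (fun _ => a' * l) m (fun e => E (-a' * (e + a' * m)) * ind (a' * l - 1) (a' * l) e) s := by
  rw [← show (fun i : ℕ => a' * ((l + i : ℕ):ℝ) - a' * i) = fun _ => a' * l by funext i; push_cast; ring]
  rw [← Wk_tilt a' _ m (by fun_prop) s]
  congr 1
  funext e
  have h1 : ind (a' * l - 1) (a' * l) (e - a' * m) = ind (a' * ((l + m : ℕ):ℝ) - 1) (a' * ((l + m : ℕ):ℝ)) e := by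
    unfold ind
    by_cases he : e ∈ Set.Icc (a' * ((l + m : ℕ):ℝ) - 1) (a' * ((l + m : ℕ):ℝ))
    · rw [Set.indicator_of_mem he, Set.indicator_of_mem]
      have h1 := he.1; have h2 := he.2
      push_cast at h1 h2
      constructor <;> linarith
    · rw [Set.indicator_of_notMem he, Set.indicator_of_notMem]
      intro h3; apply he
      have h1 := h3.1; have h2 := h3.2
      push_cast
      constructor <;> linarith
  rw [h1, ← mul_assoc, ← E_add]
  rw [show a' * e + -a' * (e - a' * m + a' * m) = 0 by ring, E_zero, one_mul]

lemma Phi_le {a : ℝ} (ha : 0 < a) : ∃ C : ℝ, 0 ≤ C ∧ ∀ (a' : ℝ) (l m : ℕ) (s : ℝ), a/2 ≤ a' → a' ≤ a → 1 ≤ m →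
    Wk (fun i => a' * ((l + i : ℕ):ℝ)) m (ind (a' * ((l + m : ℕ):ℝ) - 1) (a' * ((l + m : ℕ):ℝ))) s ≤
      ENNReal.ofReal (C * Real.exp (-a'^2 * m / 2) / (m:ℝ)^(3/2:ℝ)) * (ib (a' * l) s * E (-(3/4) * a' * (a' * l - s))) := by
  obtain ⟨C0, hC0, ht⟩ := thirds (H := 0) le_rfl
  refine ⟨2 * Real.exp a * (C0 * (1 + 8/a)), by positivity, ?_⟩
  intro a' l m s h1 h2 hm
  have ha' : 0 < a' := by linarith
  have hm0 : (0:ℝ) < m := by exact_mod_cast hm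
  rcases le_or_gt s (a' * l) with hs | hs
  swap
  · rw [ib_of_lt hs]
    obtain ⟨m', rfl⟩ : ∃ m', m = m' + 1 := ⟨m - 1, by omega⟩
    rw [Wk_succ', K_of_lt _ (by simpa using hs)]
    exact zero_le
  rw [ib_of_le hs, one_mul, tilt_ind]
  have h3 : Wk (fun _ => a' * l) m (fun e => E (-a' * (e + a' * m)) * ind (a' * l - 1) (a' * l) e) s ≤
      E (-a' * (a' * l - 1 + a' * m)) * Wk (fun _ => a' * l) m (ind (a' * l - 1) (a' * l)) s := by
    have := congrFun (Wk_const_mul (fun _ => a' * l) m (ind_meas (a' * l - 1) (a' * l)) (E (-a' * (a' * l - 1 + a' * m)))) s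
    rw [← this]
    refine Wk_mono (fun _ _ => le_rfl) (fun e => ?_) s
    simp only [ind]
    by_cases he : e ∈ Set.Icc (a' * l - 1) (a' * l)
    · rw [Set.indicator_of_mem he]
      refine mul_le_mul_left (E_mono ?_) _
      have := he.1
      nlinarith
    · rw [Set.indicator_of_notMem he]; simp
  have h4 := ht (fun _ => a' * l) (a' * l) (a' * l) s m (ind (a' * l - 1) (a' * l)) (ind_meas _ _) hm hs (fun _ _ => le_rfl)
    (fun _ _ _ => by simp)
  have h5 := ind_int (a' * l)
  set z := a' * l - s with hz
  have hz0 : 0 ≤ z := by linarith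
  calc _ ≤ E (a' * s + a'^2 * m / 2) * (E (-a' * (a' * l - 1 + a' * m)) * (ENNReal.ofReal (C0 * (1 + z) / (m:ℝ)^(3/2:ℝ)) * ENNReal.ofReal 2)) := by
        refine mul_le_mul_right (h3.trans (mul_le_mul_right (h4.trans (mul_le_mul_right ?_ _)) _)) _
        simpa using h5
    _ = ENNReal.ofReal (Real.exp (a' * s + a'^2 * m / 2 + -a' * (a' * l - 1 + a' * m)) * (C0 * (1 + z) / (m:ℝ)^(3/2:ℝ) * 2)) := by
        rw [← mul_assoc, ← E_add, ← ENNReal.ofReal_mul (by positivity)]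
        unfold E
        rw [← ENNReal.ofReal_mul (by positivity)]
    _ ≤ ENNReal.ofReal ((2 * Real.exp a * (C0 * (1 + 8/a)) * Real.exp (-a'^2 * m / 2) / (m:ℝ)^(3/2:ℝ)) * Real.exp (-(3/4) * a' * z)) := by
        apply ENNReal.ofReal_le_ofReal
        have e1 : a' * s + a'^2 * m / 2 + -a' * (a' * l - 1 + a' * m) = -a' * z + -a'^2 * m/2 + a' := by rw [hz]; ring
        rw [e1, Real.exp_add, Real.exp_add]
        have e2 : Real.exp a' ≤ Real.exp a := Real.exp_le_exp.2 h2
        have e3 : (1 + z) ≤ (1 + 8/a) * Real.exp (1/4 * a' * z) := by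
          have q1 : 1/4 * a' * z + 1 ≤ Real.exp (1/4 * a' * z) := Real.add_one_le_exp _
          have q2 : a * z / 8 + 1 ≤ Real.exp (1/4 * a' * z) := by nlinarith
          have q3 : (1 + 8/a) * (a * z/8 + 1) ≤ (1 + 8/a) * Real.exp (1/4 * a' * z) := mul_le_mul_of_nonneg_left q2 (by positivity)
          have q4 : (1 + 8/a) * (a * z/8 + 1) = a*z/8 + 1 + z + 8/a := by field_simp; ring
          have q5 : 0 ≤ a*z/8 + 8/a := by positivity
          linarith
        have e4 : Real.exp (-(3/4) * a' * z) = Real.exp (-a' * z) * Real.exp (1/4 * a' * z) := by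
          rw [← Real.exp_add]; congr 1; ring
        rw [e4]
        calc _ ≤ Real.exp (-a' * z) * Real.exp (-a'^2 * m/2) * Real.exp a * (C0 * ((1 + 8/a) * Real.exp (1/4 * a' * z)) / (m:ℝ)^(3/2:ℝ) * 2) := by
              gcongr
          _ = _ := by ring
    _ = _ := by rw [ENNReal.ofReal_mul (by positivity)]; rfl

lemma PA_low : ∃ c : ℝ, 0 < c ∧ ∀ (a' : ℝ) (n : ℕ), 0 ≤ a' → 3 ≤ n →
    ENNReal.ofReal (c * Real.exp (-a'^2 * n / 2) / (n:ℝ)^(3/2:ℝ)) ≤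
    Wk (fun i => a' * (i:ℝ)) n (ind (a' * n - 1) (a' * n)) 0 := by
  obtain ⟨c, hc, hb⟩ := ballot_low
  refine ⟨c, hc, fun a' n ha hn => ?_⟩
  have h1 := tilt_ind a' 0 n 0
  simp only [zero_add, Nat.cast_zero, mul_zero, zero_sub] at h1
  rw [h1]
  have h3 : E (-a' * (a' * n)) * Wk Z0 n (ind (-1) 0) 0 ≤ Wk (fun _ => 0) n (fun e => E (-a' * (e + a' * n)) * ind (-1) 0 e) 0 := by
    have := congrFun (Wk_const_mul Z0 n (ind_meas (-1) 0) (E (-a' * (a' * n)))) 0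
    rw [← this]
    refine Wk_mono (fun _ _ => le_rfl) (fun e => ?_) 0
    simp only [ind]
    by_cases he : e ∈ Set.Icc (-1:ℝ) 0
    · rw [Set.indicator_of_mem he]
      refine mul_le_mul_left (E_mono ?_) _
      have := he.2
      nlinarith
    · rw [Set.indicator_of_notMem he]; simp
  calc _ = E (a'^2 * n/2) * (E (-a' * (a' * n)) * ENNReal.ofReal (c / (n:ℝ)^(3/2:ℝ))) := by
        rw [← mul_assoc, ← E_add]; unfold E
        rw [← ENNReal.ofReal_mul (by positivity)]
        congr 1
        rw [show a'^2 * n/2 + -a' * (a' * n) = -a'^2 * n/2 by ring]; ring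
    _ ≤ _ := mul_le_mul' (by simp) ((mul_le_mul_right (hb n hn) _).trans h3)

end SC



namespace SC
open scoped ENNReal
set_option linter.unusedSectionVars false

variable {d : ℕ} {Ω : Type*} [m0 : MeasurableSpace Ω] {P : Measure Ω} [IsProbabilityMeasure P]
  {k : Eu d → ℝ} {X : ℝ → Eu d → Ω → ℝ}

/-- indicator of the near-maximal path event -/
def NA (X : ℝ → Eu d → Ω → ℝ) (a' : ℝ) (n : ℕ) (x : Eu d) (ω : Ω) : ℝ≥0∞ :=
  pp X (fun i => a' * (i:ℝ)) 0 n x ω * ind (a' * n - 1) (a' * n) (X n x ω)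

lemma ind_le_one (l r s : ℝ) : ind l r s ≤ 1 := by
  unfold ind; exact Set.indicator_le_self' (by simp) s

lemma NA_le_one (a' : ℝ) (n : ℕ) (x : Eu d) (ω : Ω) : NA X a' n x ω ≤ 1 :=
  mul_le_one' (pp_le_one _ _ _ _ _) (ind_le_one _ _ _)

lemma NA_meas (X : ℝ → Eu d → Ω → ℝ) (a' : ℝ) (n : ℕ) (x : Eu d) : Measurable[Fil X n] (NA X a' n x) :=
  Measurable.mul (pp_meas X _ 0 n n (by omega) x) ((ind_meas _ _).comp (FH.Fil_nat X le_rfl x))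

lemma FH.NA_int (h : FH P k X) (a' : ℝ) (n : ℕ) (x : Eu d) :
    ∫⁻ ω, NA X a' n x ω ∂P = Wk (fun i => a' * (i:ℝ)) n (ind (a' * n - 1) (a' * n)) 0 :=
  h.path0 _ n x (ind_meas _ _)

lemma FH.NA_up (h : FH P k X) {a : ℝ} (ha : 0 < a) : ∃ C : ℝ, 0 ≤ C ∧ ∀ (a' : ℝ) (n : ℕ) (x : Eu d), a/2 ≤ a' → a' ≤ a → 1 ≤ n →
    ∫⁻ ω, NA X a' n x ω ∂P ≤ ENNReal.ofReal (C * Real.exp (-a'^2 * n / 2) / (n:ℝ)^(3/2:ℝ)) := by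
  obtain ⟨C, hC, hP⟩ := Phi_le ha
  refine ⟨C, hC, fun a' n x h1 h2 hn => ?_⟩
  rw [h.NA_int]
  have := hP a' 0 n 0 h1 h2 hn
  simp only [zero_add] at this
  refine this.trans ?_
  rw [ib_of_le (by simp), one_mul]
  simp [E_zero]

/-- the factorized pair integral up to the branching level -/
lemma FH.pair_in (h : FH P k X) {a : ℝ} (ha : 0 < a) {D : ℝ} (hD : 0 ≤ D) : ∃ C : ℝ, 0 ≤ C ∧ ∀ (a' : ℝ) (l : ℕ) (x y : Eu d), a/2 ≤ a' → a' ≤ a →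
    (∀ i ≤ l, (3/4) * a' * ((i:ℝ) - Kf k i (x - y)) ≤ D) →
    ∫⁻ ω, pp X (fun i => a' * (i:ℝ)) 0 l x ω * ((ib (a' * l) (X l x ω) * E (-(3/4) * a' * (a' * l - X l x ω))) *
      (ib (a' * l) (X l y ω) * E (-(3/4) * a' * (a' * l - X l y ω)))) ∂P ≤
      ENNReal.ofReal (C * Real.exp (-a'^2 * l / 2) / ((l:ℝ)+1)^(3/2:ℝ)) := by
  obtain ⟨C0, hC0, ht⟩ := thirds (H := 0) le_rfl
  set C1 : ℝ := C0 * (1 + D) * ((1 + 8/a) * (8/a) * Real.exp (a/2 * D)) with hC1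
  have hC1n : 0 ≤ C1 := by positivity
  refine ⟨1 + C1 * 2^(3/2:ℝ), by positivity, fun a' l x y h1 h2 hκ => ?_⟩
  have ha' : 0 < a' := by linarith
  rcases Nat.eq_zero_or_pos l with rfl | hl
  · calc _ ≤ ∫⁻ ω, (1:ℝ≥0∞) ∂P := by
          refine lintegral_mono fun ω => ?_
          simp only
          have hone : ∀ s : ℝ, ib (a' * (0:ℕ)) s * E (-(3/4) * a' * (a' * (0:ℕ) - s)) ≤ 1 := by
            intro s
            rcases le_or_gt s (a' * (0:ℕ)) with hs | hs
            · rw [ib_of_le hs, one_mul, ← E_zero]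
              apply E_mono
              have : 0 ≤ a' * (a' * (0:ℕ) - s) := mul_nonneg ha'.le (by linarith)
              rw [mul_assoc]; exact mul_nonpos_of_nonpos_of_nonneg (by norm_num) this
            · rw [ib_of_lt hs, zero_mul]; exact zero_le
          exact mul_le_one' (pp_le_one _ _ _ _ _) (mul_le_one' (hone _) (hone _))
      _ = ENNReal.ofReal 1 := by simp
      _ ≤ _ := by
          apply ENNReal.ofReal_le_ofReal
          simp only [Nat.cast_zero, mul_zero, zero_div, Real.exp_zero, zero_add, Real.one_rpow, mul_one, div_one]
          have : 0 ≤ C1 * 2^(3/2:ℝ) := by positivity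
          linarith
  set f : ℝ → ℝ≥0∞ := fun e => ib (a' * l) e * E (1/2 * a' * e - 3/2 * a'^2 * l) with hf
  have hfm : Measurable f := (ib_meas _).mul (by fun_prop)
  have hκ0 : ∀ i : ℕ, 0 ≤ (i:ℝ) - Kf k i (x - y) := fun i => by
    have := kap_nonneg h (Nat.cast_nonneg i : (0:ℝ) ≤ (i:ℝ)) (x - y); linarith
  have hl0 : (1:ℝ) ≤ l := by exact_mod_cast hl
  calc _ ≤ ∫⁻ ω, E (a' * X l x ω + (-(3/4) * a') * (X l x ω - X l y ω)) * (pp X (fun i => a' * (i:ℝ)) 0 l x ω * f (X l x ω)) ∂P := by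
        refine lintegral_mono fun ω => ?_
        simp only [hf]
        have e1 : E (-(3/4) * a' * (a' * l - X l x ω)) * E (-(3/4) * a' * (a' * l - X l y ω)) =
            E (a' * X l x ω + (-(3/4) * a') * (X l x ω - X l y ω)) * E (1/2 * a' * X l x ω - 3/2 * a'^2 * l) := by
          rw [← E_add, ← E_add]; congr 1; ring
        calc _ = (pp X (fun i => a' * (i:ℝ)) 0 l x ω * ib (a' * l) (X l x ω)) * ib (a' * l) (X l y ω) * (E (-(3/4) * a' * (a' * l - X l x ω)) * E (-(3/4) * a' * (a' * l - X l y ω))) := by ring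
          _ ≤ (pp X (fun i => a' * (i:ℝ)) 0 l x ω * ib (a' * l) (X l x ω)) * 1 * (E (-(3/4) * a' * (a' * l - X l x ω)) * E (-(3/4) * a' * (a' * l - X l y ω))) :=
              mul_le_mul_left (mul_le_mul_right (ib_le_one _ _) _) _
          _ = _ := by rw [e1]; ring
    _ ≤ E (a'^2 * l/2) * (E (-a'^2 * l) * Wk (fun _ => D) l (fun e => ib D e * E (1/2 * a' * e)) 0) := by
        rw [h.cmpath a' (-(3/4) * a') _ l x y hfm]
        refine mul_le_mul' (E_mono ?_) ?_
        · have := hκ0 l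
          have : 0 ≤ a'^2 * ((l:ℝ) - Kf k l (x - y)) := by positivity
          nlinarith
        · have := congrFun (Wk_const_mul (fun _ => D) l (f := fun e => ib D e * E (1/2 * a' * e)) ((ib_meas _).mul (by fun_prop)) (E (-a'^2 * l))) 0
          rw [← this]
          refine Wk_mono (fun i hi => ?_) (fun e => ?_) 0
          · have := hκ i hi.le
            linarith
          · simp only [hf]
            have q := hκ l le_rfl
            have q0 := mul_nonneg ha'.le (hκ0 l)
            have q1 : ib (a' * l) (e + (a' * l + -(3/4) * a' * ((l:ℝ) - Kf k l (x-y)))) ≤ ib D e := by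
              apply ib_mono; intro; linarith
            have q2 : E (1/2 * a' * (e + (a' * l + -(3/4) * a' * ((l:ℝ) - Kf k l (x-y)))) - 3/2 * a'^2 * l) ≤ E (-a'^2 * l) * E (1/2 * a' * e) := by
              rw [← E_add]; apply E_mono
              have := mul_nonneg ha'.le q0
              nlinarith
            calc _ ≤ ib D e * (E (-a'^2 * l) * E (1/2 * a' * e)) := mul_le_mul' q1 q2
              _ = _ := by ring
    _ ≤ E (a'^2 * l/2) * (E (-a'^2 * l) * (ENNReal.ofReal (C0 * (1 + D) / (l:ℝ)^(3/2:ℝ)) * ENNReal.ofReal ((1 + 8/a) * (8/a) * Real.exp (a/2 * D)))) := by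
        refine mul_le_mul_right (mul_le_mul_right ?_ _) _
        have q := ht (fun _ => D) D D 0 l (fun e => ib D e * E (1/2 * a' * e)) ((ib_meas _).mul (by fun_prop)) hl hD (fun _ _ => le_rfl) (fun _ _ _ => by simp)
        rw [sub_zero] at q
        refine q.trans (mul_le_mul_right ?_ _)
        refine (lint_head (α := 1/2 * a') (by positivity) D).trans (ENNReal.ofReal_le_ofReal ?_)
        have q1 : 2/(1/2*a') ≤ 8/a := by
          rw [div_le_div_iff₀ (by positivity) ha]; linarith
        have q2 : 1/2 * a' * D ≤ a/2 * D := mul_le_mul_of_nonneg_right (by linarith) hD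
        have q3 := Real.exp_le_exp.2 q2
        gcongr
    _ = ENNReal.ofReal (C1 * Real.exp (-a'^2 * l/2) / (l:ℝ)^(3/2:ℝ)) := by
        rw [← mul_assoc, ← E_add, ← ENNReal.ofReal_mul (by positivity)]
        unfold E
        rw [← ENNReal.ofReal_mul (by positivity)]
        congr 1
        rw [show a'^2 * l/2 + -a'^2 * l = -a'^2 * l/2 by ring, hC1]; ring
    _ ≤ _ := by
        apply ENNReal.ofReal_le_ofReal
        have q : ((l:ℝ)+1)^(3/2:ℝ) ≤ 2^(3/2:ℝ) * (l:ℝ)^(3/2:ℝ) := by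
          rw [← Real.mul_rpow (by norm_num) (by positivity)]
          exact Real.rpow_le_rpow (by positivity) (by linarith) (by norm_num)
        rw [div_le_div_iff₀ (by positivity) (by positivity)]
        have q2 : 0 ≤ C1 * Real.exp (-a'^2 * l/2) := by positivity
        calc _ ≤ C1 * Real.exp (-a'^2 * l/2) * (2^(3/2:ℝ) * (l:ℝ)^(3/2:ℝ)) := mul_le_mul_of_nonneg_left q q2
          _ ≤ _ := by
            have : 0 ≤ Real.exp (-a'^2 * l/2) * (l:ℝ)^(3/2:ℝ) := by positivity
            nlinarith

lemma FH.pair (h : FH P k X) {a : ℝ} (ha : 0 < a) {R : ℝ} (hR0 : 0 < R) (hR : ∀ z, R ≤ ‖z‖ → k z = 0) : ∃ C : ℝ, 0 ≤ C ∧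
    ∀ (a' : ℝ) (l m : ℕ) (x y : Eu d), a/2 ≤ a' → a' ≤ a → 1 ≤ m → R ≤ Real.exp l * ‖x - y‖ → Real.exp l * ‖x - y‖ ≤ R * Real.exp 1 →
    ∫⁻ ω, NA X a' (l+m) x ω * NA X a' (l+m) y ω ∂P ≤
      ENNReal.ofReal (C * (Real.exp (-a'^2 * l / 2) / ((l:ℝ)+1)^(3/2:ℝ)) * (Real.exp (-a'^2 * m) / (m:ℝ)^(3:ℝ))) := by
  obtain ⟨L, hL, hLk⟩ := h.lip
  obtain ⟨C0, hC0, hPhi⟩ := Phi_le ha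
  obtain ⟨C1, hC1, hin⟩ := h.pair_in ha (D := (3/4) * a * (L * (R * Real.exp 1))) (by positivity)
  refine ⟨C0^2 * C1, by positivity, fun a' l m x y h1 h2 hm hz1 hz2 => ?_⟩
  have ha' : 0 < a' := by linarith
  have hm0 : (0:ℝ) < m := by exact_mod_cast hm
  set b : ℕ → ℝ := fun i => a' * (i:ℝ) with hb
  set φ := ind (a' * ((l+m:ℕ):ℝ) - 1) (a' * ((l+m:ℕ):ℝ)) with hφ
  set cm := ENNReal.ofReal (C0 * Real.exp (-a'^2 * m / 2) / (m:ℝ)^(3/2:ℝ)) with hcm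
  have hκ : ∀ i ≤ l, (3/4) * a' * ((i:ℝ) - Kf k i (x - y)) ≤ (3/4) * a * (L * (R * Real.exp 1)) := by
    intro i hi
    have q1 := kap_le h hL hLk (Nat.cast_nonneg i : (0:ℝ) ≤ (i:ℝ)) (x - y)
    have q2 : L * ‖x - y‖ * Real.exp i ≤ L * (R * Real.exp 1) := by
      rw [mul_assoc]
      refine mul_le_mul_of_nonneg_left (le_trans ?_ hz2) hL
      rw [mul_comm]
      exact mul_le_mul_of_nonneg_right (Real.exp_le_exp.2 (by exact_mod_cast hi)) (norm_nonneg _)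
    have q3 : 0 ≤ L * (R * Real.exp 1) := by positivity
    calc _ ≤ (3/4) * a' * (L * (R * Real.exp 1)) := mul_le_mul_of_nonneg_left (q1.trans q2) (by positivity)
      _ ≤ _ := by gcongr
  have hpm : Measurable[Fil X l] (pp X b 0 l x) := pp_meas X b 0 l l (by omega) x
  calc _ ≤ ∫⁻ ω, pp X b 0 l x ω * ((pp X (fun i => b (l+i)) l m x ω * φ (X (l+m:ℕ) x ω)) * (pp X (fun i => b (l+i)) l m y ω * φ (X (l+m:ℕ) y ω))) ∂P := by
        refine lintegral_mono fun ω => ?_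
        simp only [NA]
        rw [pp_add, pp_add]
        simp only [zero_add]
        calc _ = pp X b 0 l x ω * ((pp X (fun i => b (l+i)) l m x ω * φ (X (l+m:ℕ) x ω)) * (pp X (fun i => b (l+i)) l m y ω * φ (X (l+m:ℕ) y ω))) * pp X b 0 l y ω := by ring
          _ ≤ _ := mul_le_of_le_one_right' (pp_le_one _ _ _ _ _)
    _ = ∫⁻ ω, pp X b 0 l x ω * (Wk (fun i => b (l+i)) m φ (X l x ω) * Wk (fun i => b (l+i)) m φ (X l y ω)) ∂P :=
        h.path2 hR _ _ l m hz1 hpm (ind_meas _ _) (ind_meas _ _)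
    _ ≤ ∫⁻ ω, (cm * cm) * (pp X b 0 l x ω * ((ib (a' * l) (X l x ω) * E (-(3/4) * a' * (a' * l - X l x ω))) *
          (ib (a' * l) (X l y ω) * E (-(3/4) * a' * (a' * l - X l y ω))))) ∂P := by
        refine lintegral_mono fun ω => ?_
        simp only
        calc _ ≤ pp X b 0 l x ω * ((cm * (ib (a' * l) (X l x ω) * E (-(3/4) * a' * (a' * l - X l x ω)))) * (cm * (ib (a' * l) (X l y ω) * E (-(3/4) * a' * (a' * l - X l y ω))))) :=
              mul_le_mul_right (mul_le_mul' (hPhi a' l m _ h1 h2 hm) (hPhi a' l m _ h1 h2 hm)) _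
          _ = _ := by ring
    _ ≤ (cm * cm) * ENNReal.ofReal (C1 * Real.exp (-a'^2 * l / 2) / ((l:ℝ)+1)^(3/2:ℝ)) := by
        rw [lintegral_const_mul' _ _ (by rw [hcm]; exact ENNReal.mul_ne_top ENNReal.ofReal_ne_top ENNReal.ofReal_ne_top)]
        exact mul_le_mul_right (hin a' l x y h1 h2 hκ) _
    _ = _ := by
        rw [hcm, ← ENNReal.ofReal_mul (by positivity), ← ENNReal.ofReal_mul (by positivity)]
        congr 1
        have e1 : (m:ℝ)^(3:ℝ) = (m:ℝ)^(3/2:ℝ) * (m:ℝ)^(3/2:ℝ) := by rw [← Real.rpow_add hm0]; norm_num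
        have e2 : Real.exp (-a'^2 * m) = Real.exp (-a'^2 * m/2) * Real.exp (-a'^2 * m/2) := by rw [← Real.exp_add]; congr 1; ring
        rw [e1, e2]; field_simp

end SC



namespace SC
open scoped ENNReal
set_option linter.unusedSectionVars false

/-- the adjusted slope -/
def sl (a : ℝ) (n : ℕ) : ℝ := a - 3/(2*a) * Real.log n / n

lemma sl_sq {a D : ℝ} (ha : 0 < a) (ha2 : a^2 = 2*D) {n : ℕ} (hn : 1 ≤ n) : 2 * D - 3 * Real.log n / n ≤ (sl a n)^2 := by
  have hn0 : (0:ℝ) < n := by exact_mod_cast hn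
  have : (sl a n)^2 = a^2 - 3 * Real.log n / n + (3/(2*a) * Real.log n / n)^2 := by
    unfold sl; field_simp; ring
  rw [this, ha2]
  have := sq_nonneg (3/(2*a) * Real.log n / n)
  linarith

lemma log_frac {n m : ℕ} (hm : 1 ≤ m) (hmn : m ≤ n) : Real.log n * (m / n) ≤ Real.log m + 1 := by
  have hm0 : (0:ℝ) < m := by exact_mod_cast hm
  have hn0 : (0:ℝ) < n := by exact_mod_cast (lt_of_lt_of_le hm hmn)
  have h1 : Real.log n = Real.log m + Real.log (n/m) := by
    rw [Real.log_div hn0.ne' hm0.ne']; ring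
  have h2 : Real.log (n/m:ℝ) ≤ n/m := (Real.log_le_sub_one_of_pos (by positivity)).trans (by linarith)
  have h3 : 0 ≤ Real.log m := Real.log_nonneg (by exact_mod_cast hm)
  have h4 : (m/n:ℝ) ≤ 1 := by rw [div_le_one hn0]; exact_mod_cast hmn
  have h5 : (0:ℝ) ≤ m/n := by positivity
  rw [h1, add_mul]
  have h6 : Real.log (n/m:ℝ) * (m/n) ≤ (n/m) * (m/n) := mul_le_mul_of_nonneg_right h2 h5
  have h7 : (n/m:ℝ) * (m/n) = 1 := by field_simp
  have h8 : Real.log m * (m/n) ≤ Real.log m * 1 := mul_le_mul_of_nonneg_left h4 h3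
  linarith

lemma num1 {a D : ℝ} (ha : 0 < a) (ha2 : a^2 = 2*D) {l m : ℕ} (hm : 1 ≤ m) :
    Real.exp (2 * D * (l+m:ℕ)) * (Real.exp (-(sl a (l+m))^2 * l / 2) / ((l:ℝ)+1)^(3/2:ℝ)) * (Real.exp (-(sl a (l+m))^2 * m) / (m:ℝ)^(3:ℝ)) * Real.exp (-D * l)
      ≤ Real.exp (3/2) * 2^(3/2:ℝ) * (1/(m:ℝ)^(3/2:ℝ) + 1/((l:ℝ)+1)^(3/2:ℝ)) := by
  have hm0 : (0:ℝ) < m := by exact_mod_cast hm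
  set n := l + m with hn
  have hn1 : 1 ≤ n := by omega
  have hn0 : (0:ℝ) < n := by exact_mod_cast hn1
  have hnlm : (n:ℝ) = l + m := by rw [hn]; push_cast; ring
  have hs := sl_sq ha ha2 hn1
  set q := (sl a n)^2 with hq
  have h1 : 2 * D * n + -q * l/2 + -q * m + -D * l ≤ 3/2 * Real.log n + 3/2 * (Real.log m + 1) := by
    have h2 := log_frac hm (show m ≤ n by omega)
    have h3 : (l/2 + m : ℝ) * (2 * D - 3 * Real.log n / n) ≤ (l/2 + m : ℝ) * q := mul_le_mul_of_nonneg_left hs (by positivity)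
    have h4 : (l/2 + m : ℝ) * (3 * Real.log n / n) = 3/2 * Real.log n + 3/2 * (Real.log n * (m/n)) := by
      rw [show (l:ℝ) = n - m by rw [hnlm]; ring]; field_simp; ring
    rw [mul_sub, h4] at h3
    have h5 : 2 * D * (n:ℝ) = 2 * D * l + 2 * D * m := by rw [hnlm]; ring
    rw [h5]
    nlinarith
  have h2 : Real.exp (2 * D * n) * Real.exp (-q * l/2) * Real.exp (-q * m) * Real.exp (-D * l) ≤ Real.exp (3/2) * (n:ℝ)^(3/2:ℝ) * (m:ℝ)^(3/2:ℝ) := by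
    rw [← Real.exp_add, ← Real.exp_add, ← Real.exp_add, Real.rpow_def_of_pos hn0, Real.rpow_def_of_pos hm0, ← Real.exp_add, ← Real.exp_add]
    apply Real.exp_le_exp.2; linarith
  have hl1 : (0:ℝ) < (l:ℝ)+1 := by positivity
  have e3 : (m:ℝ)^(3:ℝ) = (m:ℝ)^(3/2:ℝ) * (m:ℝ)^(3/2:ℝ) := by rw [← Real.rpow_add hm0]; norm_num
  have h3 : (n:ℝ)^(3/2:ℝ) ≤ 2^(3/2:ℝ) * ((m:ℝ)^(3/2:ℝ) + ((l:ℝ)+1)^(3/2:ℝ)) := by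
    have q1 : (n:ℝ) ≤ 2 * max (m:ℝ) ((l:ℝ)+1) := by
      rw [hnlm]; have := le_max_left (m:ℝ) ((l:ℝ)+1); have := le_max_right (m:ℝ) ((l:ℝ)+1); linarith
    have q2 := Real.rpow_le_rpow hn0.le q1 (show (0:ℝ) ≤ 3/2 by norm_num)
    rw [Real.mul_rpow (by norm_num) (by positivity)] at q2
    refine q2.trans (mul_le_mul_of_nonneg_left ?_ (by positivity))
    have p1 : 0 ≤ (m:ℝ)^(3/2:ℝ) := by positivity
    have p2 : 0 ≤ ((l:ℝ)+1)^(3/2:ℝ) := by positivity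
    rcases max_choice (m:ℝ) ((l:ℝ)+1) with hh | hh <;> rw [hh] <;> linarith
  set M := (m:ℝ)^(3/2:ℝ) with hM
  set Lq := ((l:ℝ)+1)^(3/2:ℝ) with hLq
  have hMp : 0 < M := by positivity
  have hLp : 0 < Lq := by positivity
  rw [e3]
  calc _ = (Real.exp (2 * D * n) * Real.exp (-q * l/2) * Real.exp (-q * m) * Real.exp (-D * l)) / (Lq * (M * M)) := by field_simp
    _ ≤ (Real.exp (3/2) * (n:ℝ)^(3/2:ℝ) * M) / (Lq * (M * M)) := div_le_div_of_nonneg_right h2 (by positivity)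
    _ ≤ (Real.exp (3/2) * (2^(3/2:ℝ) * (M + Lq)) * M) / (Lq * (M * M)) := by gcongr
    _ = _ := by field_simp; ring

lemma sum_n : ∃ C : ℝ, 0 ≤ C ∧ ∀ n : ℕ, ∑ l ∈ Finset.range n, (1/((n-l:ℕ):ℝ)^(3/2:ℝ) + 1/((l:ℝ)+1)^(3/2:ℝ)) ≤ C := by
  have s1 : Summable (fun i : ℕ => 1/((i:ℝ)+1)^(3/2:ℝ)) := by
    have := (Real.summable_one_div_nat_rpow (p := 3/2)).2 (by norm_num)
    simpa using (summable_nat_add_iff 1).2 this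
  have hn : ∀ i : ℕ, 0 ≤ 1/((i:ℝ)+1)^(3/2:ℝ) := fun i => by positivity
  set S := ∑' i : ℕ, 1/((i:ℝ)+1)^(3/2:ℝ) with hS
  refine ⟨S + S, add_nonneg (tsum_nonneg hn) (tsum_nonneg hn), fun n => ?_⟩
  rw [Finset.sum_add_distrib]
  refine add_le_add ?_ (s1.sum_le_tsum _ fun i _ => hn i)
  rw [← Finset.sum_range_reflect]
  refine le_trans (le_of_eq ?_) (s1.sum_le_tsum (Finset.range n) fun i _ => hn i)
  refine Finset.sum_congr rfl fun i hi => ?_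
  have := Finset.mem_range.1 hi
  rw [show n - (n - 1 - i) = i + 1 by omega]; push_cast; rfl

lemma scale {R r : ℝ} (hr : r ≤ R * Real.exp 1) (n : ℕ) :
    r ≤ R * Real.exp (1 - n) ∨ ∃ l < n, R ≤ Real.exp l * r ∧ r ≤ R * Real.exp (1 - l) := by
  induction n with
  | zero => left; simpa using hr
  | succ n ih =>
    rcases ih with h | ⟨l, hl, h⟩
    · rcases le_or_gt R (Real.exp n * r) with h1 | h1
      · right; exact ⟨n, by omega, h1, h⟩
      · left
        push_cast
        rw [show (1 - ((n:ℝ) + 1)) = -n by ring, Real.exp_neg, ← div_eq_mul_inv, le_div_iff₀ (Real.exp_pos _)]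
        linarith
    · right; exact ⟨l, by omega, h⟩

variable {d : ℕ} {Ω : Type*} [m0 : MeasurableSpace Ω] {P : Measure Ω} [IsProbabilityMeasure P]
  {k : Eu d → ℝ} {X : ℝ → Eu d → Ω → ℝ}

lemma Q_dist {x y : Eu d} (hx : x ∈ Q d) (hy : y ∈ Q d) : ‖x - y‖ ≤ Real.sqrt d := by
  rw [EuclideanSpace.norm_eq]
  apply Real.sqrt_le_sqrt
  calc _ ≤ ∑ i : Fin d, (1:ℝ) := by
        refine Finset.sum_le_sum fun i _ => ?_
        have h1 := hx i; have h2 := hy i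
        have : |x i - y i| ≤ 1 := abs_le.2 ⟨by linarith [h1.1, h2.2], by linarith [h1.2, h2.1]⟩
        rw [Real.norm_eq_abs, sq_abs]
        simp only [PiLp.sub_apply]
        exact (sq_le_one_iff_abs_le_one _).2 this
    _ = d := by simp

/-- proximity indicator -/
def Jx (r : ℝ) (x y : Eu d) : ℝ≥0∞ := (Metric.closedBall x r).indicator (fun _ => 1) y

lemma Jx_meas (r : ℝ) (x : Eu d) : Measurable (Jx r x) := measurable_const.indicator Metric.isClosed_closedBall.measurableSet

lemma Jx_int (d : ℕ) : ∃ V : ℝ, 0 ≤ V ∧ ∀ (r : ℝ) (x : Eu d), 0 ≤ r → ∫⁻ y, Jx r x y ∂(vQ d) ≤ ENNReal.ofReal (V * r^d) := by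
  refine ⟨(volume (Metric.ball (0:Eu d) 1)).toReal, ENNReal.toReal_nonneg, fun r x hr => ?_⟩
  calc _ ≤ ∫⁻ y, Jx r x y := lintegral_mono' Measure.restrict_le_self le_rfl
    _ = volume (Metric.closedBall x r) := by
        unfold Jx; rw [lintegral_indicator Metric.isClosed_closedBall.measurableSet]; simp
    _ = _ := by
        rw [Measure.addHaar_closedBall _ _ hr, finrank_euclideanSpace, Fintype.card_fin, mul_comm, ENNReal.ofReal_mul ENNReal.toReal_nonneg,
          ENNReal.ofReal_toReal (measure_ball_lt_top).ne]

lemma FH.second (h : FH P k X) {a : ℝ} (ha : 0 < a) (ha2 : a^2 = 2*d) : ∃ C : ℝ, 0 ≤ C ∧ ∀ n : ℕ, 1 ≤ n → a/2 ≤ sl a n →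
    E (2 * d * n) * ∫⁻ x, ∫⁻ y, ∫⁻ ω, NA X (sl a n) n x ω * NA X (sl a n) n y ω ∂P ∂(vQ d) ∂(vQ d) ≤ ENNReal.ofReal C := by
  obtain ⟨R0, hR0, hsupp⟩ := h.supp
  set R := max R0 (Real.sqrt d) with hRd
  have hRp : 0 < R := lt_of_lt_of_le hR0 (le_max_left _ _)
  have hR : ∀ z, R ≤ ‖z‖ → k z = 0 := fun z hz => hsupp z ((le_max_left _ _).trans hz)
  obtain ⟨C1, hC1, hpair⟩ := h.pair ha hRp hR
  obtain ⟨C2, hC2, hup⟩ := h.NA_up ha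
  obtain ⟨V, hV, hJ⟩ := Jx_int d
  obtain ⟨S, hS, hsum⟩ := sum_n
  set W : ℝ := V * (R * Real.exp 1)^d with hW
  have hW0 : 0 ≤ W := by positivity
  set c0 : ℝ := Real.exp (3/2) * 2^(3/2:ℝ) with hc0
  refine ⟨C1 * W * (c0 * S) + C2 * W, by positivity, fun n hn hsl => ?_⟩
  have hn0 : (0:ℝ) < n := by exact_mod_cast hn
  set a' := sl a n with ha'
  have hlogn : 0 ≤ Real.log n := Real.log_nonneg (by exact_mod_cast hn)
  have hsl2 : a' ≤ a := by
    rw [ha', sl]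
    have : 0 ≤ 3/(2*a) * Real.log n / n := by positivity
    linarith
  -- weights
  let w : ℕ → ℝ := fun l => C1 * (Real.exp (-a'^2 * l / 2) / ((l:ℝ)+1)^(3/2:ℝ)) * (Real.exp (-a'^2 * (n-l:ℕ)) / ((n-l:ℕ):ℝ)^(3:ℝ))
  let wn : ℝ := C2 * Real.exp (-a'^2 * n / 2) / (n:ℝ)^(3/2:ℝ)
  have hw0 : ∀ l, 0 ≤ w l := fun l => by positivity
  have hwn0 : 0 ≤ wn := by positivity
  let rr : ℕ → ℝ := fun l => R * Real.exp (1 - l)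
  have hrr0 : ∀ l, 0 ≤ rr l := fun l => by positivity
  have hpt : ∀ x ∈ Q d, ∀ y ∈ Q d, ∫⁻ ω, NA X a' n x ω * NA X a' n y ω ∂P ≤
      ∑ l ∈ Finset.range n, ENNReal.ofReal (w l) * Jx (rr l) x y + ENNReal.ofReal wn * Jx (rr n) x y := by
    intro x hx y hy
    have hJ1 : ∀ r, ‖x - y‖ ≤ r → Jx r x y = 1 := by
      intro r hr
      unfold Jx
      rw [Set.indicator_of_mem]
      rw [Metric.mem_closedBall, dist_comm, dist_eq_norm]; exact hr
    have hxy : ‖x - y‖ ≤ R * Real.exp 1 := by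
      have q1 := Q_dist hx hy
      have q2 : Real.sqrt d ≤ R := le_max_right _ _
      have q3 : 1 ≤ Real.exp 1 := Real.one_le_exp (by norm_num)
      nlinarith
    rcases scale hxy n with hc | ⟨l, hl, hc1, hc2⟩
    · refine le_trans ?_ le_add_self
      rw [hJ1 _ hc, mul_one]
      refine le_trans (lintegral_mono fun ω => ?_) (hup a' n x hsl hsl2 hn)
      exact mul_le_of_le_one_right' (NA_le_one _ _ _ _)
    · refine le_trans ?_ le_self_add
      refine le_trans ?_ (Finset.single_le_sum (f := fun l => ENNReal.ofReal (w l) * Jx (rr l) x y) (fun _ _ => zero_le) (Finset.mem_range.2 hl))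
      rw [hJ1 _ hc2, mul_one]
      have := hpair a' l (n-l) x y hsl hsl2 (by omega) hc1 (by
        have q : Real.exp l * ‖x - y‖ ≤ Real.exp l * (R * Real.exp (1 - l)) := mul_le_mul_of_nonneg_left hc2 (Real.exp_pos _).le
        refine q.trans (le_of_eq ?_)
        rw [Real.exp_sub]; field_simp)
      rw [show l + (n - l) = n by omega] at this
      exact this
  have hrd : ∀ l : ℕ, V * (rr l)^d = W * Real.exp (-d * l) := by
    intro l
    simp only [rr, hW]
    rw [mul_pow, mul_pow, ← Real.exp_nat_mul, ← Real.exp_nat_mul, mul_assoc, mul_assoc, ← Real.exp_add]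
    congr 4; ring
  have hQae : ∀ᵐ x ∂(vQ d), x ∈ Q d := ae_restrict_mem (Q_meas d)
  have hin : ∀ x ∈ Q d, ∫⁻ y, ∫⁻ ω, NA X a' n x ω * NA X a' n y ω ∂P ∂(vQ d) ≤
      ∑ l ∈ Finset.range n, ENNReal.ofReal (w l * (W * Real.exp (-d * l))) + ENNReal.ofReal (wn * (W * Real.exp (-d * n))) := by
    intro x hx
    calc _ ≤ ∫⁻ y, (∑ l ∈ Finset.range n, ENNReal.ofReal (w l) * Jx (rr l) x y + ENNReal.ofReal wn * Jx (rr n) x y) ∂(vQ d) := by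
          refine lintegral_mono_ae ?_
          filter_upwards [hQae] with y hy
          exact hpt x hx y hy
      _ = ∑ l ∈ Finset.range n, ENNReal.ofReal (w l) * ∫⁻ y, Jx (rr l) x y ∂(vQ d) + ENNReal.ofReal wn * ∫⁻ y, Jx (rr n) x y ∂(vQ d) := by
          rw [lintegral_add_right _ ((Jx_meas _ _).const_mul _), lintegral_finsetSum _ (fun l _ => (Jx_meas _ _).const_mul _),
            lintegral_const_mul _ (Jx_meas _ _)]
          congr 1
          refine Finset.sum_congr rfl fun l _ => lintegral_const_mul _ (Jx_meas _ _)
      _ ≤ _ := by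
          refine add_le_add (Finset.sum_le_sum fun l _ => ?_) ?_
          · rw [ENNReal.ofReal_mul (hw0 l), ← hrd]
            exact mul_le_mul_right (hJ _ _ (hrr0 l)) _
          · rw [ENNReal.ofReal_mul hwn0, ← hrd]
            exact mul_le_mul_right (hJ _ _ (hrr0 n)) _
  have hout : ∫⁻ x, ∫⁻ y, ∫⁻ ω, NA X a' n x ω * NA X a' n y ω ∂P ∂(vQ d) ∂(vQ d) ≤
      ENNReal.ofReal (∑ l ∈ Finset.range n, w l * (W * Real.exp (-d * l)) + wn * (W * Real.exp (-d * n))) := by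
    rw [ENNReal.ofReal_add (Finset.sum_nonneg fun l _ => mul_nonneg (hw0 l) (by positivity)) (by positivity),
      ENNReal.ofReal_sum_of_nonneg (fun l _ => mul_nonneg (hw0 l) (by positivity))]
    refine (lintegral_mono_ae (hQae.mono fun x hx => hin x hx)).trans ?_
    rw [lintegral_const, measure_univ, mul_one]
  refine (mul_le_mul_right hout _).trans ?_
  unfold E
  rw [← ENNReal.ofReal_mul (by positivity)]
  apply ENNReal.ofReal_le_ofReal
  rw [mul_add]
  refine add_le_add ?_ ?_
  · rw [Finset.mul_sum]
    calc _ ≤ ∑ l ∈ Finset.range n, C1 * W * (c0 * (1/((n-l:ℕ):ℝ)^(3/2:ℝ) + 1/((l:ℝ)+1)^(3/2:ℝ))) := by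
          refine Finset.sum_le_sum fun l hl => ?_
          have hl := Finset.mem_range.1 hl
          have q := num1 ha ha2 (l := l) (m := n - l) (by omega)
          rw [show l + (n - l) = n by omega, ← ha'] at q
          have q2 := mul_le_mul_of_nonneg_left q (show 0 ≤ C1 * W by positivity)
          refine le_trans (le_of_eq ?_) q2
          simp only [w]; ring
      _ = C1 * W * (c0 * ∑ l ∈ Finset.range n, (1/((n-l:ℕ):ℝ)^(3/2:ℝ) + 1/((l:ℝ)+1)^(3/2:ℝ))) := by
          rw [Finset.mul_sum, Finset.mul_sum]
      _ ≤ _ := by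
          have := hsum n
          gcongr
  · have q1 : Real.exp (2 * d * n) * Real.exp (-a'^2 * n/2) * Real.exp (-d * n) ≤ (n:ℝ)^(3/2:ℝ) := by
      rw [← Real.exp_add, ← Real.exp_add, Real.rpow_def_of_pos hn0]
      apply Real.exp_le_exp.2
      have q := mul_le_mul_of_nonneg_right (sl_sq ha ha2 hn) hn0.le
      rw [← ha', sub_mul, div_mul_cancel₀ _ hn0.ne'] at q
      linarith
    have hp : (0:ℝ) < (n:ℝ)^(3/2:ℝ) := by positivity
    calc _ = C2 * W * (Real.exp (2 * d * n) * Real.exp (-a'^2 * n/2) * Real.exp (-d * n)) / (n:ℝ)^(3/2:ℝ) := by simp only [wn]; ring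
      _ ≤ C2 * W * (n:ℝ)^(3/2:ℝ) / (n:ℝ)^(3/2:ℝ) := by gcongr
      _ = _ := by field_simp

end SC



namespace SC
open scoped ENNReal
set_option linter.unusedSectionVars false

lemma log_sqrt {n : ℕ} (hn : 1 ≤ n) : Real.log n ≤ 2 * Real.sqrt n := by
  have hn0 : (0:ℝ) < n := by exact_mod_cast hn
  have h1 : Real.log (Real.sqrt n) ≤ Real.sqrt n - 1 := Real.log_le_sub_one_of_pos (Real.sqrt_pos.2 hn0)
  rw [Real.log_sqrt hn0.le] at h1
  linarith

lemma sl_ge {a : ℝ} (ha : 0 < a) {n : ℕ} (hn : 1 ≤ n) (hn2 : 36/a^4 ≤ (n:ℝ)) : a/2 ≤ sl a n := by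
  have hn0 : (0:ℝ) < n := by exact_mod_cast hn
  have h1 := log_sqrt hn
  set s := Real.sqrt n with hs
  have hsn : (n:ℝ) = s^2 := (Real.sq_sqrt hn0.le).symm
  have hs0 : 0 < s := Real.sqrt_pos.2 hn0
  have h2 : 6/a^2 ≤ s := by
    apply Real.le_sqrt_of_sq_le
    refine le_trans (le_of_eq ?_) hn2
    field_simp; norm_num
  have h3 : 6 ≤ s * a^2 := by rwa [div_le_iff₀ (by positivity)] at h2
  unfold sl
  have h4 : 3/(2*a) * Real.log n / n ≤ 3/(2*a) * (2 * s) / n := by gcongr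
  have h5 : 3/(2*a) * (2 * s) / n = 3 / (a * s) := by rw [hsn]; field_simp
  have h6 : 3/(a*s) ≤ a/2 := by
    rw [div_le_div_iff₀ (by positivity) (by norm_num)]; nlinarith
  linarith

lemma sl_sq2 {a D : ℝ} (ha : 0 < a) (ha2 : a^2 = 2*D) {n : ℕ} (hn : 1 ≤ n) :
    (n:ℝ)^(3/2:ℝ) * Real.exp (-9/(2*a^2)) ≤ Real.exp (D * n) * Real.exp (-(sl a n)^2 * n/2) := by
  have hn0 : (0:ℝ) < n := by exact_mod_cast hn
  have hl0 : 0 ≤ Real.log n := Real.log_nonneg (by exact_mod_cast hn)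
  have h1 := log_sqrt hn
  rw [Real.rpow_def_of_pos hn0, ← Real.exp_add, ← Real.exp_add]
  apply Real.exp_le_exp.2
  have e1 : D * n + -(sl a n)^2 * n/2 = 3/2 * Real.log n - 9/(8*a^2) * ((Real.log n)^2 / n) := by
    have : D = a^2/2 := by linarith
    rw [this]; unfold sl; field_simp; ring
  have e2 : (Real.log n)^2 / n ≤ 4 := by
    rw [div_le_iff₀ hn0]
    have := pow_le_pow_left₀ hl0 h1 2
    rw [mul_pow, Real.sq_sqrt hn0.le] at this
    linarith
  have e3 := mul_le_mul_of_nonneg_left e2 (show 0 ≤ 9/(8*a^2) by positivity)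
  have e4 : 9/(8*a^2) * 4 = 9/(2*a^2) := by field_simp; norm_num
  rw [e1, neg_div]
  linarith

variable {d : ℕ} {Ω : Type*} [m0 : MeasurableSpace Ω] {P : Measure Ω} [IsProbabilityMeasure P]
  {k : Eu d → ℝ} {X : ℝ → Eu d → Ω → ℝ}

/-- second moment argument -/
lemma pz {N : Ω → ℝ≥0∞} (hN : AEMeasurable N P) {c C : ℝ} (hc : 0 < c) (hC : 0 ≤ C) (h1 : ENNReal.ofReal c ≤ ∫⁻ ω, N ω ∂P)
    (h2 : ∫⁻ ω, N ω * N ω ∂P ≤ ENNReal.ofReal C) :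
    ENNReal.ofReal ((c/2) / (4*(C+1)/c)) ≤ P {ω | ENNReal.ofReal (c/4) < N ω} := by
  set K : ℝ := 4*(C+1)/c with hK
  have hK0 : 0 < K := by positivity
  set S := {ω | ENNReal.ofReal (c/4) < N ω} with hS
  have hpt : ∀ ω, N ω ≤ ENNReal.ofReal (c/4) + (S.indicator (fun _ => ENNReal.ofReal K) ω + ENNReal.ofReal K⁻¹ * (N ω * N ω)) := by
    intro ω
    rcases le_or_gt (N ω) (ENNReal.ofReal (c/4)) with q | q
    · exact q.trans le_self_add
    · refine le_trans ?_ le_add_self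
      rw [Set.indicator_of_mem (by exact q)]
      rcases le_or_gt (N ω) (ENNReal.ofReal K) with q2 | q2
      · exact q2.trans le_self_add
      · refine le_trans ?_ le_add_self
        calc N ω = ENNReal.ofReal K⁻¹ * (ENNReal.ofReal K * N ω) := by
              rw [← mul_assoc, ← ENNReal.ofReal_mul (by positivity), inv_mul_cancel₀ hK0.ne']; simp
          _ ≤ _ := mul_le_mul_right (mul_le_mul_left q2.le _) _
  have hNN : AEMeasurable (fun ω => ENNReal.ofReal K⁻¹ * (N ω * N ω)) P := (hN.mul hN).const_mul _
  have h3 : ENNReal.ofReal c ≤ ENNReal.ofReal (c/4) + (ENNReal.ofReal K * P S + ENNReal.ofReal (c/4)) := by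
    calc _ ≤ _ := h1
      _ ≤ ∫⁻ ω, (ENNReal.ofReal (c/4) + (S.indicator (fun _ => ENNReal.ofReal K) ω + ENNReal.ofReal K⁻¹ * (N ω * N ω))) ∂P := lintegral_mono hpt
      _ = ENNReal.ofReal (c/4) + (∫⁻ ω, S.indicator (fun _ => ENNReal.ofReal K) ω ∂P + ENNReal.ofReal K⁻¹ * ∫⁻ ω, N ω * N ω ∂P) := by
          rw [lintegral_add_left measurable_const, lintegral_const, measure_univ, mul_one,
            lintegral_add_right' _ hNN, lintegral_const_mul' _ _ ENNReal.ofReal_ne_top]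
      _ ≤ _ := by
          refine add_le_add le_rfl (add_le_add (lintegral_indicator_const_le _ _) ?_)
          refine (mul_le_mul_right h2 _).trans ?_
          rw [← ENNReal.ofReal_mul (by positivity)]
          apply ENNReal.ofReal_le_ofReal
          rw [hK, inv_div, div_mul_eq_mul_div, div_le_div_iff₀ (by positivity) (by norm_num)]
          nlinarith
  have hp : P S = ENNReal.ofReal (P S).toReal := (ENNReal.ofReal_toReal (measure_ne_top _ _)).symm
  set p := (P S).toReal with hpd
  have hp0 : 0 ≤ p := ENNReal.toReal_nonneg
  rw [hp] at h3 ⊢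
  rw [← ENNReal.ofReal_mul hK0.le, ← ENNReal.ofReal_add (by positivity) (by positivity), ← ENNReal.ofReal_add (by positivity) (by positivity),
    ENNReal.ofReal_le_ofReal_iff (by positivity)] at h3
  apply ENNReal.ofReal_le_ofReal
  rw [div_le_iff₀ hK0]
  linarith

lemma FH.NA_jm (h : FH P k X) {α : Type*} [MeasurableSpace α] (μ : Measure α) [SFinite μ] {g : α → Eu d} (hg : Measurable g)
    (a' : ℝ) (n : ℕ) : AEMeasurable (fun p : Ω × α => NA X a' n (g p.2) p.1) (P.prod μ) :=
  (h.pp_jm μ hg _ 0 n).mul ((ind_meas _ _).comp_aemeasurable (h.jm μ hg n))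

set_option maxHeartbeats 2000000 in
lemma FH.nontriv (h : FH P k X) (hd : 1 ≤ d) {γ : ℝ} (hγ : Real.sqrt (2*(d:ℝ)) < γ) {Y : ℝ → Ω → ℝ}
    (hY : ∀ (t : ℝ) (ω : Ω), Y t ω =
      t ^ (3 * γ / (2 * Real.sqrt (2 * (d:ℝ)))) *
        Real.exp (t * (γ / Real.sqrt 2 - Real.sqrt (d:ℝ)) ^ 2) *
        ∫ x in {x : EuclideanSpace ℝ (Fin d) | ∀ i, x i ∈ Set.Icc (0:ℝ) 1},
          Real.exp (γ * X t x ω - γ ^ 2 / 2 * t)) :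
    ∃ δ κ t0 : ℝ, 0 < δ ∧ 0 < κ ∧ 1 ≤ t0 ∧ ∀ t, t0 ≤ t → ENNReal.ofReal κ ≤ P {ω | δ ≤ Y t ω} := by
  have hd0 : (0:ℝ) < d := by exact_mod_cast hd
  set a := Real.sqrt (2*(d:ℝ)) with haD
  have ha : 0 < a := Real.sqrt_pos.2 (by positivity)
  have ha2 : a^2 = 2*d := Real.sq_sqrt (by positivity)
  have hγ0 : 0 < γ := ha.trans hγ
  obtain ⟨c, hc, hlow⟩ := PA_low
  obtain ⟨C, hC, hsec⟩ := h.second ha ha2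
  set c1 : ℝ := c * Real.exp (-9/(2*a^2)) with hc1
  have hc1p : 0 < c1 := by positivity
  set C1 : ℝ := 2 * Real.exp (2 * γ^2) * C with hC1
  have hC1n : 0 ≤ C1 := by positivity
  set c2 : ℝ := Real.exp (-γ - |d - γ * a|) with hc2
  have hc2p : 0 < c2 := Real.exp_pos _
  clear_value c1 C1 c2
  have hκ : 0 < (c1/2) / (4*(C1+1)/c1) := by positivity
  have hδ : 0 < c2 * (c1/4) := by positivity
  refine ⟨c2 * (c1/4), (c1/2) / (4*(C1+1)/c1), 36/a^4 + 4, hδ, hκ, ?_, fun t ht => ?_⟩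
  · have : 0 ≤ 36/a^4 := by positivity
    linarith
  have hq : 0 ≤ 36/a^4 := by positivity
  have ht0 : 0 < t := by linarith
  set n := ⌊t⌋₊ with hn
  have hnt : (n:ℝ) ≤ t := Nat.floor_le ht0.le
  have htn : t ≤ n + 1 := (Nat.lt_floor_add_one t).le
  have hn3 : 3 ≤ n := by
    rw [hn]; apply Nat.le_floor; push_cast; linarith
  have hn1 : 1 ≤ n := by omega
  have hn0 : (0:ℝ) < n := by exact_mod_cast hn1
  have hsl := sl_ge ha hn1 (by linarith)
  set a' := sl a n with ha'
  have ha'0 : 0 ≤ a' := by linarith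
  obtain ⟨hYn, hYr⟩ := h.Yrep hY (t := t) ht0.le
  rw [← haD] at hYr
  -- the truncated mass
  let F : Ω × Eu d → ℝ≥0∞ := fun q => NA X a' n q.2 q.1 * E (γ * (X t q.2 q.1 - X n q.2 q.1))
  have hFg : ∀ {α : Type} [MeasurableSpace α] (μ : Measure α) [SFinite μ] {g : α → Eu d}, Measurable g →
      AEMeasurable (fun q : Ω × α => F (q.1, g q.2)) (P.prod μ) := by
    intro α _ μ _ g hg
    refine (h.NA_jm μ hg a' n).mul ?_
    have hm : Measurable fun z => E (γ * z) := by fun_prop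
    exact hm.comp_aemeasurable ((h.jm μ hg t).sub (h.jm μ hg n))
  have hFm : AEMeasurable F (P.prod (vQ d)) := by
    have hid := hFg (vQ d) (g := fun x => x) measurable_id
    exact hid
  let N : Ω → ℝ≥0∞ := fun ω => E (d * n) * ∫⁻ x, F (ω, x) ∂(vQ d)
  have hNm : AEMeasurable N P := (hFm.lintegral_prod_right').const_mul _
  have hN1 : ENNReal.ofReal c1 ≤ ∫⁻ ω, N ω ∂P := by
    simp only [N]
    rw [lintegral_const_mul' _ _ (E_ne_top _), lintegral_lintegral_swap (f := fun ω x => F (ω, x)) hFm]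
    have q1 : ∀ x, ENNReal.ofReal (c * Real.exp (-a'^2 * n / 2) / (n:ℝ)^(3/2:ℝ)) ≤ ∫⁻ ω, F (ω, x) ∂P := by
      intro x
      have := h.frac hn0.le hnt γ (NA_meas X a' n x) x
      simp only [F]
      rw [this, h.NA_int]
      have hone : 1 ≤ E (γ^2 * (t - n) / 2) := by
        rw [← E_zero]
        apply E_mono
        have : 0 ≤ t - n := by linarith
        positivity
      have hmul := mul_le_mul_left hone (Wk (fun i => a' * (i:ℝ)) n (ind (a' * n - 1) (a' * n)) 0)
      rw [one_mul] at hmul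
      exact (hlow a' n ha'0 hn3).trans hmul
    calc _ ≤ E (d * n) * ∫⁻ x, ENNReal.ofReal (c * Real.exp (-a'^2 * n / 2) / (n:ℝ)^(3/2:ℝ)) ∂(vQ d) := by
          rw [lintegral_const, measure_univ, mul_one]
          unfold E
          rw [← ENNReal.ofReal_mul (by positivity)]
          apply ENNReal.ofReal_le_ofReal
          have q := sl_sq2 ha ha2 hn1
          rw [← ha'] at q
          have hp : (0:ℝ) < (n:ℝ)^(3/2:ℝ) := by positivity
          calc c1 = c * ((n:ℝ)^(3/2:ℝ) * Real.exp (-9/(2*a^2))) / (n:ℝ)^(3/2:ℝ) := by rw [hc1]; field_simp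
            _ ≤ c * (Real.exp (d * n) * Real.exp (-a'^2 * n/2)) / (n:ℝ)^(3/2:ℝ) := by gcongr
            _ = _ := by ring
      _ ≤ _ := mul_le_mul_right (lintegral_mono q1) _
  have hN2 : ∫⁻ ω, N ω * N ω ∂P ≤ ENNReal.ofReal C1 := by
    have hsl : ∀ᵐ ω ∂P, AEMeasurable (fun x => F (ω, x)) (vQ d) := by
      filter_upwards [Measure.ae_ae_of_ae_prod hFm.ae_eq_mk] with ω hω
      exact ⟨fun x => hFm.mk F (ω, x), hFm.measurable_mk.comp measurable_prodMk_left, hω⟩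
    let G2 : Ω × (Eu d × Eu d) → ℝ≥0∞ := fun q => F (q.1, q.2.1) * F (q.1, q.2.2)
    have hG2 : AEMeasurable G2 (P.prod ((vQ d).prod (vQ d))) :=
      (hFg ((vQ d).prod (vQ d)) measurable_fst).mul (hFg ((vQ d).prod (vQ d)) measurable_snd)
    have e1 : ∫⁻ ω, N ω * N ω ∂P = ∫⁻ ω, E (2 * d * n) * ∫⁻ q, G2 (ω, q) ∂((vQ d).prod (vQ d)) ∂P := by
      refine lintegral_congr_ae ?_
      filter_upwards [hsl] with ω hω
      simp only [N, G2]
      rw [lintegral_prod_mul hω hω, show 2 * (d:ℝ) * n = d * n + d * n by ring, E_add]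
      ring
    rw [e1, lintegral_const_mul' _ _ (E_ne_top _), lintegral_lintegral_swap (f := fun ω q => G2 (ω, q)) hG2]
    have q1 : ∀ x y, ∫⁻ ω, G2 (ω, (x, y)) ∂P ≤ ENNReal.ofReal (2 * Real.exp (2 * γ^2)) * ∫⁻ ω, NA X a' n x ω * NA X a' n y ω ∂P := by
      intro x y
      have q2 := h.frac2 hn0.le hnt γ (H := fun ω => NA X a' n x ω * NA X a' n y ω) (Measurable.mul (NA_meas X a' n x) (NA_meas X a' n y)) x y
      calc _ = ∫⁻ ω, NA X a' n x ω * NA X a' n y ω * (E (γ * (X t x ω - X n x ω)) * E (γ * (X t y ω - X n y ω))) ∂P := by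
            congr 1
            funext ω
            simp only [G2, F]; ring
        _ ≤ _ := q2
        _ ≤ _ := by
            refine mul_le_mul_left ?_ _
            rw [ENNReal.ofReal_mul (by norm_num), ENNReal.ofReal_ofNat]
            refine mul_le_mul_right (E_mono ?_) _
            have : 0 ≤ 2 * γ^2 := by positivity
            nlinarith
    have hm : AEMeasurable (fun q => ∫⁻ ω, G2 (ω, q) ∂P) ((vQ d).prod (vQ d)) := hG2.lintegral_prod_left'
    rw [lintegral_prod _ hm]
    calc _ ≤ E (2 * d * n) * ∫⁻ x, ∫⁻ y, ENNReal.ofReal (2 * Real.exp (2 * γ^2)) * ∫⁻ ω, NA X a' n x ω * NA X a' n y ω ∂P ∂(vQ d) ∂(vQ d) :=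
          mul_le_mul_right (lintegral_mono fun x => lintegral_mono fun y => q1 x y) _
      _ = ENNReal.ofReal (2 * Real.exp (2 * γ^2)) * (E (2 * d * n) * ∫⁻ x, ∫⁻ y, ∫⁻ ω, NA X a' n x ω * NA X a' n y ω ∂P ∂(vQ d) ∂(vQ d)) := by
          simp_rw [lintegral_const_mul' _ _ ENNReal.ofReal_ne_top]
          ring
      _ ≤ ENNReal.ofReal (2 * Real.exp (2 * γ^2)) * ENNReal.ofReal C := mul_le_mul_right (hsec n hn1 (by assumption)) _
      _ = _ := by rw [← ENNReal.ofReal_mul (by positivity), hC1]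
  have hYN : ∀ᵐ ω ∂P, ENNReal.ofReal c2 * N ω ≤ ENNReal.ofReal (Y t ω) := by
    filter_upwards [hYr] with ω hω
    rw [hω]
    simp only [N]
    rw [← mul_assoc, ← lintegral_const_mul' _ _ (ENNReal.mul_ne_top ENNReal.ofReal_ne_top (E_ne_top _)),
      ← lintegral_const_mul' _ _ ENNReal.ofReal_ne_top]
    refine lintegral_mono fun x => ?_
    simp only [F]
    by_cases hin : X n x ω ∈ Set.Icc (a' * n - 1) (a' * n)
    swap
    · have : NA X a' n x ω = 0 := by
        unfold NA ind; rw [Set.indicator_of_notMem hin, mul_zero]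
      rw [this]; simp
    calc _ ≤ ENNReal.ofReal c2 * E (d * n) * (1 * E (γ * (X t x ω - X n x ω))) :=
          mul_le_mul_right (mul_le_mul_left (NA_le_one _ _ _ _) _) _
      _ ≤ _ := by
          set p := 3 * γ / (2 * a) with hp
          have q1 : E (p * Real.log n) ≤ ENNReal.ofReal (t^p) := by
            unfold E
            apply ENNReal.ofReal_le_ofReal
            rw [mul_comm, ← Real.rpow_def_of_pos hn0]
            exact Real.rpow_le_rpow hn0.le hnt (by positivity)
          refine le_trans ?_ (mul_le_mul_left q1 _)
          rw [one_mul, hc2]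
          change E _ * _ * _ ≤ _
          rw [← E_add, ← E_add, ← E_add]
          apply E_mono
          have q2 : a' * n = a * n - 3/(2*a) * Real.log n := by
            rw [ha', sl]; field_simp
          have q3 : γ * (a' * n - 1) ≤ γ * X n x ω := mul_le_mul_of_nonneg_left hin.1 hγ0.le
          have q4 : γ * (a' * n) = γ * a * n - p * Real.log n := by
            rw [q2, hp]; field_simp
          have q5 : -|d - γ * a| ≤ (d - γ * a) * (t - n) := by
            have r1 : -|d - γ * a| ≤ d - γ * a := neg_abs_le _
            have r2 : 0 ≤ |d - γ * a| := abs_nonneg _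
            have r3 : 0 ≤ t - n := by linarith
            have r4 : t - n ≤ 1 := by linarith
            nlinarith
          nlinarith
  refine (pz hNm hc1p hC1n hN1 hN2).trans (measure_mono_ae ?_)
  filter_upwards [hYN] with ω h1 h2
  have h2' : ENNReal.ofReal (c1/4) < N ω := h2
  show c2 * (c1/4) ≤ Y t ω
  have h3 : ENNReal.ofReal (c2 * (c1/4)) ≤ ENNReal.ofReal (Y t ω) := by
    rw [ENNReal.ofReal_mul hc2p.le]
    exact (mul_le_mul_right h2'.le _).trans h1
  exact (ENNReal.ofReal_le_ofReal_iff (hYn ω)).1 h3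

end SC

theorem supercritical_renormalized_tight
    {d : ℕ} (hd : 1 ≤ d)
    {Ω : Type*} [m0 : MeasurableSpace Ω] (P : Measure Ω) [IsProbabilityMeasure P]
    (k : EuclideanSpace ℝ (Fin d) → ℝ)
    (hk1 : ContDiff ℝ 1 k) (hk0 : k 0 = 1) (hkb : ∀ z, |k z| ≤ 1)
    (hksupp : HasCompactSupport k)
    (hkpd : ∀ (n : ℕ) (z : Fin n → EuclideanSpace ℝ (Fin d)) (c : Fin n → ℝ),
      0 ≤ ∑ i, ∑ j, c i * c j * k (z i - z j))
    (X : ℝ → EuclideanSpace ℝ (Fin d) → Ω → ℝ)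
    (hXmeas : ∀ t x, Measurable (X t x))
    (hXgauss : ∀ (n : ℕ) (c : Fin n → ℝ) (t : Fin n → ℝ)
        (x : Fin n → EuclideanSpace ℝ (Fin d)),
      ∃ v : NNReal,
        Measure.map (fun ω => ∑ i, c i * X (t i) (x i) ω) P = gaussianReal 0 v)
    (hXcent : ∀ t x, ∫ ω, X t x ω ∂P = 0)
    (hXcov : ∀ t, 0 ≤ t → ∀ x y : EuclideanSpace ℝ (Fin d),
      ∫ ω, X t x ω * X t y ω ∂P = ∫ u in Set.Icc (1:ℝ) (Real.exp t), k (u • (x - y)) / u)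
    (hXcont : ∀ᵐ ω ∂P, Continuous fun p : ℝ × EuclideanSpace ℝ (Fin d) => X p.1 p.2 ω)
    (hXindep : ∀ s t : ℝ, 0 ≤ s → s < t →
      Indep (⨆ x : EuclideanSpace ℝ (Fin d),
          MeasurableSpace.comap (fun ω => X t x ω - X s x ω) inferInstance)
        (⨆ u ∈ Set.Icc (0:ℝ) s, ⨆ x : EuclideanSpace ℝ (Fin d),
          MeasurableSpace.comap (X u x) inferInstance) P)
    (γ : ℝ) (hγ : Real.sqrt (2 * (d:ℝ)) < γ)
    (Y : ℝ → Ω → ℝ)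
    (hY : ∀ (t : ℝ) (ω : Ω), Y t ω =
      t ^ (3 * γ / (2 * Real.sqrt (2 * (d:ℝ)))) *
        Real.exp (t * (γ / Real.sqrt 2 - Real.sqrt (d:ℝ)) ^ 2) *
        ∫ x in {x : EuclideanSpace ℝ (Fin d) | ∀ i, x i ∈ Set.Icc (0:ℝ) 1},
          Real.exp (γ * X t x ω - γ ^ 2 / 2 * t)) :
    (∀ ε : ℝ, 0 < ε → ∃ M : ℝ, ∀ t : ℝ, 1 ≤ t →
        P {ω | M < |Y t ω|} ≤ ENNReal.ofReal ε) ∧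
    ∀ tn : ℕ → ℝ, Tendsto tn atTop atTop →
      ∀ ν : Measure ℝ, IsProbabilityMeasure ν →
        (∀ f : BoundedContinuousFunction ℝ ℝ,
          Tendsto (fun n => ∫ ω, f (Y (tn n) ω) ∂P) atTop (nhds (∫ x, f x ∂ν))) →
        ν ≠ Measure.dirac 0 := by
  have h : SC.FH P k X := ⟨hk1, hk0, hkb, hksupp, hXmeas, hXgauss, hXcent, hXcov, hXcont, hXindep⟩
  refine ⟨h.tight hd hγ hY, ?_⟩
  intro tn htn ν hν hconv hνd
  obtain ⟨δ, κ, t0, hδ, hκ, ht0, hlow⟩ := h.nontriv hd hγ hY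
  let f : BoundedContinuousFunction ℝ ℝ :=
    BoundedContinuousFunction.ofNormedAddCommGroup (fun x => min 1 (|x| / δ)) (by fun_prop) 1 (by
      intro x
      have h1 : 0 ≤ min 1 (|x| / δ) := le_min zero_le_one (by positivity)
      rw [Real.norm_of_nonneg h1]
      exact min_le_left _ _)
  have hf : ∀ x, f x = min 1 (|x| / δ) := fun x => rfl
  have h0 : ∫ x, f x ∂ν = 0 := by
    rw [hνd, integral_dirac, hf]
    simp
  have hc := hconv f
  rw [h0] at hc
  have hk : ∀ᶠ n in atTop, κ ≤ ∫ ω, f (Y (tn n) ω) ∂P := by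
    filter_upwards [htn.eventually_ge_atTop t0] with n hn
    have hm : AEMeasurable (Y (tn n)) P := h.Y_aem hY (by linarith)
    have hfn : ∀ x, 0 ≤ f x := fun x => by
      rw [hf]; exact le_min zero_le_one (by positivity)
    have hi : Integrable (fun ω => f (Y (tn n) ω)) P := by
      refine Integrable.of_bound (f.continuous.measurable.comp_aemeasurable hm).aestronglyMeasurable 1
        (ae_of_all _ fun ω => ?_)
      rw [Real.norm_of_nonneg (hfn _), hf]
      exact min_le_left _ _
    have hmk := mul_meas_ge_le_integral_of_nonneg (ae_of_all P fun ω => hfn (Y (tn n) ω)) hi 1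
    rw [one_mul] at hmk
    refine le_trans ?_ hmk
    have h1 := (hlow (tn n) hn).trans (measure_mono (μ := P)
      (t := {ω | 1 ≤ f (Y (tn n) ω)}) (fun ω (hω : δ ≤ Y (tn n) ω) => by
        show 1 ≤ f (Y (tn n) ω)
        rw [hf]
        exact le_min le_rfl ((one_le_div hδ).2 (hω.trans (le_abs_self _)))))
    exact (ENNReal.ofReal_le_iff_le_toReal (measure_ne_top _ _)).1 h1
  exact absurd (ge_of_tendsto hc hk) (not_le.2 hκ)
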